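/- arXiv:0906.4770 — 4 statements merged into one kernel-verified Lean document; each statement's English description precedes it below -/
import Mathlib

section
/- There exist a constant C < ∞ and h₀ > 0 such that for all 0 < h ≤ h₀, ∫_ℝ w(x)² dx ≤ C/(h·ψ(1/h)²). -/
noncomputable def pdens (ψ : ℝ → ℝ) (s x : ℝ) : ℝ :=
  (1 / Real.pi) * ∫ p in Set.Ioi (0:ℝ), Real.cos (p * x) * Real.exp (-s * ψ p)

noncomputable def wfun (ψ : ℝ → ℝ) (h x : ℝ) : ℝ :=
  ∫ s in (0:ℝ)..1, |2 * pdens ψ s x - pdens ψ s (x + h) - pdens ψ s (x - h)|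

open MeasureTheory Set Filter Topology
open scoped ENNReal FourierTransform SchwartzMap ContDiff

lemma aux_scale (f : ℝ → ℝ≥0∞) {a : ℝ} (ha : 0 < a) :
    ∫⁻ x, f (a * x) = ENNReal.ofReal a⁻¹ * ∫⁻ x, f x := by
  have h := lintegral_map_equiv (μ := volume) f (Homeomorph.mulLeft₀ a ha.ne').toMeasurableEquiv
  have e : ((Homeomorph.mulLeft₀ a ha.ne').toMeasurableEquiv : ℝ → ℝ) = fun x => a * x := by
    ext x; simp
  rw [e, Real.map_volume_mul_left ha.ne', lintegral_smul_measure, abs_of_pos (by positivity)] at h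
  rw [← h, smul_eq_mul]

lemma aux_scale_Ioi (f : ℝ → ℝ≥0∞) {a : ℝ} (ha : 0 < a) :
    ∫⁻ x in Ioi (0:ℝ), f (a * x) = ENNReal.ofReal a⁻¹ * ∫⁻ x in Ioi (0:ℝ), f x := by
  rw [← lintegral_indicator measurableSet_Ioi, ← lintegral_indicator measurableSet_Ioi,
    ← aux_scale _ ha]
  congr 1
  ext x
  by_cases hx : 0 < x
  · have : 0 < a * x := by positivity
    simp [indicator, hx, this]
  · have : ¬ 0 < a * x := by
      rw [mul_pos_iff_of_pos_left ha]; exact hx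
    simp [indicator, hx, this]

lemma aux_fourier_ae (G : ℝ → ℂ) (h1 : Integrable G) (h2 : MemLp G 2 volume) :
    ∀ᵐ x, ((𝓕 (h2.toLp G) : Lp (α := ℝ) ℂ 2 volume) : ℝ → ℂ) x = 𝓕 G x := by
  apply ae_eq_of_integral_contDiff_smul_eq
  · exact (Lp.memLp _).locallyIntegrable (by norm_num)
  · have : Continuous (𝓕 G) :=
      VectorFourier.fourierIntegral_continuous Real.continuous_fourierChar
        (by exact continuous_inner) h1
    exact this.locallyIntegrable
  · intro g g_smooth g_cpt
    have hg₁ : HasCompactSupport (Complex.ofRealCLM ∘ g) := g_cpt.comp_left rfl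
    have hg₂ : ContDiff ℝ ∞ (Complex.ofRealCLM ∘ g) := by fun_prop
    set φ := hg₁.toSchwartzMap hg₂ with hφ
    have e1 : ∫ x, g x • ((𝓕 (h2.toLp G) : Lp (α := ℝ) ℂ 2 volume) : ℝ → ℂ) x
       = Lp.toTemperedDistribution (𝓕 (h2.toLp G) : Lp (α := ℝ) ℂ 2 volume) φ := by
      simp [hφ]
    rw [e1, ← Lp.fourier_toTemperedDistribution_eq, TemperedDistribution.fourier_apply,
      Lp.toTemperedDistribution_apply]
    have e2 : ∫ x, (𝓕 φ) x • (h2.toLp G) x = ∫ x, (𝓕 φ) x • G x := by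
      apply integral_congr_ae
      filter_upwards [h2.coeFn_toLp] with x hx
      rw [hx]
    rw [e2]
    have := VectorFourier.integral_fourierIntegral_smul_eq_flip (μ := volume) (ν := volume)
      (L := innerₗ ℝ) (f := (φ : ℝ → ℂ)) (g := G) Real.continuous_fourierChar
        (by exact continuous_inner) φ.integrable h1
    rw [SchwartzMap.fourier_coe]
    refine Eq.trans this ?_
    rw [flip_innerₗ]
    apply integral_congr_ae
    filter_upwards with x
    have e3 : φ x = (g x : ℂ) := by simp [hφ]
    rw [e3, Complex.real_smul, smul_eq_mul]
    rfl

lemma aux_planch (G : ℝ → ℂ) (h1 : Integrable G) (h2 : MemLp G 2 volume) :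
    ∫⁻ x, ‖𝓕 G x‖ₑ ^ 2 = ∫⁻ x, ‖G x‖ₑ ^ 2 := by
  have key : eLpNorm (𝓕 G) 2 volume = eLpNorm G 2 volume := by
    have h := Lp.norm_fourier_eq (h2.toLp G)
    rw [Lp.norm_def, Lp.norm_toLp, ENNReal.toReal_eq_toReal_iff' (Lp.eLpNorm_ne_top _) h2.2.ne] at h
    rw [← h]
    exact (eLpNorm_congr_ae (aux_fourier_ae G h1 h2)).symm
  have h := congrArg (fun t => t ^ (2:ℕ)) key
  have e : ∀ F : ℝ → ℂ, eLpNorm F 2 volume ^ 2 = ∫⁻ x, ‖F x‖ₑ ^ 2 := by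
    intro F
    have := eLpNorm_nnreal_pow_eq_lintegral (f := F) (μ := volume) (p := 2) (by norm_num)
    have h2 : ((2:NNReal):ℝ) = ((2:ℕ):ℝ) := by norm_num
    rw [h2] at this
    simp only [ENNReal.rpow_natCast] at this
    exact_mod_cast this
  simpa only [e] using h

lemma aux_cos_planch (G : ℝ → ℝ) (h1 : IntegrableOn G (Ioi 0))
    (h2 : MemLp G 2 (volume.restrict (Ioi 0))) :
    ∫⁻ x : ℝ, ‖∫ p in Ioi (0:ℝ), Real.cos (p * x) * G p‖ₑ ^ 2 ≤
      ENNReal.ofReal (2 * Real.pi) * ∫⁻ p in Ioi (0:ℝ), ‖G p‖ₑ ^ 2 := by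
  set H : ℝ → ℂ := (Ioi (0:ℝ)).indicator (fun p => (G p : ℂ)) with hH
  have H1 : Integrable H := by
    rw [hH, integrable_indicator_iff measurableSet_Ioi]
    exact h1.ofReal
  have H2 : MemLp H 2 volume := by
    rw [hH, memLp_indicator_iff_restrict measurableSet_Ioi]
    exact h2.ofReal
  have hpt : ∀ x : ℝ, ‖∫ p in Ioi (0:ℝ), Real.cos (p * x) * G p‖ₑ ≤ ‖𝓕 H ((2 * Real.pi)⁻¹ * x)‖ₑ := by
    intro x
    have hint : Integrable (fun v : ℝ => Complex.exp (((-2 * Real.pi * v * ((2 * Real.pi)⁻¹ * x)) : ℝ) * Complex.I) • (G v : ℂ)) (volume.restrict (Ioi 0)) := by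
      refine Integrable.bdd_mul (c := 1) h1.ofReal ?_ ?_
      · apply Continuous.aestronglyMeasurable
        fun_prop
      · filter_upwards with v
        rw [Complex.norm_exp_ofReal_mul_I]
    have e : ∫ p in Ioi (0:ℝ), Real.cos (p * x) * G p = (𝓕 H ((2 * Real.pi)⁻¹ * x)).re := by
      rw [Real.fourier_real_eq_integral_exp_smul]
      have : (fun v : ℝ => Complex.exp (((-2 * Real.pi * v * ((2 * Real.pi)⁻¹ * x)) : ℝ) * Complex.I) • H v)
        = (Ioi (0:ℝ)).indicator (fun v => Complex.exp (((-2 * Real.pi * v * ((2 * Real.pi)⁻¹ * x)) : ℝ) * Complex.I) • (G v : ℂ)) := by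
        ext v
        by_cases hv : v ∈ Ioi (0:ℝ) <;> simp [hH, hv]
      rw [this, integral_indicator measurableSet_Ioi]
      have h3 := integral_re (𝕜 := ℂ) hint
      simp only [RCLike.re_to_complex] at h3
      rw [← h3]
      apply integral_congr_ae
      filter_upwards with v
      have : -2 * Real.pi * v * ((2 * Real.pi)⁻¹ * x) = -(v * x) := by
        field_simp
      rw [this, smul_eq_mul, Complex.re_mul_ofReal, Complex.exp_ofReal_mul_I_re, Real.cos_neg]
    rw [e]
    rw [← ofReal_norm, ← ofReal_norm]
    exact ENNReal.ofReal_le_ofReal (Complex.abs_re_le_norm _)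
  calc _ ≤ ∫⁻ x : ℝ, ‖𝓕 H ((2 * Real.pi)⁻¹ * x)‖ₑ ^ 2 := by
        apply lintegral_mono
        intro x
        have := hpt x
        dsimp only
        gcongr
    _ = ENNReal.ofReal (2 * Real.pi) * ∫⁻ x : ℝ, ‖𝓕 H x‖ₑ ^ 2 := by
        rw [aux_scale (fun x => ‖𝓕 H x‖ₑ ^ 2) (a := (2 * Real.pi)⁻¹) (by positivity), inv_inv]
    _ = _ := by
        rw [aux_planch H H1 H2]
        congr 1
        rw [← lintegral_indicator measurableSet_Ioi]
        congr 1
        ext p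
        by_cases hv : p ∈ Ioi (0:ℝ)
        · simp only [hH, hv, indicator_of_mem]
          rw [← ofReal_norm, ← ofReal_norm, Complex.norm_real]
        · simp [hH, hv]
lemma aux_doubling (ψ : ℝ → ℝ) (hpos : ∀ p : ℝ, p ≠ 0 → 0 < ψ p)
    (hdiff1 : ∀ p : ℝ, 0 < p → DifferentiableAt ℝ ψ p) (D₁ : ℝ)
    (hD1 : ∀ l : ℝ, 1 ≤ l → l * |deriv ψ l| ≤ D₁ * ψ l) {x y : ℝ} (hx : 1 ≤ x) (hxy : x ≤ y)
    (hy : y ≤ 2 * x) : ψ y ≤ Real.exp D₁ * ψ x ∧ ψ x ≤ Real.exp D₁ * ψ y := by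
  have hD : 0 ≤ D₁ := by
    have h1 := hD1 1 le_rfl
    have h2 : 0 < ψ 1 := hpos 1 (by norm_num)
    have h3 : 0 ≤ D₁ * ψ 1 := le_trans (by positivity) h1
    exact nonneg_of_mul_nonneg_left h3 h2
  have hd : ∀ z ∈ Icc x y, DifferentiableAt ℝ (fun t => Real.log (ψ t)) z := by
    intro z hz
    have hz0 : 0 < z := by linarith [hz.1]
    exact (hdiff1 z hz0).log (hpos z hz0.ne').ne'
  have hb : ∀ z ∈ Icc x y, ‖deriv (fun t => Real.log (ψ t)) z‖ ≤ D₁ / x := by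
    intro z hz
    have hz0 : 0 < z := by linarith [hz.1]
    have hp := hpos z hz0.ne'
    rw [deriv.log (hdiff1 z hz0) hp.ne', Real.norm_eq_abs, abs_div, abs_of_pos hp,
      div_le_div_iff₀ hp (by linarith)]
    have := hD1 z (by linarith [hz.1])
    have h3 : |deriv ψ z| * x ≤ |deriv ψ z| * z := by
      gcongr; exact hz.1
    linarith
  have h := Convex.norm_image_sub_le_of_norm_deriv_le hd hb (convex_Icc x y)
    (left_mem_Icc.2 hxy) (right_mem_Icc.2 hxy)
  have h' : |Real.log (ψ y) - Real.log (ψ x)| ≤ D₁ := by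
    refine le_trans h ?_
    rw [Real.norm_eq_abs, abs_of_nonneg (by linarith), div_mul_eq_mul_div, div_le_iff₀ (by linarith)]
    gcongr; linarith
  have px := hpos x (by linarith)
  have py := hpos y (by linarith)
  rw [abs_le] at h'
  constructor
  · rw [← Real.log_le_log_iff py (by positivity), Real.log_mul (by positivity) px.ne', Real.log_exp]
    linarith
  · rw [← Real.log_le_log_iff px (by positivity), Real.log_mul (by positivity) py.ne', Real.log_exp]
    linarith

lemma aux_dyadic {x y : ℝ} (hx : 0 < x) (hxy : x ≤ y) :
    ∃ n : ℕ, 2 ^ n * x ≤ y ∧ y ≤ 2 * (2 ^ n * x) := by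
  obtain ⟨n, h1, h2⟩ := exists_nat_pow_near (x := y / x) (y := (2:ℝ)) (by rwa [one_le_div hx]) (by norm_num)
  refine ⟨n, ?_, ?_⟩
  · rwa [le_div_iff₀ hx] at h1
  · rw [div_lt_iff₀ hx, pow_succ] at h2
    linarith

lemma aux_lower (β : ℝ) (hβ1 : 1 < β) (hβ2 : β ≤ 2)
    (ψ : ℝ → ℝ)
    (hpos : ∀ p : ℝ, p ≠ 0 → 0 < ψ p)
    (hRV : ∀ l : ℝ, 0 < l →
      Filter.Tendsto (fun x => ψ (l * x) / ψ x) Filter.atTop (nhds (l ^ β)))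
    (hdiff1 : ∀ p : ℝ, 0 < p → DifferentiableAt ℝ ψ p)
    (D₁ : ℝ)
    (hD1 : ∀ l : ℝ, 1 ≤ l → l * |deriv ψ l| ≤ D₁ * ψ l)
    (C₀ : ℝ) (hC0 : ∀ p : ℝ, ψ p ≤ C₀ * p ^ 2)
    (hliminf : 0 < Filter.liminf (fun p : ℝ => ψ p / p ^ 2) (nhdsWithin (0:ℝ) ({0}ᶜ))) :
    ∃ c R₀ : ℝ, 0 < c ∧ 1 ≤ R₀ ∧ ∀ R, R₀ ≤ R → (∀ p, R ≤ p → c * (p / R) * ψ R ≤ ψ p) ∧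
      (∀ p, 0 < p → p ≤ R → c * (p / R) ^ (9/4 : ℝ) * ψ R ≤ ψ p) := by
  have hC0pos : 0 < C₀ := by
    have h1 := hC0 1
    have h2 := hpos 1 (by norm_num)
    linarith
  -- eventual doubling inequalities
  obtain ⟨X, hX⟩ : ∃ X : ℝ, ∀ x, X ≤ x → 2 < ψ (2 * x) / ψ x ∧ ψ (2 * x) / ψ x < 2 ^ (9/4 : ℝ) := by
    have h2 := hRV 2 (by norm_num)
    have a1 : (2:ℝ) < 2 ^ β := by
      calc (2:ℝ) = 2 ^ (1:ℝ) := by simp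
        _ < _ := Real.rpow_lt_rpow_of_exponent_lt (by norm_num) hβ1
    have a2 : (2:ℝ) ^ β < 2 ^ (9/4 : ℝ) := Real.rpow_lt_rpow_of_exponent_lt (by norm_num) (by linarith)
    exact eventually_atTop.1 ((h2.eventually_const_lt a1).and (h2.eventually_lt_const a2))
  set X₀ := max X 1 with hX0
  have hX1 : 1 ≤ X₀ := le_max_right _ _
  have up : ∀ n : ℕ, ∀ x, X₀ ≤ x → 2 ^ n * ψ x ≤ ψ (2 ^ n * x) ∧
      ψ (2 ^ n * x) ≤ (2 ^ (9/4 : ℝ)) ^ n * ψ x := by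
    intro n x hx
    have hx0 : 0 < x := by linarith
    induction n with
    | zero => simp
    | succ n ih =>
      have hxn : x ≤ 2 ^ n * x := le_mul_of_one_le_left hx0.le (one_le_pow₀ (by norm_num))
      obtain ⟨h1, h2⟩ := hX (2 ^ n * x) (by linarith [le_max_left X 1])
      have pp := hpos (2 ^ n * x) (by positivity)
      rw [lt_div_iff₀ pp] at h1
      rw [div_lt_iff₀ pp] at h2
      have e : (2:ℝ) ^ (n+1) * x = 2 * (2 ^ n * x) := by ring
      rw [e]
      constructor
      · rw [pow_succ]; linarith [ih.1]
      · rw [pow_succ]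
        refine h2.le.trans ?_
        have := ih.2
        calc _ ≤ (2:ℝ) ^ (9/4:ℝ) * ((2 ^ (9/4 : ℝ)) ^ n * ψ x) := by gcongr
          _ = _ := by ring
  -- bound near zero
  obtain ⟨c₁, hc₁, hlow⟩ : ∃ c₁ : ℝ, 0 < c₁ ∧ ∀ p, 0 < p → p ≤ X₀ → c₁ * p ^ 2 ≤ ψ p := by
    obtain ⟨m, hm0, hm⟩ := exists_between hliminf
    have hev := eventually_lt_of_lt_liminf hm (by
      refine ⟨0, ?_⟩
      rw [eventually_map]
      filter_upwards [self_mem_nhdsWithin] with p hp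
      exact div_nonneg (hpos p hp).le (sq_nonneg p))
    rw [eventually_nhdsWithin_iff, Metric.eventually_nhds_iff] at hev
    obtain ⟨δ, hδ, hev⟩ := hev
    have hcont : ContinuousOn (fun p => ψ p / p ^ 2) (Icc (min (δ/2) X₀) X₀) := by
      intro p hp
      have hp0 : 0 < p := lt_of_lt_of_le (lt_min (by linarith) (by linarith)) hp.1
      exact ((hdiff1 p hp0).continuousAt.div (by fun_prop) (by positivity)).continuousWithinAt
    obtain ⟨q, hq, hqmin⟩ := isCompact_Icc.exists_isMinOn (nonempty_Icc.2 (min_le_right _ _)) hcont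
    have hq0 : 0 < q := lt_of_lt_of_le (lt_min (by linarith) (by linarith)) hq.1
    refine ⟨min m (ψ q / q ^ 2), lt_min hm0 (div_pos (hpos q hq0.ne') (by positivity)), ?_⟩
    intro p hp hpX
    rw [← le_div_iff₀ (by positivity)]
    by_cases hpd : p < δ
    · refine (min_le_left _ _).trans (hev ?_ hp.ne').le
      rw [Real.dist_eq, sub_zero, abs_of_pos hp]; exact hpd
    · refine (min_le_right _ _).trans (hqmin ⟨?_, hpX⟩)
      refine (min_le_left _ _).trans (by linarith)
  have hE : 0 < Real.exp D₁ := Real.exp_pos _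
  set c := min (Real.exp D₁ * 2)⁻¹ (c₁ / C₀) with hc
  have hcE1 : c ≤ (Real.exp D₁ * 2)⁻¹ := min_le_left _ _
  have hcE2 : c ≤ (Real.exp D₁)⁻¹ := hcE1.trans (by gcongr; linarith)
  have hc2 : c ≤ c₁ / C₀ := min_le_right _ _
  have hcpos : 0 < c := lt_min (by positivity) (by positivity)
  refine ⟨c, X₀, hcpos, hX1, fun R hR => ⟨?_, ?_⟩⟩
  · intro p hp
    have hR0 : 0 < R := by linarith
    obtain ⟨n, hn1, hn2⟩ := aux_dyadic hR0 hp
    have hRn : R ≤ 2 ^ n * R := le_mul_of_one_le_left hR0.le (one_le_pow₀ (by norm_num))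
    have h1 := (aux_doubling ψ hpos hdiff1 D₁ hD1 (x := 2 ^ n * R) (by linarith) hn1 hn2).2
    have h2 := (up n R hR).1
    have pR := hpos R hR0.ne'
    have h3 : p / R ≤ 2 * 2 ^ n := by rw [div_le_iff₀ hR0]; linarith
    have h4 : 0 ≤ p / R := div_nonneg (by linarith) hR0.le
    calc c * (p / R) * ψ R ≤ (Real.exp D₁ * 2)⁻¹ * (2 * 2 ^ n) * ψ R := by gcongr
      _ = (Real.exp D₁)⁻¹ * (2 ^ n * ψ R) := by field_simp
      _ ≤ (Real.exp D₁)⁻¹ * (Real.exp D₁ * ψ p) :=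
        mul_le_mul_of_nonneg_left (h2.trans h1) (by positivity)
      _ = ψ p := by field_simp
  · intro p hp hpR
    have hR0 : 0 < R := by linarith
    have pR := hpos R hR0.ne'
    by_cases hpX : X₀ ≤ p
    · obtain ⟨n, hn1, hn2⟩ := aux_dyadic hp hpR
      have hRn : p ≤ 2 ^ n * p := le_mul_of_one_le_left hp.le (one_le_pow₀ (by norm_num))
      have h1 := (aux_doubling ψ hpos hdiff1 D₁ hD1 (x := 2 ^ n * p) (by linarith) hn1 hn2).1
      have h2 := (up n p hpX).2
      have pp := hpos p hp.ne'
      have h4 : (p / R) ^ (9/4 : ℝ) * (2 ^ (9/4 : ℝ)) ^ n ≤ 1 := by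
        rw [← Real.rpow_natCast, ← Real.rpow_mul (by norm_num), mul_comm (9/4 : ℝ),
          Real.rpow_mul (by norm_num), Real.rpow_natCast, ← Real.mul_rpow (by positivity) (by positivity)]
        apply Real.rpow_le_one (by positivity) _ (by norm_num)
        rw [div_mul_eq_mul_div, div_le_one hR0]; linarith
      calc c * (p / R) ^ (9/4 : ℝ) * ψ R 
          ≤ (Real.exp D₁)⁻¹ * (p / R) ^ (9/4 : ℝ) * (Real.exp D₁ * ((2 ^ (9/4 : ℝ)) ^ n * ψ p)) := by
            gcongr
            exact h1.trans (by gcongr)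
        _ = ((p / R) ^ (9/4 : ℝ) * (2 ^ (9/4 : ℝ)) ^ n) * ψ p := by field_simp
        _ ≤ 1 * ψ p := by gcongr
        _ = ψ p := one_mul _
    · have h1 := hlow p hp (by linarith)
      have h2 : (p / R) ^ (9/4 : ℝ) ≤ (p / R) ^ 2 := by
        rw [← Real.rpow_natCast]
        apply Real.rpow_le_rpow_of_exponent_ge (by positivity) ((div_le_one hR0).2 hpR)
        norm_num
      calc c * (p / R) ^ (9/4 : ℝ) * ψ R ≤ (c₁ / C₀) * (p / R) ^ 2 * (C₀ * R ^ 2) := by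
            gcongr
            exact hC0 R
        _ = c₁ * p ^ 2 := by field_simp
        _ ≤ _ := h1
/-- piecewise power -/
noncomputable def auxJ (α γ t : ℝ) : ℝ := if t ≤ 1 then t ^ α else t ^ γ

lemma auxJ_lt_top {α γ : ℝ} (hα : -1 < α) (hγ : γ < -1) :
    ∫⁻ t in Ioi (0:ℝ), ENNReal.ofReal (auxJ α γ t) < ⊤ := by
  have h : IntegrableOn (auxJ α γ) (Ioi 0) := by
    rw [← Ioc_union_Ioi_eq_Ioi (zero_le_one' ℝ)]
    refine IntegrableOn.union ?_ ?_
    · have := (intervalIntegral.intervalIntegrable_rpow' (a := 0) (b := 1) hα)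
      rw [intervalIntegrable_iff_integrableOn_Ioc_of_le zero_le_one] at this
      refine this.congr_fun ?_ measurableSet_Ioc
      intro t ht
      simp [auxJ, ht.2]
    · refine (integrableOn_Ioi_rpow_of_lt hγ zero_lt_one).congr_fun ?_ measurableSet_Ioi
      intro t ht
      have : ¬ t ≤ 1 := not_le.2 ht
      simp [auxJ, this]
  exact h.lintegral_lt_top

/-- weight -/
noncomputable def auxA (t : ℝ) : ℝ := t ^ (1/2 : ℝ) + t ^ (9/8 : ℝ)

lemma auxA_pos {t : ℝ} (ht : 0 < t) : 0 < auxA t := by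
  unfold auxA; positivity

lemma auxA_meas : Measurable auxA := by
  unfold auxA; fun_prop

lemma auxA_inv_lt_top :
    ∫⁻ t in Ioi (0:ℝ), ENNReal.ofReal (1 / auxA t) < ⊤ := by
  refine lt_of_le_of_lt ?_ (auxJ_lt_top (α := -(1/2)) (γ := -(9/8)) (by norm_num) (by norm_num))
  refine setLIntegral_mono' measurableSet_Ioi ?_
  intro t ht
  have ht : 0 < t := ht
  apply ENNReal.ofReal_le_ofReal
  unfold auxJ auxA
  have h1 : 0 < t ^ (1/2 : ℝ) := by positivity
  have h2 : 0 < t ^ (9/8 : ℝ) := by positivity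
  split_ifs with h
  · rw [Real.rpow_neg ht.le, one_div]
    gcongr; linarith
  · rw [Real.rpow_neg ht.le, one_div]
    gcongr; linarith

lemma aux_gamma1 {a ρ : ℝ} (ha : 0 < a) (hρ : 0 < ρ) :
    ∫⁻ t in Ioi (0:ℝ), ENNReal.ofReal (t ^ (a - 1) * Real.exp (-(ρ * t))) =
      ENNReal.ofReal ((1 / ρ) ^ a * Real.Gamma a) := by
  have h := Real.integral_rpow_mul_exp_neg_mul_Ioi ha hρ
  have hp : 0 < (1 / ρ) ^ a * Real.Gamma a := mul_pos (by positivity) (Real.Gamma_pos_of_pos ha)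
  have hi : Integrable (fun t : ℝ => t ^ (a - 1) * Real.exp (-(ρ * t))) (volume.restrict (Ioi 0)) := by
    by_contra hn
    rw [integral_undef hn] at h
    linarith
  rw [← h, ofReal_integral_eq_lintegral_ofReal hi]
  filter_upwards [ae_restrict_mem measurableSet_Ioi] with t ht
  have ht : 0 < t := ht
  simp only [Pi.zero_apply]
  positivity

lemma aux_gamma {ρ : ℝ} (hρ : 0 < ρ) :
    ∫⁻ t in Ioi (0:ℝ), ENNReal.ofReal (auxA t * Real.exp (-(ρ * t))) =
      ENNReal.ofReal ((1 / ρ) ^ (3/2 : ℝ) * Real.Gamma (3/2) + (1 / ρ) ^ (17/8 : ℝ) * Real.Gamma (17/8)) := by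
  have g1 := Real.Gamma_pos_of_pos (s := 3/2) (by norm_num)
  have g2 := Real.Gamma_pos_of_pos (s := 17/8) (by norm_num)
  rw [ENNReal.ofReal_add (by positivity) (by positivity), ← aux_gamma1 (by norm_num) hρ,
    ← aux_gamma1 (by norm_num) hρ, ← lintegral_add_left (by fun_prop)]
  refine setLIntegral_congr_fun measurableSet_Ioi ?_
  intro t ht
  have ht : 0 < t := ht
  dsimp only
  rw [← ENNReal.ofReal_add (by positivity) (by positivity), auxA]
  norm_num [add_mul]

lemma aux_point {q k u G₁ G₂ : ℝ} (hq : 0 < q) (hk : 0 < k) (hu : 0 < u) (hG1 : 0 < G₁) (hG2 : 0 < G₂)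
    (h1 : q ≤ 1 → u ≤ k * q ^ (-(9/4) : ℝ)) (h2 : 1 ≤ q → u ≤ k * q ^ (-1 : ℝ)) :
    (2 - 2 * Real.cos q) ^ 2 * (u ^ (3/2 : ℝ) * G₁ + u ^ (17/8 : ℝ) * G₂) ≤
      16 * (k ^ (3/2 : ℝ) * G₁ + k ^ (17/8 : ℝ) * G₂) * auxJ (-(25/32)) (-(3/2)) q := by
  have hc1 := Real.cos_le_one q
  have hc2 := Real.neg_one_le_cos q
  unfold auxJ
  split_ifs with h
  · have hu' := h1 h
    have e1 : u ^ (3/2 : ℝ) ≤ k ^ (3/2 : ℝ) * q ^ (-(27/8) : ℝ) := by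
      calc u ^ (3/2 : ℝ) ≤ (k * q ^ (-(9/4) : ℝ)) ^ (3/2 : ℝ) := by gcongr
        _ = _ := by
          rw [Real.mul_rpow hk.le (by positivity), ← Real.rpow_mul hq.le]; norm_num
    have e2 : u ^ (17/8 : ℝ) ≤ k ^ (17/8 : ℝ) * q ^ (-(153/32) : ℝ) := by
      calc u ^ (17/8 : ℝ) ≤ (k * q ^ (-(9/4) : ℝ)) ^ (17/8 : ℝ) := by gcongr
        _ = _ := by
          rw [Real.mul_rpow hk.le (by positivity), ← Real.rpow_mul hq.le]; norm_num
    have e3 : (2 - 2 * Real.cos q) ^ 2 ≤ q ^ (4:ℝ) := by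
      have := Real.one_sub_sq_div_two_le_cos (x := q)
      calc (2 - 2 * Real.cos q) ^ 2 ≤ (q ^ 2) ^ 2 := by
            apply pow_le_pow_left₀ (by linarith); linarith
        _ = q ^ (4:ℝ) := by norm_cast; ring
    have e4 : q ^ (4:ℝ) * q ^ (-(27/8) : ℝ) ≤ q ^ (-(25/32) : ℝ) := by
      rw [← Real.rpow_add hq]
      exact Real.rpow_le_rpow_of_exponent_ge hq h (by norm_num)
    have e5 : q ^ (4:ℝ) * q ^ (-(153/32) : ℝ) = q ^ (-(25/32) : ℝ) := by
      rw [← Real.rpow_add hq]; norm_num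
    have e6 : 0 < q ^ (-(25/32) : ℝ) := by positivity
    calc _ ≤ q ^ (4:ℝ) * (k ^ (3/2 : ℝ) * q ^ (-(27/8) : ℝ) * G₁ + k ^ (17/8 : ℝ) * q ^ (-(153/32) : ℝ) * G₂) := by
          gcongr
      _ = k ^ (3/2 : ℝ) * G₁ * (q ^ (4:ℝ) * q ^ (-(27/8) : ℝ)) +
            k ^ (17/8 : ℝ) * G₂ * (q ^ (4:ℝ) * q ^ (-(153/32) : ℝ)) := by ring
      _ ≤ k ^ (3/2 : ℝ) * G₁ * q ^ (-(25/32) : ℝ) + k ^ (17/8 : ℝ) * G₂ * q ^ (-(25/32) : ℝ) := by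
          rw [e5]; gcongr
      _ = 1 * (k ^ (3/2 : ℝ) * G₁ + k ^ (17/8 : ℝ) * G₂) * q ^ (-(25/32) : ℝ) := by ring
      _ ≤ _ := by gcongr; norm_num
  · have h : 1 ≤ q := (not_le.1 h).le
    have hu' := h2 h
    have e1 : u ^ (3/2 : ℝ) ≤ k ^ (3/2 : ℝ) * q ^ (-(3/2) : ℝ) := by
      calc u ^ (3/2 : ℝ) ≤ (k * q ^ (-1 : ℝ)) ^ (3/2 : ℝ) := by gcongr
        _ = _ := by
          rw [Real.mul_rpow hk.le (by positivity), ← Real.rpow_mul hq.le]; norm_num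
    have e2 : u ^ (17/8 : ℝ) ≤ k ^ (17/8 : ℝ) * q ^ (-(3/2) : ℝ) := by
      calc u ^ (17/8 : ℝ) ≤ (k * q ^ (-1 : ℝ)) ^ (17/8 : ℝ) := by gcongr
        _ = k ^ (17/8 : ℝ) * q ^ (-(17/8) : ℝ) := by
          rw [Real.mul_rpow hk.le (by positivity), ← Real.rpow_mul hq.le]; norm_num
        _ ≤ _ := by
          refine mul_le_mul_of_nonneg_left ?_ (by positivity)
          exact Real.rpow_le_rpow_of_exponent_le h (by norm_num)
    have e3 : (2 - 2 * Real.cos q) ^ 2 ≤ 16 := by nlinarith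
    calc _ ≤ 16 * (k ^ (3/2 : ℝ) * q ^ (-(3/2) : ℝ) * G₁ + k ^ (17/8 : ℝ) * q ^ (-(3/2) : ℝ) * G₂) := by
          gcongr
      _ = _ := by ring

lemma aux_cs {α : Type*} [MeasurableSpace α] (μ : Measure α) (f : α → ℝ≥0∞) (b : α → ℝ)
    (hf : AEMeasurable f μ) (hb : Measurable b) (hbpos : ∀ᵐ s ∂μ, 0 < b s) :
    (∫⁻ s, f s ∂μ) ^ 2 ≤ (∫⁻ s, ENNReal.ofReal (1 / b s) ∂μ) * ∫⁻ s, ENNReal.ofReal (b s) * f s ^ 2 ∂μ := by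
  have hc : (2:ℝ).HolderConjugate 2 := Real.HolderConjugate.two_two
  have h := ENNReal.lintegral_mul_le_Lp_mul_Lq μ hc
    (f := fun s => ENNReal.ofReal (√(1 / b s))) (g := fun s => ENNReal.ofReal (√(b s)) * f s)
    (by fun_prop) (by fun_prop)
  have e0 : ∫⁻ s, f s ∂μ = ∫⁻ s, ((fun s => ENNReal.ofReal (√(1 / b s))) * (fun s => ENNReal.ofReal (√(b s)) * f s)) s ∂μ := by
    apply lintegral_congr_ae
    filter_upwards [hbpos] with s hs
    simp only [Pi.mul_apply]
    rw [← mul_assoc, ← ENNReal.ofReal_mul (by positivity), ← Real.sqrt_mul (by positivity)]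
    rw [one_div_mul_cancel hs.ne']
    simp
  have e1 : ∫⁻ s, ENNReal.ofReal (√(1 / b s)) ^ (2:ℝ) ∂μ = ∫⁻ s, ENNReal.ofReal (1 / b s) ∂μ := by
    apply lintegral_congr_ae
    filter_upwards [hbpos] with s hs
    rw [ENNReal.ofReal_rpow_of_nonneg (by positivity) (by norm_num), Real.rpow_two, Real.sq_sqrt (by positivity)]
  have e2 : ∫⁻ s, (ENNReal.ofReal (√(b s)) * f s) ^ (2:ℝ) ∂μ = ∫⁻ s, ENNReal.ofReal (b s) * f s ^ 2 ∂μ := by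
    apply lintegral_congr_ae
    filter_upwards [hbpos] with s hs
    rw [ENNReal.mul_rpow_of_nonneg _ _ (by norm_num), ENNReal.ofReal_rpow_of_nonneg (by positivity) (by norm_num), Real.rpow_two, Real.sq_sqrt (by positivity), ENNReal.rpow_two]
  rw [e0]
  refine (pow_le_pow_left' h 2).trans ?_
  rw [e1, e2, mul_pow, ← ENNReal.rpow_two, ← ENNReal.rpow_two, ← ENNReal.rpow_mul, ← ENNReal.rpow_mul]
  norm_num

lemma aux_exp_int (ψ : ℝ → ℝ) (hmeas : Measurable ψ) (hnonneg : ∀ p : ℝ, 0 ≤ ψ p)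
    {c' R₀ : ℝ} (hc : 0 < c') (hR : 0 < R₀) (hlow : ∀ p, R₀ ≤ p → c' * p ≤ ψ p) {s : ℝ} (hs : 0 < s) :
    IntegrableOn (fun p => Real.exp (-s * ψ p)) (Ioi 0) := by
  have h := (exp_neg_integrableOn_Ioi (0:ℝ) (b := s * c') (by positivity)).const_mul (Real.exp (s * c' * R₀))
  refine Integrable.mono' h (by fun_prop) ?_
  filter_upwards with p
  rw [Real.norm_eq_abs, abs_of_pos (Real.exp_pos _), ← Real.exp_add]
  apply Real.exp_le_exp.2
  by_cases hp : R₀ ≤ p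
  · have := mul_le_mul_of_nonneg_left (hlow p hp) hs.le
    have h3 : 0 < s * c' * R₀ := by positivity
    nlinarith
  · have h1 := mul_nonneg hs.le (hnonneg p)
    have h3 : 0 < s * c' * (R₀ - p) := mul_pos (by positivity) (by linarith)
    nlinarith

lemma aux_pdens_meas (ψ : ℝ → ℝ) (hmeas : Measurable ψ) :
    Measurable (fun z : ℝ × ℝ => pdens ψ z.1 z.2) := by
  unfold pdens
  apply Measurable.const_mul
  apply StronglyMeasurable.measurable
  apply StronglyMeasurable.integral_prod_right' (f := fun z : (ℝ × ℝ) × ℝ => Real.cos (z.2 * z.1.2) * Real.exp (-z.1.1 * ψ z.2))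
  apply Measurable.stronglyMeasurable
  fun_prop

lemma aux_gs (ψ : ℝ → ℝ) (hmeas : Measurable ψ) (hnonneg : ∀ p : ℝ, 0 ≤ ψ p) (h : ℝ)
    {s : ℝ} (hs : 0 < s) (hi : IntegrableOn (fun p => Real.exp (-s * ψ p)) (Ioi 0)) :
    ∫⁻ x : ℝ, ‖2 * pdens ψ s x - pdens ψ s (x + h) - pdens ψ s (x - h)‖ₑ ^ 2 ≤
      ENNReal.ofReal (2 * Real.pi) * ∫⁻ p in Ioi (0:ℝ),
        ENNReal.ofReal ((2 - 2 * Real.cos (h * p)) ^ 2 * Real.exp (-s * ψ p) ^ 2) := by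
  set G : ℝ → ℝ := fun p => (1 / Real.pi) * (2 - 2 * Real.cos (h * p)) * Real.exp (-s * ψ p) with hG
  have hpi : 1 / Real.pi ≤ 1 := by
    rw [div_le_one Real.pi_pos]; linarith [Real.pi_gt_three]
  have hpi0 : 0 < 1 / Real.pi := by positivity
  have hcoef : ∀ p, |(1 / Real.pi) * (2 - 2 * Real.cos (h * p))| ≤ 4 := by
    intro p
    have hc1 := Real.cos_le_one (h * p)
    have hc2 := Real.neg_one_le_cos (h * p)
    rw [abs_of_nonneg (mul_nonneg hpi0.le (by linarith))]
    nlinarith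
  have hb : ∀ p, |G p| ≤ 4 * Real.exp (-s * ψ p) := by
    intro p
    rw [hG]
    dsimp only
    rw [abs_mul, abs_of_pos (Real.exp_pos _)]
    gcongr
    exact hcoef p
  have hGm : Measurable G := by rw [hG]; fun_prop
  have G1 : IntegrableOn G (Ioi 0) :=
    Integrable.mono' (hi.const_mul 4) hGm.aestronglyMeasurable (ae_of_all _ hb)
  have G2 : MemLp G 2 (volume.restrict (Ioi 0)) := by
    rw [memLp_two_iff_integrable_sq hGm.aestronglyMeasurable]
    refine Integrable.mono' (hi.const_mul 16) (by fun_prop) (ae_of_all _ fun p => ?_)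
    have h1 : Real.exp (-s * ψ p) ≤ 1 := by
      apply Real.exp_le_one_iff.2
      have := mul_nonneg hs.le (hnonneg p)
      linarith
    have h2 := Real.exp_pos (-s * ψ p)
    rw [Real.norm_eq_abs, abs_pow]
    calc |G p| ^ 2 ≤ (4 * Real.exp (-s * ψ p)) ^ 2 := pow_le_pow_left₀ (abs_nonneg _) (hb p) 2
      _ ≤ _ := by nlinarith
  have hcos : ∀ x : ℝ, IntegrableOn (fun p => Real.cos (p * x) * Real.exp (-s * ψ p)) (Ioi 0) := by
    intro x
    refine Integrable.mono' hi (by fun_prop) (ae_of_all _ fun p => ?_)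
    rw [Real.norm_eq_abs, abs_mul, abs_of_pos (Real.exp_pos _)]
    exact mul_le_of_le_one_left (Real.exp_pos _).le (Real.abs_cos_le_one _)
  have e : ∀ x, 2 * pdens ψ s x - pdens ψ s (x + h) - pdens ψ s (x - h) =
      ∫ p in Ioi (0:ℝ), Real.cos (p * x) * G p := by
    intro x
    unfold pdens
    have h3 : ∫ p in Ioi (0:ℝ), Real.cos (p * x) * G p =
        ∫ p in Ioi (0:ℝ), (1 / Real.pi) * ((2 * (Real.cos (p * x) * Real.exp (-s * ψ p))
          - Real.cos (p * (x + h)) * Real.exp (-s * ψ p))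
          - Real.cos (p * (x - h)) * Real.exp (-s * ψ p)) := by
      congr 1
      ext p
      simp only [hG]
      rw [mul_add, mul_sub p x h, Real.cos_add, Real.cos_sub, mul_comm h p]
      ring
    have i1 : Integrable (fun p => 2 * (Real.cos (p * x) * Real.exp (-s * ψ p))
          - Real.cos (p * (x + h)) * Real.exp (-s * ψ p)) (volume.restrict (Ioi 0)) :=
      ((hcos x).const_mul 2).sub (hcos (x + h))
    rw [h3, integral_const_mul, integral_sub i1 (hcos (x - h)),
      integral_sub ((hcos x).const_mul 2) (hcos (x + h)), integral_const_mul]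
    ring
  simp_rw [e]
  refine (aux_cos_planch G G1 G2).trans ?_
  gcongr with p
  rw [← ofReal_norm, ← ENNReal.ofReal_pow (norm_nonneg _), Real.norm_eq_abs, sq_abs]
  apply ENNReal.ofReal_le_ofReal
  rw [hG]
  dsimp only
  rw [mul_pow, mul_pow]
  gcongr
  apply mul_le_of_le_one_left (sq_nonneg _)
  exact pow_le_one₀ hpi0.le hpi

set_option maxHeartbeats 2000000 in
theorem stmt_8
    (β : ℝ) (hβ1 : 1 < β) (hβ2 : β ≤ 2)
    (ψ : ℝ → ℝ)
    (hmeas : Measurable ψ)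
    (heven : ∀ p : ℝ, ψ (-p) = ψ p)
    (hnonneg : ∀ p : ℝ, 0 ≤ ψ p)
    (hpos : ∀ p : ℝ, p ≠ 0 → 0 < ψ p)
    (hRV : ∀ l : ℝ, 0 < l →
      Filter.Tendsto (fun x => ψ (l * x) / ψ x) Filter.atTop (nhds (l ^ β)))
    (hdiff1 : ∀ p : ℝ, 0 < p → DifferentiableAt ℝ ψ p)
    (hdiff2 : ∀ p : ℝ, 0 < p → DifferentiableAt ℝ (deriv ψ) p)
    (D₁ D₂ : ℝ)
    (hD1 : ∀ l : ℝ, 1 ≤ l → l * |deriv ψ l| ≤ D₁ * ψ l)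
    (hD2 : ∀ l : ℝ, 1 ≤ l → l ^ 2 * |deriv (deriv ψ) l| ≤ D₂ * ψ l)
    (hint1 : MeasureTheory.IntegrableOn (fun l : ℝ => (deriv ψ l) ^ 2) (Set.Ioc (0:ℝ) 1))
    (hint2 : MeasureTheory.IntegrableOn (fun l : ℝ => |deriv (deriv ψ) l|) (Set.Ioc (0:ℝ) 1))
    (hint3 : MeasureTheory.IntegrableOn (fun l : ℝ => ψ l / l) (Set.Ioc (0:ℝ) 1))
    (C₀ : ℝ) (hC0 : ∀ p : ℝ, ψ p ≤ C₀ * p ^ 2)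
    (hliminf : 0 < Filter.liminf (fun p : ℝ => ψ p / p ^ 2) (nhdsWithin (0:ℝ) ({0}ᶜ))) :
    ∃ C h₀ : ℝ, 0 < h₀ ∧ ∀ h : ℝ, 0 < h → h ≤ h₀ →
      (∫ x : ℝ, wfun ψ h x ^ 2) ≤ C / (h * ψ (1 / h) ^ 2) := by
  obtain ⟨c, R₀, hc, hR0, hlow⟩ := aux_lower β hβ1 hβ2 ψ hpos hRV hdiff1 D₁ hD1 C₀ hC0 hliminf
  have hR0' : 0 < R₀ := by linarith
  have hint : ∀ s, 0 < s → IntegrableOn (fun p => Real.exp (-s * ψ p)) (Ioi 0) := by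
    intro s hs
    have p0 := hpos R₀ hR0'.ne'
    refine aux_exp_int ψ hmeas hnonneg (c' := c * ψ R₀ / R₀) (R₀ := R₀) (by positivity) hR0' ?_ hs
    intro p hp
    have := (hlow R₀ le_rfl).1 p hp
    calc _ = c * (p / R₀) * ψ R₀ := by field_simp
      _ ≤ _ := this
  set A : ℝ≥0∞ := ∫⁻ t in Ioi (0:ℝ), ENNReal.ofReal (1 / auxA t) with hA
  set B : ℝ≥0∞ := ∫⁻ q in Ioi (0:ℝ), ENNReal.ofReal (auxJ (-(25/32)) (-(3/2)) q) with hB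
  have hAt : A < ⊤ := auxA_inv_lt_top
  have hBt : B < ⊤ := auxJ_lt_top (by norm_num) (by norm_num)
  set k : ℝ := (2 * c)⁻¹ with hk
  have hk0 : 0 < k := by positivity
  have g1 := Real.Gamma_pos_of_pos (s := 3/2) (by norm_num)
  have g2 := Real.Gamma_pos_of_pos (s := 17/8) (by norm_num)
  set K : ℝ := 16 * (k ^ (3/2 : ℝ) * Real.Gamma (3/2) + k ^ (17/8 : ℝ) * Real.Gamma (17/8)) with hK
  have hK0 : 0 < K := by positivity
  refine ⟨A.toReal * (2 * Real.pi) * K * B.toReal, 1 / R₀, by positivity, ?_⟩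
  intro h hh hhR
  have hR : R₀ ≤ 1 / h := by
    rw [le_div_iff₀ hh]
    rwa [le_div_iff₀ hR0', mul_comm] at hhR
  obtain ⟨low1, low2⟩ := hlow (1 / h) hR
  set Λ := ψ (1 / h) with hΛ
  have hΛ0 : 0 < Λ := hpos _ (by positivity)
  set g : ℝ → ℝ → ℝ := fun s x => 2 * pdens ψ s x - pdens ψ s (x + h) - pdens ψ s (x - h) with hg
  have hgm : Measurable (fun z : ℝ × ℝ => g z.1 z.2) := by
    have hm := aux_pdens_meas ψ hmeas
    rw [hg]
    dsimp only
    refine Measurable.sub (Measurable.sub (Measurable.const_mul hm 2) ?_) ?_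
    · exact hm.comp (g := fun z : ℝ × ℝ => pdens ψ z.1 z.2) (f := fun z : ℝ × ℝ => (z.1, z.2 + h)) (by fun_prop)
    · exact hm.comp (g := fun z : ℝ × ℝ => pdens ψ z.1 z.2) (f := fun z : ℝ × ℝ => (z.1, z.2 - h)) (by fun_prop)
  have hgm' : Measurable (fun z : ℝ × ℝ => g z.2 z.1) :=
    hgm.comp (g := fun z : ℝ × ℝ => g z.1 z.2) (f := fun z : ℝ × ℝ => (z.2, z.1)) (by fun_prop)
  clear_value g
  have hAm := auxA_meas
  clear_value A B K k Λ
  -- Cauchy-Schwarz step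
  have step1 : ∀ x, ‖wfun ψ h x‖ₑ ^ 2 ≤ ENNReal.ofReal Λ⁻¹ * A *
      ∫⁻ s in Ioc (0:ℝ) 1, ENNReal.ofReal (auxA (Λ * s)) * ‖g s x‖ₑ ^ 2 := by
    intro x
    have h1 : ‖wfun ψ h x‖ₑ ≤ ∫⁻ s in Ioc (0:ℝ) 1, ‖g s x‖ₑ := by
      unfold wfun
      rw [intervalIntegral.integral_of_le zero_le_one]
      refine (enorm_integral_le_lintegral_enorm _).trans_eq ?_
      simp only [hg, ← ofReal_norm, Real.norm_eq_abs, abs_abs]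
    have h2 := aux_cs (volume.restrict (Ioc (0:ℝ) 1)) (fun s => ‖g s x‖ₑ) (fun s => auxA (Λ * s))
      (by
        have : Measurable (fun s => g s x) := hgm.comp (f := fun s : ℝ => (s, x)) (by fun_prop)
        fun_prop) (by fun_prop)
      (by
        filter_upwards [ae_restrict_mem measurableSet_Ioc] with s hs
        exact auxA_pos (mul_pos hΛ0 hs.1))
    refine (pow_le_pow_left' h1 2).trans (h2.trans ?_)
    gcongr
    rw [hA]
    calc _ ≤ ∫⁻ s in Ioi (0:ℝ), ENNReal.ofReal (1 / auxA (Λ * s)) :=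
          lintegral_mono_set Ioc_subset_Ioi_self
      _ = _ := aux_scale_Ioi (fun t => ENNReal.ofReal (1 / auxA t)) hΛ0
  -- the inner time integral
  have step2 : ∀ p ∈ Ioi (0:ℝ), ∫⁻ s in Ioi (0:ℝ), ENNReal.ofReal (auxA (Λ * s)) *
      ENNReal.ofReal ((2 - 2 * Real.cos (h * p)) ^ 2 * Real.exp (-s * ψ p) ^ 2) ≤
      ENNReal.ofReal Λ⁻¹ * ENNReal.ofReal K * ENNReal.ofReal (auxJ (-(25/32)) (-(3/2)) (h * p)) := by
    intro p hp
    have hp : 0 < p := hp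
    have pp := hpos p hp.ne'
    set ρ := 2 * ψ p / Λ with hρ
    have hρ0 : 0 < ρ := by positivity
    have e1 : ∫⁻ s in Ioi (0:ℝ), ENNReal.ofReal (auxA (Λ * s)) *
      ENNReal.ofReal ((2 - 2 * Real.cos (h * p)) ^ 2 * Real.exp (-s * ψ p) ^ 2) =
      ENNReal.ofReal ((2 - 2 * Real.cos (h * p)) ^ 2) *
        ∫⁻ s in Ioi (0:ℝ), ENNReal.ofReal (auxA (Λ * s) * Real.exp (-(ρ * (Λ * s)))) := by
      rw [← lintegral_const_mul _ (by fun_prop)]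
      refine setLIntegral_congr_fun measurableSet_Ioi ?_
      intro s hs
      have hs : 0 < s := hs
      have ha := auxA_pos (mul_pos hΛ0 hs)
      have e2 : Real.exp (-s * ψ p) ^ 2 = Real.exp (-(ρ * (Λ * s))) := by
        rw [← Real.exp_nat_mul]
        congr 1
        rw [hρ]; field_simp; norm_num
      dsimp only
      rw [e2, ← ENNReal.ofReal_mul ha.le, ← ENNReal.ofReal_mul (sq_nonneg _)]
      congr 1; ring
    rw [e1, aux_scale_Ioi (fun t => ENNReal.ofReal (auxA t * Real.exp (-(ρ * t)))) hΛ0, aux_gamma hρ0]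
    have key := aux_point (q := h * p) (k := k) (u := 1 / ρ) (by positivity) hk0 (by positivity) g1 g2
      (by
        intro hq
        have := low2 p hp (by rw [le_div_iff₀ hh]; linarith)
        have e : p / (1 / h) = h * p := by field_simp
        rw [e] at this
        have e0 : 0 < (h * p) ^ (9/4 : ℝ) := by positivity
        rw [Real.rpow_neg (by positivity), hk, hρ, ← mul_inv, one_div]
        apply inv_anti₀ (by positivity)
        rw [le_div_iff₀ hΛ0]
        linarith)
      (by
        intro hq
        have := low1 p (by rw [div_le_iff₀ hh]; linarith)
        have e : p / (1 / h) = h * p := by field_simp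
        rw [e] at this
        have e0 : 0 < h * p := by positivity
        rw [Real.rpow_neg (by positivity), Real.rpow_one, hk, hρ, ← mul_inv, one_div]
        apply inv_anti₀ (by positivity)
        rw [le_div_iff₀ hΛ0]
        linarith)
    calc _ = ENNReal.ofReal Λ⁻¹ * ENNReal.ofReal ((2 - 2 * Real.cos (h * p)) ^ 2 * 
            ((1 / ρ) ^ (3/2 : ℝ) * Real.Gamma (3/2) + (1 / ρ) ^ (17/8 : ℝ) * Real.Gamma (17/8))) := by
          rw [ENNReal.ofReal_mul (sq_nonneg _)]; ring
      _ ≤ ENNReal.ofReal Λ⁻¹ * ENNReal.ofReal (K * auxJ (-(25/32)) (-(3/2)) (h * p)) := by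
          rw [hK]; exact mul_le_mul' le_rfl (ENNReal.ofReal_le_ofReal key)
      _ = _ := by rw [ENNReal.ofReal_mul hK0.le]; ring
  have main : ∫⁻ x, ‖wfun ψ h x‖ₑ ^ 2 ≤ ENNReal.ofReal Λ⁻¹ * A * (ENNReal.ofReal (2 * Real.pi) *
      (ENNReal.ofReal Λ⁻¹ * ENNReal.ofReal K * (ENNReal.ofReal h⁻¹ * B))) := by
    calc ∫⁻ x, ‖wfun ψ h x‖ₑ ^ 2 ≤ ∫⁻ x, ENNReal.ofReal Λ⁻¹ * A *
          ∫⁻ s in Ioc (0:ℝ) 1, ENNReal.ofReal (auxA (Λ * s)) * ‖g s x‖ₑ ^ 2 := lintegral_mono step1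
      _ = ENNReal.ofReal Λ⁻¹ * A * ∫⁻ x, ∫⁻ s in Ioc (0:ℝ) 1,
            ENNReal.ofReal (auxA (Λ * s)) * ‖g s x‖ₑ ^ 2 :=
          lintegral_const_mul' _ _ (ENNReal.mul_ne_top ENNReal.ofReal_ne_top hAt.ne)
      _ ≤ _ := ?_
    refine mul_le_mul' le_rfl ?_
    calc ∫⁻ x, ∫⁻ s in Ioc (0:ℝ) 1, ENNReal.ofReal (auxA (Λ * s)) * ‖g s x‖ₑ ^ 2
        = ∫⁻ s in Ioc (0:ℝ) 1, ∫⁻ x, ENNReal.ofReal (auxA (Λ * s)) * ‖g s x‖ₑ ^ 2 := by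
          apply lintegral_lintegral_swap
          apply Measurable.aemeasurable
          unfold Function.uncurry
          fun_prop
      _ ≤ ∫⁻ s in Ioc (0:ℝ) 1, ENNReal.ofReal (2 * Real.pi) * ∫⁻ p in Ioi (0:ℝ),
            ENNReal.ofReal (auxA (Λ * s)) *
            ENNReal.ofReal ((2 - 2 * Real.cos (h * p)) ^ 2 * Real.exp (-s * ψ p) ^ 2) := by
          refine setLIntegral_mono' measurableSet_Ioc ?_
          intro s hs
          rw [lintegral_const_mul' _ _ ENNReal.ofReal_ne_top, lintegral_const_mul' _ _ ENNReal.ofReal_ne_top,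
            mul_left_comm]
          gcongr
          have := aux_gs ψ hmeas hnonneg h hs.1 (hint s hs.1)
          rw [hg]; exact this
      _ ≤ ∫⁻ s in Ioi (0:ℝ), ENNReal.ofReal (2 * Real.pi) * ∫⁻ p in Ioi (0:ℝ),
            ENNReal.ofReal (auxA (Λ * s)) *
            ENNReal.ofReal ((2 - 2 * Real.cos (h * p)) ^ 2 * Real.exp (-s * ψ p) ^ 2) :=
          lintegral_mono_set Ioc_subset_Ioi_self
      _ = ENNReal.ofReal (2 * Real.pi) * ∫⁻ p in Ioi (0:ℝ), ∫⁻ s in Ioi (0:ℝ), 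
            ENNReal.ofReal (auxA (Λ * s)) *
            ENNReal.ofReal ((2 - 2 * Real.cos (h * p)) ^ 2 * Real.exp (-s * ψ p) ^ 2) := by
          rw [lintegral_const_mul' _ _ ENNReal.ofReal_ne_top]
          congr 1
          apply lintegral_lintegral_swap
          apply Measurable.aemeasurable
          unfold Function.uncurry
          fun_prop
      _ ≤ ENNReal.ofReal (2 * Real.pi) * ∫⁻ p in Ioi (0:ℝ), ENNReal.ofReal Λ⁻¹ * ENNReal.ofReal K *
            ENNReal.ofReal (auxJ (-(25/32)) (-(3/2)) (h * p)) := by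
          exact mul_le_mul' le_rfl (setLIntegral_mono' measurableSet_Ioi step2)
      _ = ENNReal.ofReal (2 * Real.pi) *
            (ENNReal.ofReal Λ⁻¹ * ENNReal.ofReal K * (ENNReal.ofReal h⁻¹ * B)) := by
          rw [lintegral_const_mul' _ _ (ENNReal.mul_ne_top ENNReal.ofReal_ne_top ENNReal.ofReal_ne_top),
            aux_scale_Ioi (fun q => ENNReal.ofReal (auxJ (-(25/32)) (-(3/2)) q)) hh, hB]
  have fin : ENNReal.ofReal Λ⁻¹ * A * (ENNReal.ofReal (2 * Real.pi) *
      (ENNReal.ofReal Λ⁻¹ * ENNReal.ofReal K * (ENNReal.ofReal h⁻¹ * B))) =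
      ENNReal.ofReal (A.toReal * (2 * Real.pi) * K * B.toReal / (h * Λ ^ 2)) := by
    have a0 : 0 ≤ A.toReal := ENNReal.toReal_nonneg
    have b0 : 0 ≤ B.toReal := ENNReal.toReal_nonneg
    rw [← ENNReal.ofReal_toReal hAt.ne, ← ENNReal.ofReal_toReal hBt.ne]
    rw [ENNReal.toReal_ofReal a0, ENNReal.toReal_ofReal b0]
    repeat rw [← ENNReal.ofReal_mul (by positivity)]
    congr 1
    field_simp
  rw [fin] at main
  have a0 : 0 ≤ A.toReal := ENNReal.toReal_nonneg
  have b0 : 0 ≤ B.toReal := ENNReal.toReal_nonneg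
  have hCn : 0 ≤ A.toReal * (2 * Real.pi) * K * B.toReal / (h * Λ ^ 2) := by positivity
  rw [← ENNReal.ofReal_le_ofReal_iff hCn]
  have hn : 0 ≤ ∫ x : ℝ, wfun ψ h x ^ 2 := integral_nonneg fun x => sq_nonneg _
  rw [← Real.enorm_of_nonneg hn]
  refine (enorm_integral_le_lintegral_enorm _).trans ?_
  simp_rw [enorm_pow]
  exact main
end

section
/- One has lim_{h→0⁺} h·ψ(1/h)²·c_{ψ,h,1} = c_{β,1}, where c_{β,1} = (16/π) ∫₀^∞ sin⁴(p/2)/p^{2β} dp. -/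
namespace Stmt11Aux

section
open MeasureTheory FourierTransform SchwartzMap
open scoped ContDiff

theorem aux_plancherel (g : ℝ → ℂ) (h1 : Integrable g) (h2 : MemLp g 2) :
    ∫ x, ‖𝓕 g x‖ ^ 2 = ∫ x, ‖g x‖ ^ 2 := by
  set f : Lp ℂ 2 (volume : Measure ℝ) := h2.toLp g with hf
  have hcont : Continuous (𝓕 g) :=
    VectorFourier.fourierIntegral_continuous Real.continuous_fourierChar
      (by exact continuous_inner) h1
  have hae : ∀ᵐ x : ℝ, (𝓕 f : Lp ℂ 2 (volume : Measure ℝ)) x = 𝓕 g x := by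
    apply ae_eq_of_integral_contDiff_smul_eq
    · exact (Lp.memLp _).locallyIntegrable (by norm_num)
    · exact hcont.locallyIntegrable
    · intro u u_smooth u_cpt
      have hg₁ : HasCompactSupport (Complex.ofRealCLM ∘ u) := u_cpt.comp_left rfl
      have hg₂ : ContDiff ℝ ∞ (Complex.ofRealCLM ∘ u) := by fun_prop
      set U : 𝓢(ℝ, ℂ) := hg₁.toSchwartzMap hg₂ with hU
      have hUu : ∀ x, U x = (u x : ℂ) := fun x => by simp [hU]
      have e1 : ∫ x, u x • (𝓕 f : Lp ℂ 2 (volume : Measure ℝ)) x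
          = ((𝓕 f : Lp ℂ 2 (volume : Measure ℝ)) : 𝓢'(ℝ, ℂ)) U := by
        simp [hUu]
      rw [e1, ← Lp.fourier_toTemperedDistribution_eq, TemperedDistribution.fourier_apply,
        Lp.toTemperedDistribution_apply]
      have e2 : ∫ x, (𝓕 U) x • f x = ∫ x, (𝓕 (U : ℝ → ℂ)) x • g x := by
        apply integral_congr_ae
        filter_upwards [h2.coeFn_toLp] with x hx
        rw [hf, hx, SchwartzMap.fourier_coe]
      rw [e2]
      have := VectorFourier.integral_fourierIntegral_smul_eq_flip (μ := volume) (ν := volume)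
        (L := innerₗ ℝ) (f := (U : ℝ → ℂ)) (g := g) Real.continuous_fourierChar
        (by exact continuous_inner) U.integrable h1
      rw [flip_innerₗ] at this
      refine Eq.trans this ?_
      apply integral_congr_ae
      filter_upwards with x
      rw [hUu]
      simp; left; rfl
  have e3 := Lp.norm_fourier_eq f
  have key : ∀ F : Lp ℂ 2 (volume : Measure ℝ), ‖F‖ ^ 2 = ∫ x, ‖F x‖ ^ 2 := by
    intro F
    have h := L2.inner_def (𝕜 := ℂ) F F
    rw [inner_self_eq_norm_sq_to_K] at h
    simp_rw [inner_self_eq_norm_sq_to_K] at h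
    have h' : (((‖F‖ ^ 2 : ℝ)) : ℂ) = ((∫ x, ‖F x‖ ^ 2 : ℝ) : ℂ) := by
      rw [← integral_complex_ofReal]
      simpa using h
    exact_mod_cast h'
  have e4 := key (𝓕 f)
  have e5 := key f
  rw [e3, e5] at e4
  calc ∫ x, ‖𝓕 g x‖ ^ 2 = ∫ x, ‖(𝓕 f : Lp ℂ 2 (volume : Measure ℝ)) x‖ ^ 2 := by
        apply integral_congr_ae
        filter_upwards [hae] with x hx
        rw [hx]
    _ = ∫ x, ‖f x‖ ^ 2 := e4.symm
    _ = _ := by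
        apply integral_congr_ae
        filter_upwards [h2.coeFn_toLp] with x hx
        rw [hf, hx]

theorem aux_cos (g : ℝ → ℝ) (hev : ∀ p, g (-p) = g p) (h1 : Integrable g) (h2 : MemLp g 2) :
    ∫ x : ℝ, (∫ p in Set.Ioi (0:ℝ), Real.cos (p * x) * g p) ^ 2
      = Real.pi * ∫ p in Set.Ioi (0:ℝ), g p ^ 2 := by
  have hG : ∀ ξ : ℝ, 𝓕 (fun p => (g p : ℂ)) ξ
      = ((2 * ∫ p in Set.Ioi (0:ℝ), Real.cos (p * (2 * Real.pi * ξ)) * g p : ℝ) : ℂ) := by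
    intro ξ
    rw [Real.fourier_real_eq_integral_exp_smul]
    set k : ℝ → ℂ := fun v => Complex.exp ((-2 * Real.pi * v * ξ : ℝ) * Complex.I) • (g v : ℂ)
      with hk
    have hkint : Integrable k := by
      refine h1.ofReal.bdd_mul (c := 1) ?_ ?_
      · exact (by fun_prop : Continuous fun v : ℝ =>
          Complex.exp ((-2 * Real.pi * v * ξ : ℝ) * Complex.I)).aestronglyMeasurable
      · filter_upwards with v
        rw [Complex.norm_exp_ofReal_mul_I]
    have hkneg : Integrable (fun v => k (-v)) := hkint.comp_neg
    have hsplit := intervalIntegral.integral_Iic_add_Ioi (b := (0:ℝ)) hkint.integrableOn hkint.integrableOn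
    change ∫ v, k v = _
    rw [← hsplit]
    have e := integral_comp_neg_Ioi (0:ℝ) k
    rw [neg_zero] at e
    rw [← e, ← integral_add hkneg.integrableOn hkint.integrableOn, ← integral_const_mul,
      ← integral_complex_ofReal]
    apply integral_congr_ae
    filter_upwards with v
    simp only [hk, hev, smul_eq_mul]
    push_cast
    rw [Complex.cos]
    ring_nf
  have hP := aux_plancherel (fun p => (g p : ℂ)) h1.ofReal h2.ofReal
  simp_rw [hG] at hP
  have e1 := Measure.integral_comp_mul_left
    (fun x => (∫ p in Set.Ioi (0:ℝ), Real.cos (p * x) * g p) ^ 2) (2 * Real.pi)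
  have e2 := integral_comp_abs (f := fun p => g p ^ 2)
  have e3 : ∀ x : ℝ, g |x| = g x := fun x => by
    rcases abs_choice x with h | h <;> rw [h]
    exact hev x
  simp only [e3] at e2
  simp only [Complex.norm_real, Real.norm_eq_abs, sq_abs, mul_pow] at hP
  rw [integral_const_mul, e1, e2, abs_of_pos (by positivity), smul_eq_mul] at hP
  have := Real.pi_pos
  field_simp at hP
  linarith

theorem aux_potter (f : ℝ → ℝ) (X γ c : ℝ) (hX : 0 < X)
    (h2 : ∀ x, X ≤ x → (2:ℝ) ^ γ * f x ≤ f (2 * x))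
    (h1 : ∀ x y, X ≤ x → x ≤ y → y ≤ 2 * x → c * (y / x) ^ γ * f x ≤ f y) (hc : 0 ≤ c) :
    ∀ x y, X ≤ x → x ≤ y → c * (y / x) ^ γ * f x ≤ f y := by
  have main : ∀ n : ℕ, ∀ x y, X ≤ x → x ≤ y → y ≤ 2 ^ (n + 1) * x →
      c * (y / x) ^ γ * f x ≤ f y := by
    intro n
    induction n with
    | zero => intro x y hx hxy hy; exact h1 x y hx hxy (by simpa using hy)
    | succ n ih =>
      intro x y hx hxy hy
      rcases le_total y (2 * x) with h | h
      · exact h1 x y hx hxy h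
      · have hx0 : 0 < x := by linarith
        have := ih (2 * x) y (by linarith) h (by rw [pow_succ] at hy; linarith)
        refine le_trans ?_ this
        have e : (y / x) ^ γ = (y / (2 * x)) ^ γ * 2 ^ γ := by
          rw [← Real.mul_rpow (by apply div_nonneg <;> linarith) (by norm_num)]
          congr 1; field_simp
        rw [e]
        have hnn : 0 ≤ c * (y / (2 * x)) ^ γ := by
          apply mul_nonneg hc
          apply Real.rpow_nonneg
          apply div_nonneg <;> linarith
        calc _ = c * (y / (2 * x)) ^ γ * (2 ^ γ * f x) := by ring
          _ ≤ _ := mul_le_mul_of_nonneg_left (h2 x hx) hnn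
  intro x y hx hxy
  have hx0 : 0 < x := by linarith
  obtain ⟨n, hn⟩ := pow_unbounded_of_one_lt (y / x) (by norm_num : (1:ℝ) < 2)
  apply main n x y hx hxy
  rw [div_lt_iff₀ hx0] at hn
  have : (2:ℝ) ^ n * x ≤ 2 ^ (n + 1) * x := by
    rw [pow_succ]; nlinarith [pow_pos (by norm_num : (0:ℝ) < 2) n, mul_pos (pow_pos (by norm_num : (0:ℝ) < 2) n) hx0]
  linarith

/-- local comparability from the derivative bound -/
theorem aux_local (ψ : ℝ → ℝ) (hpos : ∀ p : ℝ, p ≠ 0 → 0 < ψ p)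
    (hdiff1 : ∀ p : ℝ, 0 < p → DifferentiableAt ℝ ψ p) (D₁ : ℝ)
    (hD1 : ∀ l : ℝ, 1 ≤ l → l * |deriv ψ l| ≤ D₁ * ψ l) :
    ∃ K : ℝ, 1 ≤ K ∧ ∀ x y, 1 ≤ x → x ≤ y → y ≤ 2 * x → ψ y ≤ K * ψ x ∧ ψ x ≤ K * ψ y := by
  have hD0 : 0 ≤ D₁ := by
    have h := hD1 1 le_rfl
    have h0 := hpos 1 one_ne_zero
    by_contra hneg
    push Not at hneg
    have := abs_nonneg (deriv ψ 1)
    nlinarith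
  have hd : ∀ (r x : ℝ), 0 < x → HasDerivAt (fun x => x ^ r * ψ x)
      (r * x ^ (r - 1) * ψ x + x ^ r * deriv ψ x) x := by
    intro r x hx
    exact (Real.hasDerivAt_rpow_const (Or.inl hx.ne')).mul (hdiff1 x hx).hasDerivAt
  have hfac : ∀ (r x : ℝ), 0 < x → r * x ^ (r - 1) * ψ x + x ^ r * deriv ψ x
      = x ^ (r - 1) * (r * ψ x + x * deriv ψ x) := by
    intro r x hx
    rw [Real.rpow_sub_one hx.ne']; field_simp
  have hcont : ∀ r : ℝ, ContinuousOn (fun x => x ^ r * ψ x) (Set.Ici 1) := by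
    intro r x hx
    exact (hd r x (by have : (1:ℝ) ≤ x := hx; linarith)).continuousAt.continuousWithinAt
  have hmono : MonotoneOn (fun x => x ^ D₁ * ψ x) (Set.Ici 1) := by
    apply monotoneOn_of_deriv_nonneg (convex_Ici 1) (hcont _)
    · intro x hx
      rw [interior_Ici] at hx
      exact (hd _ x (by have : (1:ℝ) < x := hx; linarith)).differentiableAt.differentiableWithinAt
    · intro x hx
      rw [interior_Ici] at hx
      have hx1 : (1:ℝ) < x := hx
      rw [(hd _ x (by linarith)).deriv, hfac _ _ (by linarith)]
      apply mul_nonneg (Real.rpow_nonneg (by linarith) _)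
      have h := hD1 x hx1.le
      have := mul_le_mul_of_nonneg_left (neg_abs_le (deriv ψ x)) (by linarith : 0 ≤ x)
      linarith
  have hanti : AntitoneOn (fun x => x ^ (-D₁) * ψ x) (Set.Ici 1) := by
    apply antitoneOn_of_deriv_nonpos (convex_Ici 1) (hcont _)
    · intro x hx
      rw [interior_Ici] at hx
      exact (hd _ x (by have : (1:ℝ) < x := hx; linarith)).differentiableAt.differentiableWithinAt
    · intro x hx
      rw [interior_Ici] at hx
      have hx1 : (1:ℝ) < x := hx
      rw [(hd _ x (by linarith)).deriv, hfac _ _ (by linarith)]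
      apply mul_nonpos_of_nonneg_of_nonpos (Real.rpow_nonneg (by linarith) _)
      have h := hD1 x hx1.le
      have := mul_le_mul_of_nonneg_left (le_abs_self (deriv ψ x)) (by linarith : 0 ≤ x)
      linarith
  refine ⟨2 ^ D₁, Real.one_le_rpow (by norm_num) hD0, ?_⟩
  intro x y hx hxy hy
  have hx0 : 0 < x := by linarith
  have hy0 : 0 < y := by linarith
  have hψx := hpos x hx0.ne'
  have hψy := hpos y hy0.ne'
  have hyx : y ^ D₁ ≤ 2 ^ D₁ * x ^ D₁ := by
    rw [← Real.mul_rpow (by norm_num) hx0.le]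
    exact Real.rpow_le_rpow hy0.le hy hD0
  have px : 0 < x ^ D₁ := Real.rpow_pos_of_pos hx0 _
  have py : 0 < y ^ D₁ := Real.rpow_pos_of_pos hy0 _
  constructor
  · have h := hanti (show x ∈ Set.Ici 1 from hx) (show y ∈ Set.Ici 1 from hx.trans hxy) hxy
    simp only [Real.rpow_neg hx0.le, Real.rpow_neg hy0.le] at h
    rw [inv_mul_le_iff₀ py] at h
    calc ψ y ≤ y ^ D₁ * ((x ^ D₁)⁻¹ * ψ x) := h
      _ ≤ (2 ^ D₁ * x ^ D₁) * ((x ^ D₁)⁻¹ * ψ x) :=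
        mul_le_mul_of_nonneg_right hyx (by positivity)
      _ = _ := by field_simp
  · have h := hmono (show x ∈ Set.Ici 1 from hx) (show y ∈ Set.Ici 1 from hx.trans hxy) hxy
    simp only at h
    have : x ^ D₁ * ψ x ≤ x ^ D₁ * (2 ^ D₁ * ψ y) :=
      calc _ ≤ _ := h
        _ ≤ (2 ^ D₁ * x ^ D₁) * ψ y := mul_le_mul_of_nonneg_right hyx hψy.le
        _ = _ := by ring
    exact le_of_mul_le_mul_left this px

theorem aux_near (ψ : ℝ → ℝ) (hnonneg : ∀ p : ℝ, 0 ≤ ψ p) (hpos : ∀ p : ℝ, p ≠ 0 → 0 < ψ p)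
    (hdiff1 : ∀ p : ℝ, 0 < p → DifferentiableAt ℝ ψ p)
    (hliminf : 0 < Filter.liminf (fun p : ℝ => ψ p / p ^ 2) (nhdsWithin (0:ℝ) ({0}ᶜ)))
    (X : ℝ) :
    ∃ c : ℝ, 0 < c ∧ ∀ p, 0 < p → p ≤ X → c * p ^ 2 ≤ ψ p := by
  obtain ⟨a, ha0, ha⟩ := exists_between hliminf
  have hbd : Filter.IsBoundedUnder (· ≥ ·) (nhdsWithin (0:ℝ) ({0}ᶜ)) (fun p : ℝ => ψ p / p ^ 2) :=
    Filter.isBoundedUnder_of ⟨0, fun p => div_nonneg (hnonneg p) (sq_nonneg p)⟩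
  have hev := Filter.eventually_lt_of_lt_liminf ha hbd
  rw [eventually_nhdsWithin_iff, Metric.eventually_nhds_iff] at hev
  obtain ⟨δ, hδ, hball⟩ := hev
  have hcont : ContinuousOn (fun p : ℝ => ψ p / p ^ 2) (Set.Icc (δ / 2) (max X δ)) := by
    intro p hp
    have hp0 : 0 < p := by have := hp.1; linarith
    apply ContinuousAt.continuousWithinAt
    exact (hdiff1 p hp0).continuousAt.div (by fun_prop) (by positivity)
  obtain ⟨m, hm, hmin⟩ := isCompact_Icc.exists_isMinOn
    (Set.nonempty_Icc.2 (by have := le_max_right X δ; linarith)) hcont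
  have hm0 : 0 < m := by have := hm.1; linarith
  have hψm : 0 < ψ m / m ^ 2 := div_pos (hpos m hm0.ne') (by positivity)
  refine ⟨min a (ψ m / m ^ 2), lt_min ha0 hψm, ?_⟩
  intro p hp hpX
  rw [← le_div_iff₀ (by positivity)]
  rcases lt_or_ge p δ with h | h
  · have := hball (y := p) (by rw [Real.dist_eq, sub_zero, abs_of_pos hp]; exact h) hp.ne'
    exact (min_le_left _ _).trans this.le
  · exact (min_le_right _ _).trans
      (hmin (show p ∈ Set.Icc (δ / 2) (max X δ) from ⟨by linarith, hpX.trans (le_max_left _ _)⟩))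

theorem aux_bounds (β : ℝ) (hβ1 : 1 < β) (hβ2 : β ≤ 2) (ψ : ℝ → ℝ)
    (hnonneg : ∀ p : ℝ, 0 ≤ ψ p) (hpos : ∀ p : ℝ, p ≠ 0 → 0 < ψ p)
    (hRV : ∀ l : ℝ, 0 < l →
      Filter.Tendsto (fun x => ψ (l * x) / ψ x) Filter.atTop (nhds (l ^ β)))
    (hdiff1 : ∀ p : ℝ, 0 < p → DifferentiableAt ℝ ψ p) (D₁ : ℝ)
    (hD1 : ∀ l : ℝ, 1 ≤ l → l * |deriv ψ l| ≤ D₁ * ψ l)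
    (C₀ : ℝ) (hC0 : ∀ p : ℝ, ψ p ≤ C₀ * p ^ 2)
    (hliminf : 0 < Filter.liminf (fun p : ℝ => ψ p / p ^ 2) (nhdsWithin (0:ℝ) ({0}ᶜ))) :
    ∃ X γ c C : ℝ, 1 ≤ X ∧ 1 < γ ∧ 0 < c ∧ 0 < C ∧
      (∀ p, 0 < p → p ≤ X → c * p ^ 2 ≤ ψ p) ∧
      (∀ p, X ≤ p → c * p ^ γ ≤ ψ p) ∧
      (∀ x y, X ≤ x → x ≤ y → c * (y / x) ^ γ * ψ x ≤ ψ y) ∧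
      (∀ x y, 0 < x → x ≤ y → X ≤ y → ψ y ≤ C * (y / x) ^ (9 / 4 : ℝ) * ψ x) := by
  obtain ⟨K, hK1, hK⟩ := aux_local ψ hpos hdiff1 D₁ hD1
  have hK0 : 0 < K := by linarith
  obtain ⟨γ, hγ1, hγβ⟩ := exists_between hβ1
  have hlim := hRV 2 (by norm_num)
  have ev1 := hlim.eventually_const_lt
    (Real.rpow_lt_rpow_of_exponent_lt (by norm_num : (1:ℝ) < 2) hγβ)
  have ev2 := hlim.eventually_lt_const
    (Real.rpow_lt_rpow_of_exponent_lt (by norm_num : (1:ℝ) < 2) (by linarith : β < 9 / 4))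
  obtain ⟨X0, hX0⟩ := Filter.eventually_atTop.1 (ev1.and ev2)
  set X := max X0 1 with hX
  have hX1 : 1 ≤ X := le_max_right _ _
  have hXd : ∀ x, X ≤ x → 2 ^ γ * ψ x ≤ ψ (2 * x) ∧ ψ (2 * x) ≤ 2 ^ (9 / 4 : ℝ) * ψ x := by
    intro x hx
    have hx0 : 0 < x := by linarith
    have hψ := hpos x hx0.ne'
    have h := hX0 x ((le_max_left _ _).trans hx)
    rw [lt_div_iff₀ hψ, div_lt_iff₀ hψ] at h
    exact ⟨h.1.le, h.2.le⟩
  have p2 : (0:ℝ) < 2 ^ γ := by positivity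
  have hlow := aux_potter ψ X γ (1 / (K * 2 ^ γ)) (by linarith) (fun x hx => (hXd x hx).1)
    (by
      intro x y hx hxy hy
      have hx0 : 0 < x := by linarith
      have hψ := hpos x hx0.ne'
      have h := (hK x y (by linarith) hxy hy).2
      have h' : (y / x) ^ γ ≤ 2 ^ γ := by
        apply Real.rpow_le_rpow (div_nonneg (by linarith) hx0.le) _ (by linarith)
        rw [div_le_iff₀ hx0]; exact hy
      calc 1 / (K * 2 ^ γ) * (y / x) ^ γ * ψ x ≤ 1 / (K * 2 ^ γ) * 2 ^ γ * ψ x := by gcongr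
        _ = ψ x / K := by field_simp
        _ ≤ ψ y := by rw [div_le_iff₀ hK0]; linarith)
    (by positivity)
  have hup := aux_potter (fun x => (ψ x)⁻¹) X (-(9 / 4)) (1 / K) (by linarith)
    (by
      intro x hx
      have hx0 : 0 < x := by linarith
      have hψ := hpos x hx0.ne'
      have hψ2 := hpos (2 * x) (by positivity)
      have h := (hXd x hx).2
      rw [Real.rpow_neg (by norm_num), ← mul_inv]
      exact inv_anti₀ hψ2 h)
    (by
      intro x y hx hxy hy
      have hx0 : 0 < x := by linarith
      have hy0 : 0 < y := by linarith
      have hψ := hpos x hx0.ne'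
      have hψy := hpos y hy0.ne'
      have h := (hK x y (by linarith) hxy hy).1
      have h' : (y / x) ^ (-(9 / 4) : ℝ) ≤ 1 := by
        apply Real.rpow_le_one_of_one_le_of_nonpos _ (by norm_num)
        rw [one_le_div hx0]; exact hxy
      calc 1 / K * (y / x) ^ (-(9 / 4) : ℝ) * (ψ x)⁻¹ ≤ 1 / K * 1 * (ψ x)⁻¹ := by gcongr
        _ = (K * ψ x)⁻¹ := by field_simp
        _ ≤ (ψ y)⁻¹ := inv_anti₀ hψy h)
    (by positivity)
  have hup' : ∀ x y, X ≤ x → x ≤ y → ψ y ≤ K * (y / x) ^ (9 / 4 : ℝ) * ψ x := by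
    intro x y hx hxy
    have hx0 : 0 < x := by linarith
    have hy0 : 0 < y := by linarith
    have hψ := hpos x hx0.ne'
    have hψy := hpos y hy0.ne'
    have h := hup x y hx hxy
    rw [Real.rpow_neg (by positivity)] at h
    have hp : 0 < (y / x) ^ (9 / 4 : ℝ) := by positivity
    have e : 1 / K * ((y / x) ^ (9 / 4 : ℝ))⁻¹ * (ψ x)⁻¹ = (K * (y / x) ^ (9 / 4 : ℝ) * ψ x)⁻¹ := by
      field_simp
    rw [e] at h
    exact (inv_le_inv₀ (by positivity) hψy).1 h
  obtain ⟨c1, hc1, hnear⟩ := aux_near ψ hnonneg hpos hdiff1 hliminf X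
  have hXpos : 0 < X := by linarith
  have hψX := hpos X hXpos.ne'
  have hC0pos : 0 ≤ C₀ := by
    have := hC0 1
    have := hnonneg 1
    linarith
  set c2 := 1 / (K * 2 ^ γ) with hc2
  have hc2pos : 0 < c2 := by positivity
  set c3 := c2 * ψ X / X ^ γ with hc3
  have hc3pos : 0 < c3 := by positivity
  refine ⟨X, γ, min c1 (min c2 c3), max K (C₀ / c1), hX1, hγ1, ?_, ?_, ?_, ?_, ?_, ?_⟩
  · exact lt_min hc1 (lt_min hc2pos hc3pos)
  · exact lt_max_of_lt_left hK0
  · intro p hp hpX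
    refine le_trans ?_ (hnear p hp hpX)
    gcongr
    exact min_le_left _ _
  · intro p hp
    have hp0 : 0 < p := by linarith
    have h := hlow X p le_rfl hp
    rw [Real.div_rpow hp0.le hXpos.le] at h
    calc min c1 (min c2 c3) * p ^ γ ≤ c3 * p ^ γ := by
          gcongr
          exact (min_le_right _ _).trans (min_le_right _ _)
      _ = c2 * (p ^ γ / X ^ γ) * ψ X := by rw [hc3]; ring
      _ ≤ _ := h
  · intro x y hx hxy
    have hx0 : 0 < x := by linarith
    have hy0 : 0 < y := by linarith
    have hψ := hpos x hx0.ne'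
    refine le_trans ?_ (hlow x y hx hxy)
    gcongr
    exact (min_le_right _ _).trans (min_le_left _ _)
  · intro x y hx hxy hXy
    have hy0 : 0 < y := by linarith
    have hψ := hpos x hx.ne'
    rcases le_total X x with h | h
    · refine (hup' x y h hxy).trans ?_
      gcongr
      exact le_max_left _ _
    · have h1 := hnear x hx h
      have h2 := hC0 y
      have h3 : (y / x) ^ 2 ≤ (y / x) ^ (9 / 4 : ℝ) := by
        rw [← Real.rpow_natCast]
        apply Real.rpow_le_rpow_of_exponent_le
        · rw [one_le_div hx]; exact hxy
        · norm_num
      calc ψ y ≤ C₀ * y ^ 2 := h2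
        _ = C₀ / c1 * (y / x) ^ 2 * (c1 * x ^ 2) := by field_simp
        _ ≤ C₀ / c1 * (y / x) ^ (9 / 4 : ℝ) * ψ x := by gcongr
        _ ≤ _ := by
          gcongr
          exact le_max_right _ _

theorem aux_dom (F : ℝ → ℝ) (X γ M₁ M₂ : ℝ) (hX : 1 ≤ X) (hγ : 1 < γ) (hF : Measurable F)
    (h1 : ∀ p, 0 < p → p ≤ X → |F p| ≤ M₁) (h2 : ∀ p, X ≤ p → |F p| ≤ M₂ * p ^ (-γ)) :
    IntegrableOn F (Set.Ioi 0) := by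
  have hX0 : (0:ℝ) < X := by linarith
  rw [← Set.Ioc_union_Ioi_eq_Ioi hX0.le, integrableOn_union]
  constructor
  · refine Measure.integrableOn_of_bounded (M := M₁) (by simp) hF.aestronglyMeasurable ?_
    filter_upwards [ae_restrict_mem measurableSet_Ioc] with p hp
    exact h1 p hp.1 hp.2
  · refine Integrable.mono'
      ((integrableOn_Ioi_rpow_of_lt (by linarith : -γ < -1) hX0).const_mul M₂)
      hF.aestronglyMeasurable ?_
    filter_upwards [ae_restrict_mem measurableSet_Ioi] with p hp
    exact h2 p (le_of_lt hp)

theorem aux_identity (ψ : ℝ → ℝ) (hmeas : Measurable ψ) (heven : ∀ p : ℝ, ψ (-p) = ψ p)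
    (hnonneg : ∀ p : ℝ, 0 ≤ ψ p) (hpos : ∀ p : ℝ, p ≠ 0 → 0 < ψ p)
    (X γ c : ℝ) (hX : 1 ≤ X) (hγ : 1 < γ) (hc : 0 < c)
    (hnear : ∀ p, 0 < p → p ≤ X → c * p ^ 2 ≤ ψ p)
    (hfar : ∀ p, X ≤ p → c * p ^ γ ≤ ψ p) (h : ℝ) (hh : 0 < h) :
    ∫ x : ℝ, (∫ s in Set.Ioi (0:ℝ),
          (2 * pdens ψ s x - pdens ψ s (x + h) - pdens ψ s (x - h))) ^ 2
      = (16 / Real.pi) * ∫ p in Set.Ioi (0:ℝ), Real.sin (p * h / 2) ^ 4 / ψ p ^ 2 := by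
  have hfarinv : ∀ p, X ≤ p → (ψ p)⁻¹ ≤ c⁻¹ * p ^ (-γ) := by
    intro p hp
    have hp0 : 0 < p := by linarith
    rw [Real.rpow_neg hp0.le, ← mul_inv]
    exact inv_anti₀ (by positivity) (hfar p hp)
  set g : ℝ → ℝ := fun p => Real.sin (p * h / 2) ^ 2 / ψ p with hg
  have hgmeas : Measurable g := by
    rw [hg]; fun_prop
  have hgnn : ∀ p, 0 ≤ g p := fun p => div_nonneg (sq_nonneg _) (hnonneg p)
  have hgnear : ∀ p, 0 < p → p ≤ X → |g p| ≤ h ^ 2 / 4 / c := by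
    intro p hp hpX
    rw [abs_of_nonneg (hgnn p)]
    have hψ := hpos p hp.ne'
    have hs : Real.sin (p * h / 2) ^ 2 ≤ (p * h / 2) ^ 2 := by
      rw [sq_le_sq]; exact Real.abs_sin_le_abs
    rw [hg]
    simp only
    rw [div_le_div_iff₀ hψ hc]
    have := hnear p hp hpX
    calc Real.sin (p * h / 2) ^ 2 * c ≤ (p * h / 2) ^ 2 * c := by gcongr
      _ = h ^ 2 / 4 * (c * p ^ 2) := by ring
      _ ≤ _ := by gcongr
  have hgfar : ∀ p, X ≤ p → |g p| ≤ c⁻¹ * p ^ (-γ) := by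
    intro p hp
    rw [abs_of_nonneg (hgnn p)]
    have hp0 : 0 < p := by linarith
    have hψ := hpos p hp0.ne'
    refine le_trans ?_ (hfarinv p hp)
    rw [hg]
    simp only
    rw [div_eq_mul_inv]
    have := Real.sin_sq_le_one (p * h / 2)
    exact mul_le_of_le_one_left (by positivity) this
  have hgint0 : IntegrableOn g (Set.Ioi 0) :=
    aux_dom g X γ _ _ hX hγ hgmeas hgnear hgfar
  have hgev : ∀ p, g (-p) = g p := by
    intro p
    simp only [hg, heven]
    rw [show -p * h / 2 = -(p * h / 2) by ring, Real.sin_neg, neg_sq]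
  have hgint : Integrable g := by
    have hneg : IntegrableOn g (Set.Iio 0) := by
      have h2 : IntegrableOn (fun p => g (-p)) (Set.Iio 0) := by
        have h3 := ((Measure.measurePreserving_neg (volume : Measure ℝ)).integrableOn_comp_preimage
          (Homeomorph.neg ℝ).isClosedEmbedding.measurableEmbedding (f := g) (s := Set.Ioi 0)).2 hgint0
        rw [Set.neg_preimage, Set.neg_Ioi, neg_zero] at h3
        exact h3
      simpa only [hgev] using h2
    rw [← integrableOn_univ, ← Set.Iic_union_Ioi (a := (0:ℝ)), integrableOn_union]
    exact ⟨(integrableOn_Iic_iff_integrableOn_Iio (by simp)).2 hneg, hgint0⟩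
  have hgbd : ∀ p, |g p| ≤ h ^ 2 / 4 / c + c⁻¹ := by
    have pos : ∀ p, 0 < p → |g p| ≤ h ^ 2 / 4 / c + c⁻¹ := by
      intro p hp
      rcases le_total p X with hpX | hpX
      · have := hgnear p hp hpX
        have : 0 < c⁻¹ := by positivity
        linarith
      · have h1 := hgfar p hpX
        have h2 : p ^ (-γ) ≤ 1 :=
          Real.rpow_le_one_of_one_le_of_nonpos (by linarith) (by linarith)
        have h3 : c⁻¹ * p ^ (-γ) ≤ c⁻¹ * 1 := by gcongr
        have : 0 ≤ h ^ 2 / 4 / c := by positivity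
        linarith
    intro p
    rcases lt_trichotomy p 0 with hp | hp | hp
    · rw [← hgev]; exact pos _ (by linarith)
    · subst hp
      simp only [hg]
      simp
      positivity
    · exact pos p hp
  have hgmem : MemLp g 2 := by
    rw [memLp_two_iff_integrable_sq hgmeas.aestronglyMeasurable]
    simp_rw [pow_two]
    refine hgint.bdd_mul (c := h ^ 2 / 4 / c + c⁻¹) hgmeas.aestronglyMeasurable ?_
    filter_upwards with p
    exact hgbd p
  -- integrability of the exponentials
  have hexp : ∀ s, 0 < s → IntegrableOn (fun p => Real.exp (-s * ψ p)) (Set.Ioi 0) := by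
    intro s hs
    refine aux_dom _ X γ 1 (s⁻¹ * c⁻¹) hX hγ (by fun_prop) ?_ ?_
    · intro p hp hpX
      rw [abs_of_pos (Real.exp_pos _)]
      apply Real.exp_le_one_iff.2
      have := hnonneg p
      nlinarith
    · intro p hp
      have hp0 : 0 < p := by linarith
      have hψ := hpos p hp0.ne'
      rw [abs_of_pos (Real.exp_pos _)]
      have h1 : Real.exp (-s * ψ p) ≤ (s * ψ p)⁻¹ := by
        rw [neg_mul, Real.exp_neg]
        apply inv_anti₀ (by positivity)
        have := Real.add_one_le_exp (s * ψ p)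
        linarith
      refine h1.trans ?_
      rw [mul_inv, mul_assoc]
      have := hfarinv p hp
      gcongr
  have hcosexp : ∀ s x, 0 < s →
      IntegrableOn (fun p => Real.cos (p * x) * Real.exp (-s * ψ p)) (Set.Ioi 0) := by
    intro s x hs
    refine (hexp s hs).bdd_mul (c := 1)
      (by fun_prop : Continuous fun p : ℝ => Real.cos (p * x)).aestronglyMeasurable ?_
    filter_upwards with p
    exact Real.abs_cos_le_one _
  have hdiff : ∀ s x, 0 < s → 2 * pdens ψ s x - pdens ψ s (x + h) - pdens ψ s (x - h)
      = (4 / Real.pi) * ∫ p in Set.Ioi (0:ℝ),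
          Real.cos (p * x) * Real.sin (p * h / 2) ^ 2 * Real.exp (-s * ψ p) := by
    intro s x hs
    unfold pdens
    have e : ∀ p : ℝ, Real.cos (p * x) * Real.sin (p * h / 2) ^ 2 * Real.exp (-s * ψ p)
        = (1 / 4) * (2 * (Real.cos (p * x) * Real.exp (-s * ψ p))
          - Real.cos (p * (x + h)) * Real.exp (-s * ψ p)
          - Real.cos (p * (x - h)) * Real.exp (-s * ψ p)) := by
      intro p
      have h1 : Real.cos (p * h) = 1 - 2 * Real.sin (p * h / 2) ^ 2 := by
        have := Real.cos_two_mul (p * h / 2)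
        have h2 := Real.sin_sq_add_cos_sq (p * h / 2)
        rw [show 2 * (p * h / 2) = p * h by ring] at this
        linarith
      rw [mul_add p x h, mul_sub p x h, Real.cos_add, Real.cos_sub, h1]
      ring
    simp_rw [e]
    rw [integral_const_mul, integral_sub, integral_sub, integral_const_mul]
    · ring
    · exact (hcosexp s x hs).const_mul 2
    · exact hcosexp s (x + h) hs
    · exact ((hcosexp s x hs).const_mul 2).sub (hcosexp s (x + h) hs)
    · exact hcosexp s (x - h) hs
  have hexps : ∀ a : ℝ, 0 < a → IntegrableOn (fun s => Real.exp (-s * a)) (Set.Ioi 0) ∧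
      ∫ s in Set.Ioi (0:ℝ), Real.exp (-s * a) = a⁻¹ := by
    intro a ha
    have e : ∀ s : ℝ, Real.exp (-s * a) = Real.exp (-a * s) := fun s => by ring_nf
    simp_rw [e]
    refine ⟨integrableOn_exp_mul_Ioi (by linarith) 0, ?_⟩
    rw [integral_exp_mul_Ioi (by linarith)]
    simp
  have hinner : ∀ x, ∫ s in Set.Ioi (0:ℝ),
      (2 * pdens ψ s x - pdens ψ s (x + h) - pdens ψ s (x - h))
      = (4 / Real.pi) * ∫ p in Set.Ioi (0:ℝ), Real.cos (p * x) * g p := by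
    intro x
    rw [setIntegral_congr_fun measurableSet_Ioi (fun s hs => hdiff s x hs), integral_const_mul,
      integral_integral_swap]
    · congr 1
      apply setIntegral_congr_fun measurableSet_Ioi
      intro p hp
      have hp0 : (0:ℝ) < p := hp
      simp only
      rw [integral_const_mul, (hexps _ (hpos p hp0.ne')).2, hg]
      simp only
      ring
    · have hm : Measurable (Function.uncurry fun s p : ℝ =>
          Real.cos (p * x) * Real.sin (p * h / 2) ^ 2 * Real.exp (-s * ψ p)) := by
        unfold Function.uncurry
        fun_prop
      rw [integrable_prod_iff' hm.aestronglyMeasurable]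
      constructor
      · filter_upwards [ae_restrict_mem measurableSet_Ioi] with p hp
        have hp0 : (0:ℝ) < p := hp
        exact (hexps _ (hpos p hp0.ne')).1.const_mul (Real.cos (p * x) * Real.sin (p * h / 2) ^ 2)
      · have hi : IntegrableOn (fun p => |Real.cos (p * x)| * g p) (Set.Ioi 0) := by
          refine hgint0.bdd_mul (c := 1)
            (by fun_prop : Continuous fun p : ℝ => |Real.cos (p * x)|).aestronglyMeasurable ?_
          filter_upwards with p
          rw [Real.norm_eq_abs, abs_abs]
          exact Real.abs_cos_le_one _
        refine hi.congr_fun ?_ measurableSet_Ioi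
        intro p hp
        have hp0 : (0:ℝ) < p := hp
        simp only [Function.uncurry, Real.norm_eq_abs, abs_mul, Real.abs_exp, abs_pow, sq_abs]
        rw [integral_const_mul, (hexps _ (hpos p hp0.ne')).2, hg]
        simp only
        ring
  simp_rw [hinner, mul_pow]
  rw [integral_const_mul, aux_cos g hgev hgint hgmem]
  have e : ∀ p, g p ^ 2 = Real.sin (p * h / 2) ^ 4 / ψ p ^ 2 := by
    intro p; simp only [hg]; rw [div_pow]; ring
  simp_rw [e]
  have hpi := Real.pi_pos
  rw [← mul_assoc]
  congr 1
  field_simp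
  norm_num

theorem aux_scale (ψ : ℝ → ℝ) (h : ℝ) (hh : 0 < h) :
    h * ψ (1 / h) ^ 2 * ((16 / Real.pi) * ∫ p in Set.Ioi (0:ℝ), Real.sin (p * h / 2) ^ 4 / ψ p ^ 2)
     = (16 / Real.pi) * ∫ q in Set.Ioi (0:ℝ), Real.sin (q / 2) ^ 4 * (ψ (1 / h) / ψ (q * (1 / h))) ^ 2 := by
  have e := integral_comp_mul_left_Ioi
    (fun q => Real.sin (q / 2) ^ 4 * (ψ (1 / h) / ψ (q * (1 / h))) ^ 2) 0 hh
  rw [mul_zero, smul_eq_mul] at e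
  have e2 : ∀ p : ℝ, Real.sin (h * p / 2) ^ 4 * (ψ (1 / h) / ψ (h * p * (1 / h))) ^ 2
      = ψ (1 / h) ^ 2 * (Real.sin (p * h / 2) ^ 4 / ψ p ^ 2) := by
    intro p
    rw [show h * p * (1 / h) = p by field_simp, mul_comm h p, div_pow]
    ring
  simp_rw [e2] at e
  rw [integral_const_mul] at e
  rw [eq_inv_mul_iff_mul_eq₀ hh.ne'] at e
  rw [← e]
  ring

theorem aux_limit (β : ℝ) (ψ : ℝ → ℝ) (hmeas : Measurable ψ)
    (hpos : ∀ p : ℝ, p ≠ 0 → 0 < ψ p)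
    (hRV : ∀ l : ℝ, 0 < l →
      Filter.Tendsto (fun x => ψ (l * x) / ψ x) Filter.atTop (nhds (l ^ β)))
    (X γ c C : ℝ) (hX : 1 ≤ X) (hγ : 1 < γ) (hc : 0 < c) (hC : 0 < C)
    (hlow : ∀ x y, X ≤ x → x ≤ y → c * (y / x) ^ γ * ψ x ≤ ψ y)
    (hup : ∀ x y, 0 < x → x ≤ y → X ≤ y → ψ y ≤ C * (y / x) ^ (9 / 4 : ℝ) * ψ x) :
    Filter.Tendsto (fun h : ℝ => ∫ q in Set.Ioi (0:ℝ),
        Real.sin (q / 2) ^ 4 * (ψ (1 / h) / ψ (q * (1 / h))) ^ 2)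
      (nhdsWithin (0:ℝ) (Set.Ioi 0))
      (nhds (∫ p in Set.Ioi (0:ℝ), Real.sin (p / 2) ^ 4 / p ^ (2 * β))) := by
  have hinv : Filter.Tendsto (fun h : ℝ => 1 / h) (nhdsWithin (0:ℝ) (Set.Ioi 0)) Filter.atTop := by
    simpa only [one_div] using tendsto_inv_nhdsGT_zero (𝕜 := ℝ)
  refine Filter.Tendsto.comp (g := fun y : ℝ => ∫ q in Set.Ioi (0:ℝ),
        Real.sin (q / 2) ^ 4 * (ψ y / ψ (q * y)) ^ 2) ?_ hinv
  set B : ℝ → ℝ := fun q => if q ≤ 1 then C ^ 2 * q ^ (-(1 / 2) : ℝ) else (c⁻¹) ^ 2 * q ^ (-(2 * γ))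
    with hB
  apply tendsto_integral_filter_of_dominated_convergence B
  · filter_upwards with y
    exact (by fun_prop : Measurable fun q : ℝ =>
      Real.sin (q / 2) ^ 4 * (ψ y / ψ (q * y)) ^ 2).aestronglyMeasurable
  · filter_upwards [Filter.eventually_ge_atTop X] with y hy
    filter_upwards [ae_restrict_mem measurableSet_Ioi] with q hq
    have hq0 : (0:ℝ) < q := hq
    have hy0 : 0 < y := by linarith
    have hψy := hpos y hy0.ne'
    have hψqy := hpos (q * y) (by positivity)
    rw [Real.norm_eq_abs, abs_of_nonneg (by positivity)]
    simp only [hB]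
    split_ifs with hq1
    · have h1 := hup (q * y) y (by positivity) (by nlinarith) hy
      rw [show y / (q * y) = q⁻¹ by field_simp] at h1
      have h2 : ψ y / ψ (q * y) ≤ C * q⁻¹ ^ (9 / 4 : ℝ) := by
        rw [div_le_iff₀ hψqy]; exact h1
      have hs : Real.sin (q / 2) ^ 4 ≤ q ^ 4 := by
        have : |Real.sin (q / 2)| ≤ q := by
          refine Real.abs_sin_le_abs.trans ?_
          rw [abs_of_pos (by positivity)]; linarith
        have h3 := pow_le_pow_left₀ (abs_nonneg _) this 4
        rwa [Even.pow_abs (by decide)] at h3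
      calc _ ≤ q ^ 4 * (C * q⁻¹ ^ (9 / 4 : ℝ)) ^ 2 := by gcongr
        _ = C ^ 2 * (q ^ 4 * (q⁻¹ ^ (9 / 4 : ℝ)) ^ 2) := by ring
        _ = _ := by
          congr 1
          rw [Real.inv_rpow hq0.le, ← Real.rpow_neg hq0.le, ← Real.rpow_natCast,
            ← Real.rpow_natCast, ← Real.rpow_mul hq0.le, ← Real.rpow_add hq0]
          norm_num
    · push Not at hq1
      have h1 := hlow y (q * y) hy (by nlinarith)
      rw [show q * y / y = q by field_simp] at h1
      have hqγ : 0 < q ^ γ := by positivity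
      have h2 : ψ y / ψ (q * y) ≤ c⁻¹ * q ^ (-γ) := by
        rw [Real.rpow_neg hq0.le, ← mul_inv, div_le_iff₀ hψqy, inv_mul_eq_div,
          le_div_iff₀ (by positivity)]
        linarith
      have hs : Real.sin (q / 2) ^ 4 ≤ 1 := by
        have h3 := pow_le_one₀ (n := 4) (abs_nonneg _) (Real.abs_sin_le_one (q / 2))
        rwa [Even.pow_abs (by decide)] at h3
      calc _ ≤ 1 * (c⁻¹ * q ^ (-γ)) ^ 2 := by gcongr
        _ = (c⁻¹) ^ 2 * (q ^ (-γ)) ^ 2 := by ring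
        _ = _ := by
          congr 1
          rw [← Real.rpow_natCast, ← Real.rpow_mul hq0.le]
          congr 1; push_cast; ring
  · change IntegrableOn B (Set.Ioi 0)
    rw [← Set.Ioc_union_Ioi_eq_Ioi (zero_le_one' ℝ), integrableOn_union]
    constructor
    · have h1 : IntegrableOn (fun q : ℝ => C ^ 2 * q ^ (-(1 / 2) : ℝ)) (Set.Ioc 0 1) := by
        have := intervalIntegral.intervalIntegrable_rpow' (a := 0) (b := 1) (r := -(1 / 2))
          (by norm_num)
        rw [intervalIntegrable_iff_integrableOn_Ioc_of_le zero_le_one] at this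
        exact this.const_mul _
      refine h1.congr_fun ?_ measurableSet_Ioc
      intro q hq
      simp only [hB]
      rw [if_pos hq.2]
    · have h1 := (integrableOn_Ioi_rpow_of_lt (by linarith : -(2 * γ) < -1)
        (zero_lt_one' ℝ)).const_mul ((c⁻¹) ^ 2)
      refine IntegrableOn.congr_fun h1 ?_ measurableSet_Ioi
      intro q hq
      have : (1:ℝ) < q := hq
      simp only [hB]
      rw [if_neg (not_le.2 this)]
  · filter_upwards [ae_restrict_mem measurableSet_Ioi] with q hq
    have hq0 : (0:ℝ) < q := hq
    have h1 := hRV q hq0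
    have hqβ : 0 < q ^ β := by positivity
    have h2 := ((h1.inv₀ hqβ.ne').pow 2).const_mul (Real.sin (q / 2) ^ 4)
    have e : Real.sin (q / 2) ^ 4 / q ^ (2 * β) = Real.sin (q / 2) ^ 4 * ((q ^ β)⁻¹) ^ 2 := by
      rw [inv_pow, ← Real.rpow_natCast (q ^ β) 2, ← Real.rpow_mul hq0.le, div_eq_mul_inv]
      congr 3; push_cast; ring
    rw [e]
    simpa only [inv_div] using h2

end

end Stmt11Aux

theorem stmt_11
    (β : ℝ) (hβ1 : 1 < β) (hβ2 : β ≤ 2)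
    (ψ : ℝ → ℝ)
    (hmeas : Measurable ψ)
    (heven : ∀ p : ℝ, ψ (-p) = ψ p)
    (hnonneg : ∀ p : ℝ, 0 ≤ ψ p)
    (hpos : ∀ p : ℝ, p ≠ 0 → 0 < ψ p)
    (hRV : ∀ l : ℝ, 0 < l →
      Filter.Tendsto (fun x => ψ (l * x) / ψ x) Filter.atTop (nhds (l ^ β)))
    (hdiff1 : ∀ p : ℝ, 0 < p → DifferentiableAt ℝ ψ p)
    (hdiff2 : ∀ p : ℝ, 0 < p → DifferentiableAt ℝ (deriv ψ) p)
    (D₁ D₂ : ℝ)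
    (hD1 : ∀ l : ℝ, 1 ≤ l → l * |deriv ψ l| ≤ D₁ * ψ l)
    (hD2 : ∀ l : ℝ, 1 ≤ l → l ^ 2 * |deriv (deriv ψ) l| ≤ D₂ * ψ l)
    (hint1 : MeasureTheory.IntegrableOn (fun l : ℝ => (deriv ψ l) ^ 2) (Set.Ioc (0:ℝ) 1))
    (hint2 : MeasureTheory.IntegrableOn (fun l : ℝ => |deriv (deriv ψ) l|) (Set.Ioc (0:ℝ) 1))
    (hint3 : MeasureTheory.IntegrableOn (fun l : ℝ => ψ l / l) (Set.Ioc (0:ℝ) 1))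
    (C₀ : ℝ) (hC0 : ∀ p : ℝ, ψ p ≤ C₀ * p ^ 2)
    (hliminf : 0 < Filter.liminf (fun p : ℝ => ψ p / p ^ 2) (nhdsWithin (0:ℝ) ({0}ᶜ))) :
    Filter.Tendsto (fun h : ℝ => h * ψ (1 / h) ^ 2 *
        ∫ x : ℝ, (∫ s in Set.Ioi (0:ℝ),
          (2 * pdens ψ s x - pdens ψ s (x + h) - pdens ψ s (x - h))) ^ 2)
      (nhdsWithin (0:ℝ) (Set.Ioi 0))
      (nhds ((16 / Real.pi) * ∫ p in Set.Ioi (0:ℝ), Real.sin (p / 2) ^ 4 / p ^ (2 * β))) := by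
  obtain ⟨X, γ, c, C, hX, hγ, hc, hC, hnear, hfar, hlow, hup⟩ :=
    Stmt11Aux.aux_bounds β hβ1 hβ2 ψ hnonneg hpos hRV hdiff1 D₁ hD1 C₀ hC0 hliminf
  have hlim := (Stmt11Aux.aux_limit β ψ hmeas hpos hRV X γ c C hX hγ hc hC hlow hup).const_mul
    (16 / Real.pi)
  refine hlim.congr' ?_
  filter_upwards [self_mem_nhdsWithin] with h hh
  have hh0 : (0:ℝ) < h := hh
  rw [Stmt11Aux.aux_identity ψ hmeas heven hnonneg hpos X γ c hX hγ hc hnear hfar h hh0,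
    Stmt11Aux.aux_scale ψ h hh0]
end

section
/- There exist a constant C < ∞ and h₀ > 0 such that for all 0 < h ≤ h₀, h·ψ(1/h)² · ( c_{ψ,h,1} − ∫_ℝ (∫₀^{√h} Δ^hΔ^{−h} p_s(x) ds)² dx ) ≤ C·h^{1/2}, and this quantity is nonnegative. -/
open MeasureTheory FourierTransform
open scoped ContDiff

lemma plancherel_aux (f : ℝ → ℂ) (hf : Integrable f) (hf2 : MemLp f 2) :
    ∫ w, ‖𝓕 f w‖ ^ 2 = ∫ x, ‖f x‖ ^ 2 := by
  let U : Lp (α := ℝ) ℂ 2 volume := hf2.toLp f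
  let V : Lp (α := ℝ) ℂ 2 volume := 𝓕 U
  have key : (V : ℝ → ℂ) =ᵐ[volume] 𝓕 f := by
    apply ae_eq_of_integral_contDiff_smul_eq
    · exact (Lp.memLp _).locallyIntegrable (by norm_num)
    · exact (VectorFourier.fourierIntegral_continuous Real.continuous_fourierChar
        (by exact continuous_inner) hf).locallyIntegrable
    · intro g g_smooth g_cpt
      have hg₁ : HasCompactSupport (Complex.ofRealCLM ∘ g) := g_cpt.comp_left rfl
      have hg₂ : ContDiff ℝ ∞ (Complex.ofRealCLM ∘ g) := by fun_prop
      set G := hg₁.toSchwartzMap hg₂ with hG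
      have h1 := congrArg (fun T => T G)
        (Lp.fourier_toTemperedDistribution_eq U)
      simp only [TemperedDistribution.fourier_apply, Lp.toTemperedDistribution_apply] at h1
      have h2 : ∫ x, (𝓕 G) x • U x = ∫ x, (𝓕 G) x • f x := by
        apply integral_congr_ae
        filter_upwards [hf2.coeFn_toLp] with x hx
        simp only [U]; rw [hx]
      have h3 : ∫ x, (𝓕 G) x • f x = ∫ x, G x • 𝓕 f x := by
        have := VectorFourier.integral_fourierIntegral_smul_eq_flip (L := innerₗ ℝ) (μ := volume) (ν := volume)
          Real.continuous_fourierChar continuous_inner G.integrable hf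
        simpa [SchwartzMap.fourier_coe, Real.fourier_eq] using! this
      have h4 : ∀ F : ℝ → ℂ, ∫ x, g x • F x = ∫ x, G x • F x := by
        intro F; simp [hG]
      rw [h4, h4, ← h3, ← h2]; exact h1.symm
  have n1 : ‖V‖ = ‖U‖ := Lp.norm_fourier_eq U
  have nsq : ∀ u : Lp (α := ℝ) ℂ 2, ∫ x, ‖u x‖ ^ 2 = ‖u‖ ^ 2 := by
    intro u
    have := L2.inner_def (𝕜 := ℂ) u u
    have h := congrArg Complex.re this
    rw [inner_self_eq_norm_sq_to_K] at h
    have h5 : ∫ x, inner ℂ (u x) (u x) = ((∫ x, ‖u x‖ ^ 2 : ℝ) : ℂ) := by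
      rw [← integral_complex_ofReal]
      congr 1; ext x; rw [inner_self_eq_norm_sq_to_K]; simp
    rw [h5] at h
    rw [Complex.ofReal_re] at h
    rw [← h]
    norm_cast
  calc ∫ w, ‖𝓕 f w‖ ^ 2 = ∫ w, ‖V w‖ ^ 2 := by
        apply integral_congr_ae; filter_upwards [key] with x hx; rw [hx]
    _ = ∫ x, ‖U x‖ ^ 2 := by rw [nsq, nsq, n1]
    _ = _ := by apply integral_congr_ae; filter_upwards [hf2.coeFn_toLp] with x hx; simp only [U]; rw [hx]

lemma cos_plancherel (G : ℝ → ℝ) (hev : ∀ p, G (-p) = G p) (hG : Integrable G) (hG2 : MemLp G 2) :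
    ∫ x : ℝ, ((1 / Real.pi) * ∫ p in Set.Ioi (0:ℝ), Real.cos (p * x) * G p) ^ 2
      = (1 / (2 * Real.pi)) * ∫ p, G p ^ 2 := by
  have hpi := Real.pi_pos
  have hF : Integrable (fun p => (G p : ℂ)) := hG.ofReal
  have hF2 : MemLp (fun p => (G p : ℂ)) 2 := hG2.ofReal
  have pl := plancherel_aux _ hF hF2
  have hcos : ∀ x : ℝ, Integrable (fun p => Real.cos (p * x) * G p) := fun x =>
    hG.bdd_mul (c := 1) (by fun_prop) (by filter_upwards with p; simpa using Real.abs_cos_le_one _)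
  have hsin : ∀ x : ℝ, Integrable (fun p => Real.sin (p * x) * G p) := fun x =>
    hG.bdd_mul (c := 1) (by fun_prop) (by filter_upwards with p; simpa using Real.abs_sin_le_one _)
  have h1 : ∀ w : ℝ, 𝓕 (fun p => (G p : ℂ)) w
      = ((2 * ∫ p in Set.Ioi (0:ℝ), Real.cos (p * (2 * Real.pi * w)) * G p : ℝ) : ℂ) := by
    intro w
    have e1 : 2 * ∫ p in Set.Ioi (0:ℝ), Real.cos (p * (2 * Real.pi * w)) * G p
        = ∫ p : ℝ, Real.cos (p * (2 * Real.pi * w)) * G p := by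
      rw [← integral_comp_abs (f := fun p => Real.cos (p * (2 * Real.pi * w)) * G p)]
      congr 1; ext p
      rcases abs_choice p with h | h <;> rw [h]
      rw [hev, neg_mul, Real.cos_neg]
    have e2 : ∫ p : ℝ, Real.sin (p * (2 * Real.pi * w)) * G p = 0 := by
      have := integral_neg_eq_self (fun p : ℝ => Real.sin (p * (2 * Real.pi * w)) * G p) volume
      simp only [hev, neg_mul, Real.sin_neg, integral_neg] at this
      linarith
    rw [e1, Real.fourier_real_eq_integral_exp_smul]
    have e3 : ∀ v : ℝ, Complex.exp (↑(-2 * Real.pi * v * w) * Complex.I) • (G v : ℂ)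
        = ((Real.cos (v * (2 * Real.pi * w)) * G v : ℝ) : ℂ)
          - Complex.I * ((Real.sin (v * (2 * Real.pi * w)) * G v : ℝ) : ℂ) := by
      intro v
      rw [Complex.exp_mul_I, ← Complex.ofReal_cos, ← Complex.ofReal_sin,
        show -2 * Real.pi * v * w = -(v * (2 * Real.pi * w)) by ring, Real.cos_neg, Real.sin_neg]
      simp; ring
    simp_rw [e3]
    rw [integral_sub (hcos _).ofReal ((hsin _).ofReal.const_mul _), integral_const_mul,
      integral_complex_ofReal, integral_complex_ofReal, e2]
    simp
  simp_rw [h1] at pl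
  simp only [Complex.norm_real, Real.norm_eq_abs, sq_abs] at pl
  set Φ : ℝ → ℝ := fun x => (2 * ∫ p in Set.Ioi (0:ℝ), Real.cos (p * x) * G p) ^ 2 with hΦ
  have h2 : ∫ w : ℝ, Φ (2 * Real.pi * w) = ∫ p, G p ^ 2 := pl
  rw [Measure.integral_comp_mul_left] at h2
  rw [← h2]
  have h3 : ∀ x : ℝ, ((1 / Real.pi) * ∫ p in Set.Ioi (0:ℝ), Real.cos (p * x) * G p) ^ 2
      = (1 / (2 * Real.pi)) ^ 2 * Φ x := by
    intro x; simp only [hΦ]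
    generalize ∫ p in Set.Ioi (0:ℝ), Real.cos (p * x) * G p = I
    field_simp
  simp_rw [h3]
  rw [integral_const_mul, abs_of_pos (by positivity)]
  simp; field_simp

/-- lower Potter-type bound -/
lemma potter_low (ψ : ℝ → ℝ) (β γ : ℝ) (hγ : γ < β)
    (hpos : ∀ p : ℝ, 0 < p → 0 < ψ p) (hc : ContinuousOn ψ (Set.Ici 1))
    (hRV : Filter.Tendsto (fun x => ψ (2 * x) / ψ x) Filter.atTop (nhds (2 ^ β))) :
    ∃ c > 0, ∀ p : ℝ, 1 ≤ p → c * p ^ γ ≤ ψ p := by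
  have h1 : (2:ℝ) ^ γ < 2 ^ β := Real.rpow_lt_rpow_of_exponent_lt (by norm_num) hγ
  obtain ⟨X0, hX0⟩ := Filter.eventually_atTop.1 (hRV.eventually (lt_mem_nhds h1))
  set X := max X0 1
  have hX1 : 1 ≤ X := le_max_right _ _
  have hcont : ContinuousOn (fun p => ψ p / p ^ γ) (Set.Icc 1 (2 * X)) := by
    refine ContinuousOn.div (hc.mono fun p hp => hp.1) ?_ ?_
    · intro p hp
      exact (Real.continuousAt_rpow_const p γ (Or.inl (by linarith [hp.1]))).continuousWithinAt
    · intro p hp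
      exact (Real.rpow_pos_of_pos (by linarith [hp.1]) _).ne'
  obtain ⟨q, hq, hmin⟩ := isCompact_Icc.exists_isMinOn
    (Set.nonempty_Icc.2 (by linarith : (1:ℝ) ≤ 2 * X)) hcont
  have hq0 : 0 < q := by linarith [hq.1]
  refine ⟨ψ q / q ^ γ, div_pos (hpos q hq0) (Real.rpow_pos_of_pos hq0 _), ?_⟩
  set m := ψ q / q ^ γ
  have base : ∀ p : ℝ, 1 ≤ p → p ≤ 2 * X → m * p ^ γ ≤ ψ p := by
    intro p hp1 hp2
    have := hmin (show p ∈ Set.Icc 1 (2 * X) from ⟨hp1, hp2⟩)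
    exact (le_div_iff₀ (Real.rpow_pos_of_pos (by linarith) _)).1 this
  have step : ∀ n : ℕ, ∀ p : ℝ, 1 ≤ p → p ≤ 2 ^ n * (2 * X) → m * p ^ γ ≤ ψ p := by
    intro n
    induction n with
    | zero => intro p h1 h2; exact base p h1 (by simpa using h2)
    | succ n ih =>
      intro p h1 h2
      by_cases hp : p ≤ 2 * X
      · exact base p h1 hp
      have hXp : X ≤ p / 2 := by linarith
      have i1 := ih (p / 2) (by linarith) (by rw [pow_succ] at h2; linarith)
      have i2 := hX0 (p / 2) ((le_max_left _ _).trans hXp)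
      rw [lt_div_iff₀ (hpos _ (by linarith)), mul_div_cancel₀ _ (by norm_num : (2:ℝ) ≠ 0)] at i2
      have i3 : p ^ γ = 2 ^ γ * (p / 2) ^ γ := by
        rw [← Real.mul_rpow (by norm_num) (by linarith)]; congr 1; ring
      have : (0:ℝ) < 2 ^ γ := by positivity
      rw [i3]; nlinarith
  intro p hp
  obtain ⟨n, hn⟩ := pow_unbounded_of_one_lt p (by norm_num : (1:ℝ) < 2)
  exact step n p hp (by nlinarith [pow_pos (by norm_num : (0:ℝ) < 2) n])

/-- upper Potter-type bound -/
lemma potter_up (ψ : ℝ → ℝ) (β γ : ℝ) (hγ : β < γ)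
    (hpos : ∀ p : ℝ, 0 < p → 0 < ψ p) (hc : ContinuousOn ψ (Set.Ici 1))
    (hRV : Filter.Tendsto (fun x => ψ (2 * x) / ψ x) Filter.atTop (nhds (2 ^ β))) :
    ∃ c > 0, ∀ p : ℝ, 1 ≤ p → ψ p ≤ c * p ^ γ := by
  have h := potter_low (fun p => (ψ p)⁻¹) (-β) (-γ) (by linarith)
    (fun p hp => inv_pos.2 (hpos p hp))
    (hc.inv₀ (fun p hp => (hpos p (by linarith [Set.mem_Ici.1 hp])).ne'))
    (by
      have := hRV.inv₀ (by positivity)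
      rw [← Real.rpow_neg (by norm_num)] at this
      refine this.congr fun x => ?_
      simp [div_eq_mul_inv, mul_comm])
  obtain ⟨c, hc0, h⟩ := h
  refine ⟨c⁻¹, inv_pos.2 hc0, fun p hp => ?_⟩
  have := h p hp
  have hp0 : 0 < p := by linarith
  rw [Real.rpow_neg hp0.le] at this
  have := inv_anti₀ (by positivity) this
  rwa [inv_inv, mul_inv, inv_inv] at this

lemma near_zero_low (ψ : ℝ → ℝ)
    (hpos : ∀ p : ℝ, 0 < p → 0 < ψ p) (hc : ContinuousOn ψ (Set.Ioi 0))
    (hliminf : 0 < Filter.liminf (fun p : ℝ => ψ p / p ^ 2) (nhdsWithin (0:ℝ) ({0}ᶜ))) :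
    ∃ c > 0, ∀ p : ℝ, 0 < p → p ≤ 1 → c * p ^ 2 ≤ ψ p := by
  rw [Filter.liminf_eq] at hliminf
  obtain ⟨a, ha, ha0⟩ : ∃ a ∈ {a | ∀ᶠ p in nhdsWithin (0:ℝ) ({0}ᶜ), a ≤ ψ p / p ^ 2}, 0 < a := by
    by_contra! hcon
    exact absurd (Real.sSup_nonpos hcon) (not_le.2 hliminf)
  have ha' := eventually_nhdsWithin_iff.1 ha
  obtain ⟨δ, hδ, hball⟩ := Metric.eventually_nhds_iff.1 ha'
  set d := min (δ / 2) 1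
  have hd0 : 0 < d := by positivity
  obtain ⟨q, hq, hmin⟩ := isCompact_Icc.exists_isMinOn
    (Set.nonempty_Icc.2 (min_le_right _ _ : d ≤ 1))
    (hc.mono (fun p hp => lt_of_lt_of_le hd0 hp.1) : ContinuousOn ψ (Set.Icc d 1))
  have hq0 : 0 < q := lt_of_lt_of_le hd0 hq.1
  refine ⟨min a (ψ q), lt_min ha0 (hpos q hq0), fun p hp0 hp1 => ?_⟩
  have hp2 : 0 < p ^ 2 := by positivity
  by_cases h : p < δ
  · have := hball (y := p) (by simpa [abs_of_pos hp0] using h) (by simpa using hp0.ne')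
    rw [le_div_iff₀ hp2] at this
    exact le_trans (by gcongr; exact min_le_left _ _) this
  · have h3 : ψ q ≤ ψ p := hmin (show p ∈ Set.Icc d 1 from
      ⟨(min_le_left _ _).trans (by linarith), hp1⟩)
    have : min a (ψ q) ≤ ψ q := min_le_right _ _
    have h5 : 0 < min a (ψ q) := lt_min ha0 (hpos q hq0)
    nlinarith [mul_le_of_le_one_right h5.le (show p ^ 2 ≤ 1 by nlinarith)]

lemma two_cos_nonneg (y : ℝ) : 0 ≤ 2 - 2 * Real.cos y := by linarith [Real.cos_le_one y]

lemma two_cos_le_sq (y : ℝ) : 2 - 2 * Real.cos y ≤ y ^ 2 := by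
  linarith [Real.one_sub_sq_div_two_le_cos (x := y)]

lemma two_cos_le_four (y : ℝ) : 2 - 2 * Real.cos y ≤ 4 := by linarith [Real.neg_one_le_cos y]

lemma exp_int (ψ : ℝ → ℝ) (hmeas : Measurable ψ) (hnonneg : ∀ p : ℝ, 0 ≤ ψ p)
    (c γ : ℝ) (hc : 0 < c) (hγ : 1 < γ) (hlow : ∀ p : ℝ, 1 ≤ p → c * p ^ γ ≤ ψ p)
    (s : ℝ) (hs : 0 < s) :
    IntegrableOn (fun p => Real.exp (-s * ψ p)) (Set.Ioi 0) := by
  have hm : Measurable (fun p => Real.exp (-s * ψ p)) := by fun_prop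
  rw [← Set.Ioc_union_Ioi_eq_Ioi (zero_le_one : (0:ℝ) ≤ 1)]
  refine IntegrableOn.union ?_ ?_
  · refine Measure.integrableOn_of_bounded (M := 1) (by simp) hm.aestronglyMeasurable ?_
    filter_upwards with p
    rw [Real.norm_eq_abs, abs_of_pos (Real.exp_pos _), Real.exp_le_one_iff]
    nlinarith [hnonneg p]
  · have hi : IntegrableOn (fun p : ℝ => (s * c)⁻¹ * p ^ (-γ)) (Set.Ioi 1) :=
      (integrableOn_Ioi_rpow_of_lt (by linarith) one_pos).const_mul _
    refine Integrable.mono' hi hm.aestronglyMeasurable ?_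
    refine (ae_restrict_iff' measurableSet_Ioi).2 (Filter.Eventually.of_forall fun p hp => ?_)
    have hp1 : (1:ℝ) < p := hp
    have hp0 : 0 < p := by linarith
    rw [Real.norm_eq_abs, abs_of_pos (Real.exp_pos _), Real.rpow_neg hp0.le, ← mul_inv, neg_mul,
      Real.exp_neg]
    apply inv_anti₀ (by positivity)
    have := hlow p hp1.le
    have h2 := Real.add_one_le_exp (s * ψ p)
    nlinarith

/-- the kernel is nonneg, bounded, and integrable on the half line -/
lemma K_int (ψ : ℝ → ℝ) (hmeas : Measurable ψ)
    (hpos : ∀ p : ℝ, 0 < p → 0 < ψ p)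
    (c γ : ℝ) (hc : 0 < c) (hγ : 1 < γ) (hlow : ∀ p : ℝ, 1 ≤ p → c * p ^ γ ≤ ψ p)
    (d : ℝ) (hd : 0 < d) (hlow0 : ∀ p : ℝ, 0 < p → p ≤ 1 → d * p ^ 2 ≤ ψ p) (h : ℝ) :
    IntegrableOn (fun p => (2 - 2 * Real.cos (p * h)) / ψ p) (Set.Ioi 0) ∧
    ∃ B, ∀ p, 0 < p → (2 - 2 * Real.cos (p * h)) / ψ p ≤ B := by
  have hm : Measurable (fun p => (2 - 2 * Real.cos (p * h)) / ψ p) := by fun_prop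
  have b0 : ∀ p : ℝ, 0 < p → p ≤ 1 → (2 - 2 * Real.cos (p * h)) / ψ p ≤ h ^ 2 / d := by
    intro p h0 h1
    rw [div_le_div_iff₀ (hpos p h0) hd]
    have := two_cos_le_sq (p * h)
    have h3 := hlow0 p h0 h1
    nlinarith [mul_le_mul_of_nonneg_left h3 (sq_nonneg h)]
  have b1 : ∀ p : ℝ, 1 ≤ p → (2 - 2 * Real.cos (p * h)) / ψ p ≤ 4 / c * p ^ (-γ) := by
    intro p h1
    have hp0 : 0 < p := by linarith
    have hr : 0 < p ^ γ := by positivity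
    rw [Real.rpow_neg hp0.le, ← div_eq_mul_inv, div_div,
      div_le_div_iff₀ (hpos p hp0) (by positivity)]
    nlinarith [two_cos_le_four (p * h), hlow p h1, mul_pos hc hr]
  have hn : ∀ p : ℝ, 0 < p → 0 ≤ (2 - 2 * Real.cos (p * h)) / ψ p := fun p hp =>
    div_nonneg (two_cos_nonneg _) (hpos p hp).le
  constructor
  · rw [← Set.Ioc_union_Ioi_eq_Ioi (zero_le_one : (0:ℝ) ≤ 1)]
    refine IntegrableOn.union ?_ ?_
    · refine Measure.integrableOn_of_bounded (M := h ^ 2 / d) (by simp) hm.aestronglyMeasurable ?_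
      refine (ae_restrict_iff' measurableSet_Ioc).2 (Filter.Eventually.of_forall fun p hp => ?_)
      rw [Real.norm_eq_abs, abs_of_nonneg (hn p hp.1)]
      exact b0 p hp.1 hp.2
    · have hi : IntegrableOn (fun p : ℝ => 4 / c * p ^ (-γ)) (Set.Ioi 1) :=
        (integrableOn_Ioi_rpow_of_lt (by linarith) one_pos).const_mul _
      refine Integrable.mono' hi hm.aestronglyMeasurable ?_
      refine (ae_restrict_iff' measurableSet_Ioi).2 (Filter.Eventually.of_forall fun p hp => ?_)
      have hp1 : (1:ℝ) < p := hp
      rw [Real.norm_eq_abs, abs_of_nonneg (hn p (by linarith))]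
      exact b1 p hp1.le
  · refine ⟨max (h ^ 2 / d) (4 / c), fun p hp => ?_⟩
    rcases le_total p 1 with h1 | h1
    · exact (b0 p hp h1).trans (le_max_left _ _)
    · refine ((b1 p h1).trans ?_).trans (le_max_right _ _)
      have : p ^ (-γ) ≤ 1 := Real.rpow_le_one_of_one_le_of_nonpos h1 (by linarith)
      exact mul_le_of_le_one_right (by positivity) this

lemma second_diff (ψ : ℝ → ℝ) (s h x : ℝ)
    (hi : IntegrableOn (fun p => Real.exp (-s * ψ p)) (Set.Ioi 0)) :
    2 * pdens ψ s x - pdens ψ s (x + h) - pdens ψ s (x - h)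
      = (1 / Real.pi) * ∫ p in Set.Ioi (0:ℝ),
        Real.cos (p * x) * ((2 - 2 * Real.cos (p * h)) * Real.exp (-s * ψ p)) := by
  have hcos : ∀ y : ℝ, IntegrableOn (fun p => Real.cos (p * y) * Real.exp (-s * ψ p)) (Set.Ioi 0) :=
    fun y => Integrable.bdd_mul (c := 1) hi (by fun_prop)
      (by filter_upwards with p; simpa using Real.abs_cos_le_one _)
  have : ∀ p : ℝ, Real.cos (p * x) * ((2 - 2 * Real.cos (p * h)) * Real.exp (-s * ψ p))
      = 2 * (Real.cos (p * x) * Real.exp (-s * ψ p)) -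
        Real.cos (p * (x + h)) * Real.exp (-s * ψ p)
        - Real.cos (p * (x - h)) * Real.exp (-s * ψ p) := by
    intro p
    rw [mul_add, mul_sub, Real.cos_add, Real.cos_sub]; ring
  simp_rw [this]
  have i1 : IntegrableOn (fun p => 2 * (Real.cos (p * x) * Real.exp (-s * ψ p))
      - Real.cos (p * (x + h)) * Real.exp (-s * ψ p)) (Set.Ioi 0) :=
    ((hcos x).const_mul 2).sub (hcos _)
  rw [integral_sub i1 (hcos _),
    integral_sub ((hcos x).const_mul 2) (hcos _), integral_const_mul]
  unfold pdens
  ring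

lemma time_int (ψ : ℝ → ℝ) (hmeas : Measurable ψ)
    (hpos : ∀ p : ℝ, 0 < p → 0 < ψ p) (h x : ℝ)
    (hE : ∀ s : ℝ, 0 < s → IntegrableOn (fun p => Real.exp (-s * ψ p)) (Set.Ioi 0))
    (hK : IntegrableOn (fun p => (2 - 2 * Real.cos (p * h)) / ψ p) (Set.Ioi 0))
    (S : Set ℝ) (hS : MeasurableSet S) (hS0 : S ⊆ Set.Ioi 0) :
    ∫ s in S, (2 * pdens ψ s x - pdens ψ s (x + h) - pdens ψ s (x - h))
      = (1 / Real.pi) * ∫ p in Set.Ioi (0:ℝ),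
        Real.cos (p * x) * ((2 - 2 * Real.cos (p * h)) * ∫ s in S, Real.exp (-s * ψ p)) := by
  have e1 : ∀ p : ℝ, 0 < p → IntegrableOn (fun s => Real.exp (-s * ψ p)) (Set.Ioi 0) := by
    intro p hp
    have := integrableOn_exp_mul_Ioi (a := -ψ p) (by linarith [hpos p hp]) 0
    refine this.congr_fun (fun s _ => ?_) measurableSet_Ioi
    simp only; congr 1; ring
  have e2 : ∀ p : ℝ, 0 < p → ∫ s in Set.Ioi (0:ℝ), Real.exp (-s * ψ p) = 1 / ψ p := by
    intro p hp
    have := integral_exp_mul_Ioi (a := -ψ p) (by linarith [hpos p hp]) 0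
    rw [show (fun s => Real.exp (-s * ψ p)) = fun s => Real.exp (-ψ p * s) by ext s; congr 1; ring,
      this]
    simp
  have hprod : Integrable (fun z : ℝ × ℝ =>
      Real.cos (z.2 * x) * ((2 - 2 * Real.cos (z.2 * h)) * Real.exp (-z.1 * ψ z.2)))
      ((volume.restrict (Set.Ioi 0)).prod (volume.restrict (Set.Ioi 0))) := by
    have hm : Measurable (fun z : ℝ × ℝ =>
      Real.cos (z.2 * x) * ((2 - 2 * Real.cos (z.2 * h)) * Real.exp (-z.1 * ψ z.2))) := by
      fun_prop
    rw [integrable_prod_iff' hm.aestronglyMeasurable]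
    constructor
    · refine (ae_restrict_iff' measurableSet_Ioi).2 (Filter.Eventually.of_forall fun p hp => ?_)
      exact ((e1 p hp).const_mul (2 - 2 * Real.cos (p * h))).const_mul (Real.cos (p * x))
    · refine Integrable.mono' hK ?_ ?_
      · exact hm.norm.aestronglyMeasurable.prod_swap.integral_prod_right'
      · refine (ae_restrict_iff' measurableSet_Ioi).2 (Filter.Eventually.of_forall fun p hp => ?_)
        have hp0 : 0 < p := hp
        simp only [norm_mul, Real.norm_eq_abs, Real.abs_exp]
        rw [integral_const_mul, integral_const_mul, e2 p hp, abs_of_nonneg (two_cos_nonneg (p * h)),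
          abs_of_nonneg (by have := two_cos_nonneg (p * h); have := hpos p hp; positivity)]
        rw [mul_one_div]
        exact mul_le_of_le_one_left (div_nonneg (two_cos_nonneg _) (hpos p hp).le)
          (Real.abs_cos_le_one _)
  have hprodS : Integrable (fun z : ℝ × ℝ =>
      Real.cos (z.2 * x) * ((2 - 2 * Real.cos (z.2 * h)) * Real.exp (-z.1 * ψ z.2)))
      ((volume.restrict S).prod (volume.restrict (Set.Ioi 0))) :=
    hprod.mono_measure (Measure.prod_mono (Measure.restrict_mono hS0 le_rfl) le_rfl)
  rw [setIntegral_congr_fun hS (fun s hs => second_diff ψ s h x (hE s (hS0 hs))),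
    integral_const_mul, integral_integral_swap hprodS]
  simp_rw [integral_const_mul]

lemma even_int (G : ℝ → ℝ) (hev : ∀ p, G (-p) = G p) (hi : IntegrableOn G (Set.Ioi 0)) :
    Integrable G := by
  have h2 : IntegrableOn G (Set.Iic 0) := by
    rw [← Measure.map_neg_eq_self (volume : Measure ℝ)]
    let m : MeasurableEmbedding fun x : ℝ => -x := (Homeomorph.neg ℝ).measurableEmbedding
    rw [m.integrableOn_map_iff]
    simp_rw [Function.comp_def, hev, Set.neg_preimage, Set.neg_Iic, neg_zero]
    exact Iff.mpr integrableOn_Ici_iff_integrableOn_Ioi hi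
  have := h2.union hi
  rwa [Set.Iic_union_Ioi, integrableOn_univ] at this

lemma half_plancherel (G K : ℝ → ℝ) (hm : Measurable G) (hev : ∀ p, G (-p) = G p)
    (hGK : ∀ p, 0 < p → |G p| ≤ K p) (hK : IntegrableOn K (Set.Ioi 0))
    (B : ℝ) (hB : ∀ p, 0 < p → K p ≤ B) :
    IntegrableOn (fun p => G p ^ 2) (Set.Ioi 0) ∧
    ∫ x : ℝ, ((1 / Real.pi) * ∫ p in Set.Ioi (0:ℝ), Real.cos (p * x) * G p) ^ 2
      = (1 / Real.pi) * ∫ p in Set.Ioi (0:ℝ), G p ^ 2 := by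
  have i1 : IntegrableOn G (Set.Ioi 0) := by
    refine Integrable.mono' hK hm.aestronglyMeasurable ?_
    exact (ae_restrict_iff' measurableSet_Ioi).2 (Filter.Eventually.of_forall fun p hp => hGK p hp)
  have i2 : IntegrableOn (fun p => G p ^ 2) (Set.Ioi 0) := by
    refine Integrable.mono' (hK.const_mul B) (hm.pow_const 2).aestronglyMeasurable ?_
    refine (ae_restrict_iff' measurableSet_Ioi).2 (Filter.Eventually.of_forall fun p hp => ?_)
    have h1 := hGK p hp
    have h2 := hB p hp
    have h3 := abs_nonneg (G p)
    rw [Real.norm_eq_abs, abs_pow]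
    nlinarith
  refine ⟨i2, ?_⟩
  have j2 : Integrable (fun p => G p ^ 2) := even_int _ (by simp [hev]) i2
  rw [cos_plancherel G hev (even_int G hev i1)
    ((memLp_two_iff_integrable_sq hm.aestronglyMeasurable).2 j2)]
  have : ∫ p, G p ^ 2 = 2 * ∫ p in Set.Ioi (0:ℝ), G p ^ 2 := by
    rw [← integral_comp_abs (f := fun p => G p ^ 2)]
    congr 1; ext p
    rcases abs_choice p with h | h <;> rw [h]
    rw [hev]
  rw [this]
  have := Real.pi_pos
  field_simp

lemma diff_formula (ψ : ℝ → ℝ) (hmeas : Measurable ψ) (heven : ∀ p : ℝ, ψ (-p) = ψ p)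
    (hpos : ∀ p : ℝ, 0 < p → 0 < ψ p) (h T : ℝ) (hT : 0 ≤ T)
    (hE : ∀ s : ℝ, 0 < s → IntegrableOn (fun p => Real.exp (-s * ψ p)) (Set.Ioi 0))
    (hK : IntegrableOn (fun p => (2 - 2 * Real.cos (p * h)) / ψ p) (Set.Ioi 0))
    (B : ℝ) (hB : ∀ p, 0 < p → (2 - 2 * Real.cos (p * h)) / ψ p ≤ B) :
    (∫ x : ℝ, (∫ s in Set.Ioi (0:ℝ),
              (2 * pdens ψ s x - pdens ψ s (x + h) - pdens ψ s (x - h))) ^ 2) -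
           ∫ x : ℝ, (∫ s in Set.Ioc (0:ℝ) T,
              (2 * pdens ψ s x - pdens ψ s (x + h) - pdens ψ s (x - h))) ^ 2
    = (1 / Real.pi) * ∫ p in Set.Ioi (0:ℝ), ((2 - 2 * Real.cos (p * h)) / ψ p) ^ 2
        * (1 - (1 - Real.exp (-T * ψ p)) ^ 2) := by
  set K : ℝ → ℝ := fun p => (2 - 2 * Real.cos (p * h)) / ψ p with hKdef
  set G : ℝ → ℝ := fun p => K p * (1 - Real.exp (-T * ψ p)) with hGdef
  have hKm : Measurable K := by fun_prop
  have hGm : Measurable G := by fun_prop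
  have hK0 : ∀ p, 0 < p → 0 ≤ K p := fun p hp => div_nonneg (two_cos_nonneg _) (hpos p hp).le
  have hKev : ∀ p, K (-p) = K p := by intro p; simp [hKdef, heven]
  have hGev : ∀ p, G (-p) = G p := by intro p; simp [hGdef, hKev, heven]
  have hGK : ∀ p, 0 < p → |G p| ≤ K p := by
    intro p hp
    have h1 : Real.exp (-T * ψ p) ≤ 1 := Real.exp_le_one_iff.2 (by nlinarith [hpos p hp])
    have h2 := Real.exp_pos (-T * ψ p)
    have h3 := hK0 p hp
    rw [hGdef, abs_of_nonneg (mul_nonneg h3 (by linarith))]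
    exact mul_le_of_le_one_right h3 (by linarith)
  obtain ⟨iK, fK⟩ := half_plancherel K K hKm hKev
    (fun p hp => (abs_of_nonneg (hK0 p hp)).le) hK B hB
  obtain ⟨iG, fG⟩ := half_plancherel G K hGm hGev hGK hK B hB
  have e2 : ∀ p : ℝ, 0 < p → ∫ s in Set.Ioi (0:ℝ), Real.exp (-s * ψ p) = 1 / ψ p := by
    intro p hp
    have := integral_exp_mul_Ioi (a := -ψ p) (by linarith [hpos p hp]) 0
    rw [show (fun s => Real.exp (-s * ψ p)) = fun s => Real.exp (-ψ p * s) by ext s; congr 1; ring,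
      this]
    simp
  have e3 : ∀ p : ℝ, 0 < p → ∫ s in Set.Ioc (0:ℝ) T, Real.exp (-s * ψ p)
      = (1 - Real.exp (-T * ψ p)) / ψ p := by
    intro p hp
    have hp0 := (hpos p hp).ne'
    rw [← intervalIntegral.integral_of_le hT]
    have : ∀ s ∈ Set.uIcc 0 T, HasDerivAt (fun s => - Real.exp (-s * ψ p) / ψ p)
        (Real.exp (-s * ψ p)) s := by
      intro s _
      have := ((((hasDerivAt_id s).neg.mul_const (ψ p)).exp).neg.div_const (ψ p))
      convert! this using 1
      simp; field_simp
    rw [intervalIntegral.integral_eq_sub_of_hasDerivAt this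
      ((by fun_prop : Continuous fun s => Real.exp (-s * ψ p)).intervalIntegrable _ _)]
    simp; field_simp; ring
  have f1 : ∀ x : ℝ, ∫ s in Set.Ioi (0:ℝ),
      (2 * pdens ψ s x - pdens ψ s (x + h) - pdens ψ s (x - h))
      = (1 / Real.pi) * ∫ p in Set.Ioi (0:ℝ), Real.cos (p * x) * K p := by
    intro x
    rw [time_int ψ hmeas hpos h x hE hK _ measurableSet_Ioi le_rfl]
    congr 1
    refine setIntegral_congr_fun measurableSet_Ioi fun p hp => ?_
    simp only [e2 p hp, hKdef]; ring
  have f2 : ∀ x : ℝ, ∫ s in Set.Ioc (0:ℝ) T,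
      (2 * pdens ψ s x - pdens ψ s (x + h) - pdens ψ s (x - h))
      = (1 / Real.pi) * ∫ p in Set.Ioi (0:ℝ), Real.cos (p * x) * G p := by
    intro x
    rw [time_int ψ hmeas hpos h x hE hK _ measurableSet_Ioc (fun s hs => hs.1)]
    congr 1
    refine setIntegral_congr_fun measurableSet_Ioi fun p hp => ?_
    simp only [e3 p hp, hKdef, hGdef]; ring
  simp_rw [f1, f2]
  rw [fK, fG, ← mul_sub, ← integral_sub iK iG]
  congr 1
  refine integral_congr_ae (Filter.Eventually.of_forall fun p => ?_)
  simp only [hGdef]; ring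

lemma W_bound (ψ : ℝ → ℝ)
    (hpos : ∀ p : ℝ, 0 < p → 0 < ψ p)
    (c γ : ℝ) (hc : 0 < c) (hlow : ∀ p : ℝ, 1 ≤ p → c * p ^ γ ≤ ψ p)
    (d : ℝ) (hd : 0 < d) (hlow0 : ∀ p : ℝ, 0 < p → p ≤ 1 → d * p ^ 2 ≤ ψ p)
    (k : ℕ) (hk : 5 < γ * (2 + k)) (h T : ℝ) (hT : 0 < T) :
    0 ≤ (∫ p in Set.Ioi (0:ℝ), ((2 - 2 * Real.cos (p * h)) / ψ p) ^ 2
        * (1 - (1 - Real.exp (-T * ψ p)) ^ 2)) ∧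
    ∫ p in Set.Ioi (0:ℝ), ((2 - 2 * Real.cos (p * h)) / ψ p) ^ 2
        * (1 - (1 - Real.exp (-T * ψ p)) ^ 2)
     ≤ 2 * h ^ 4 / d ^ 2 + 2 * h ^ 4 * (k.factorial / T ^ k) / c ^ (2 + k)
        * ∫ p in Set.Ioi (1:ℝ), p ^ (4 - γ * (2 + k)) := by
  set W : ℝ → ℝ := fun p => ((2 - 2 * Real.cos (p * h)) / ψ p) ^ 2
        * (1 - (1 - Real.exp (-T * ψ p)) ^ 2) with hW
  have hW0 : ∀ p, 0 < p → 0 ≤ W p := by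
    intro p hp
    have h1 : Real.exp (-T * ψ p) ≤ 1 := Real.exp_le_one_iff.2 (by nlinarith [hpos p hp])
    have h2 := Real.exp_pos (-T * ψ p)
    exact mul_nonneg (sq_nonneg _) (by nlinarith)
  have hWa : ∀ p, 0 < p → W p ≤ 2 * h ^ 4 * (p ^ 4 / ψ p ^ 2) * Real.exp (-T * ψ p) := by
    intro p hp
    have h2 := Real.exp_pos (-T * ψ p)
    have h3 : 1 - (1 - Real.exp (-T * ψ p)) ^ 2 ≤ 2 * Real.exp (-T * ψ p) := by nlinarith
    have hψ := hpos p hp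
    have h4 : ((2 - 2 * Real.cos (p * h)) / ψ p) ^ 2 ≤ ((p * h) ^ 2 / ψ p) ^ 2 := by
      have := two_cos_nonneg (p * h)
      have := two_cos_le_sq (p * h)
      gcongr
    calc W p ≤ ((2 - 2 * Real.cos (p * h)) / ψ p) ^ 2 * (2 * Real.exp (-T * ψ p)) := by
          simp only [hW]; gcongr
      _ ≤ ((p * h) ^ 2 / ψ p) ^ 2 * (2 * Real.exp (-T * ψ p)) := by gcongr
      _ = _ := by field_simp
  set M := 2 * h ^ 4 * (k.factorial / T ^ k) / c ^ (2 + k)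
  set R : ℝ → ℝ := Set.indicator (Set.Ioc 0 1) (fun _ => 2 * h ^ 4 / d ^ 2)
    + Set.indicator (Set.Ioi 1) (fun p => M * p ^ (4 - γ * (2 + k))) with hR
  have hWR : ∀ p, 0 < p → W p ≤ R p := by
    intro p hp
    have hψ := hpos p hp
    refine (hWa p hp).trans ?_
    rcases le_or_gt p 1 with h1 | h1
    · have : R p = 2 * h ^ 4 / d ^ 2 := by
        simp [hR, Set.indicator, hp, h1]
      rw [this]
      have e1 : Real.exp (-T * ψ p) ≤ 1 := Real.exp_le_one_iff.2 (by nlinarith)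
      have e2 : p ^ 4 / ψ p ^ 2 ≤ 1 / d ^ 2 := by
        rw [div_le_div_iff₀ (by positivity) (by positivity)]
        have := pow_le_pow_left₀ (by positivity) (hlow0 p hp h1) 2
        nlinarith
      calc _ ≤ 2 * h ^ 4 * (1 / d ^ 2) * 1 := by gcongr
        _ = _ := by ring
    · have : R p = M * p ^ (4 - γ * (2 + k)) := by
        simp [hR, Set.indicator, hp, h1, not_le.2 h1]
      rw [this]
      have e1 : Real.exp (-T * ψ p) ≤ k.factorial / (T * ψ p) ^ k := by
        have := Real.pow_div_factorial_le_exp (x := T * ψ p) (by positivity) k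
        rw [neg_mul, Real.exp_neg, ← inv_div]
        exact inv_anti₀ (by positivity) this
      have e2 : (c * p ^ γ) ^ (2 + k) ≤ ψ p ^ (2 + k) :=
        pow_le_pow_left₀ (by positivity) (hlow p h1.le) _
      have e3 : p ^ (4 - γ * (2 + k)) = p ^ 4 / (p ^ γ) ^ (2 + k) := by
        rw [Real.rpow_sub hp, Real.rpow_mul hp.le, ← Real.rpow_natCast (p ^ γ) (2 + k)]
        norm_cast
      calc _ ≤ 2 * h ^ 4 * (p ^ 4 / ψ p ^ 2) * (k.factorial / (T * ψ p) ^ k) := by gcongr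
        _ = 2 * h ^ 4 * (k.factorial / T ^ k) * p ^ 4 / ψ p ^ (2 + k) := by
          rw [mul_pow, pow_add]; field_simp
        _ ≤ 2 * h ^ 4 * (k.factorial / T ^ k) * p ^ 4 / (c * p ^ γ) ^ (2 + k) := by gcongr
        _ = _ := by rw [e3, mul_pow]; simp only [M]; field_simp
  have i1 : IntegrableOn (fun p : ℝ => p ^ (4 - γ * (2 + k))) (Set.Ioi 1) :=
    integrableOn_Ioi_rpow_of_lt (by linarith) one_pos
  have r1 : Integrable (Set.indicator (Set.Ioc (0:ℝ) 1) (fun _ => 2 * h ^ 4 / d ^ 2)) :=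
    (integrable_indicator_iff measurableSet_Ioc).2 (by simp)
  have r2 : Integrable (Set.indicator (Set.Ioi 1) (fun p => M * p ^ (4 - γ * (2 + k)))) :=
    (integrable_indicator_iff measurableSet_Ioi).2 (i1.const_mul M)
  have hRi : Integrable R := r1.add r2
  have hR0 : ∀ p, 0 ≤ R p := by
    intro p
    refine add_nonneg (Set.indicator_nonneg (fun _ _ => by positivity) p)
      (Set.indicator_nonneg (fun q hq => ?_) p)
    have : (0:ℝ) < q := lt_trans one_pos hq
    positivity
  constructor
  · exact setIntegral_nonneg measurableSet_Ioi hW0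
  · calc ∫ p in Set.Ioi (0:ℝ), W p ≤ ∫ p in Set.Ioi (0:ℝ), R p := by
          refine integral_mono_of_nonneg ?_ hRi.integrableOn ?_
          · exact (ae_restrict_iff' measurableSet_Ioi).2 (Filter.Eventually.of_forall hW0)
          · exact (ae_restrict_iff' measurableSet_Ioi).2 (Filter.Eventually.of_forall hWR)
      _ ≤ ∫ p, R p := setIntegral_le_integral hRi (Filter.Eventually.of_forall hR0)
      _ = _ := by
          rw [hR, integral_add' r1 r2, integral_indicator measurableSet_Ioc,
            integral_indicator measurableSet_Ioi, integral_const_mul]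
          simp

lemma final_arith (T γ' C1 P : ℝ) (k : ℕ) (hT : 0 < T) (hT1 : T ≤ 1) (hP0 : 0 ≤ P)
    (hP : P ≤ C1 * (1 / T ^ 2) ^ γ') (hC1 : 0 < C1) (hk : (k:ℝ) ≤ 9 - 4 * γ') :
    T ^ 2 * P ^ 2 * ((T ^ 2) ^ 4 / T ^ k) ≤ C1 ^ 2 * T := by
  have e1 : (1 / T ^ 2) ^ γ' = T ^ (-2 * γ') := by
    rw [Real.rpow_mul hT.le, one_div, ← Real.rpow_natCast T 2, ← Real.rpow_neg hT.le]
    norm_num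
  rw [e1] at hP
  have e2 : P ^ 2 ≤ C1 ^ 2 * T ^ (-4 * γ') := by
    calc P ^ 2 ≤ (C1 * T ^ (-2 * γ')) ^ 2 := by gcongr
      _ = C1 ^ 2 * T ^ (-4 * γ') := by
        rw [mul_pow, ← Real.rpow_natCast (T ^ _) 2, ← Real.rpow_mul hT.le]; congr 2; push_cast; ring
  have e3 : T ^ 2 * T ^ (-4 * γ') * ((T ^ 2) ^ 4 / T ^ k) = T ^ (10 - 4 * γ' - k) := by
    rw [← pow_mul, ← Real.rpow_natCast T 2, ← Real.rpow_natCast T (2 * 4), ← Real.rpow_natCast T k,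
      ← Real.rpow_sub hT, ← Real.rpow_add hT, ← Real.rpow_add hT]
    congr 1; push_cast; ring
  have e4 : T ^ (10 - 4 * γ' - k) ≤ T := by
    calc _ ≤ T ^ (1:ℝ) := Real.rpow_le_rpow_of_exponent_ge hT hT1 (by linarith)
      _ = T := Real.rpow_one T
  calc T ^ 2 * P ^ 2 * ((T ^ 2) ^ 4 / T ^ k)
      ≤ T ^ 2 * (C1 ^ 2 * T ^ (-4 * γ')) * ((T ^ 2) ^ 4 / T ^ k) := by gcongr
    _ = C1 ^ 2 * (T ^ 2 * T ^ (-4 * γ') * ((T ^ 2) ^ 4 / T ^ k)) := by ring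
    _ = C1 ^ 2 * T ^ (10 - 4 * γ' - k) := by rw [e3]
    _ ≤ _ := by gcongr

theorem stmt_12
    (β : ℝ) (hβ1 : 1 < β) (hβ2 : β ≤ 2)
    (ψ : ℝ → ℝ)
    (hmeas : Measurable ψ)
    (heven : ∀ p : ℝ, ψ (-p) = ψ p)
    (hnonneg : ∀ p : ℝ, 0 ≤ ψ p)
    (hpos : ∀ p : ℝ, p ≠ 0 → 0 < ψ p)
    (hRV : ∀ l : ℝ, 0 < l →
      Filter.Tendsto (fun x => ψ (l * x) / ψ x) Filter.atTop (nhds (l ^ β)))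
    (hdiff1 : ∀ p : ℝ, 0 < p → DifferentiableAt ℝ ψ p)
    (hdiff2 : ∀ p : ℝ, 0 < p → DifferentiableAt ℝ (deriv ψ) p)
    (D₁ D₂ : ℝ)
    (hD1 : ∀ l : ℝ, 1 ≤ l → l * |deriv ψ l| ≤ D₁ * ψ l)
    (hD2 : ∀ l : ℝ, 1 ≤ l → l ^ 2 * |deriv (deriv ψ) l| ≤ D₂ * ψ l)
    (hint1 : MeasureTheory.IntegrableOn (fun l : ℝ => (deriv ψ l) ^ 2) (Set.Ioc (0:ℝ) 1))
    (hint2 : MeasureTheory.IntegrableOn (fun l : ℝ => |deriv (deriv ψ) l|) (Set.Ioc (0:ℝ) 1))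
    (hint3 : MeasureTheory.IntegrableOn (fun l : ℝ => ψ l / l) (Set.Ioc (0:ℝ) 1))
    (C₀ : ℝ) (hC0 : ∀ p : ℝ, ψ p ≤ C₀ * p ^ 2)
    (hliminf : 0 < Filter.liminf (fun p : ℝ => ψ p / p ^ 2) (nhdsWithin (0:ℝ) ({0}ᶜ))) :
    ∃ C h₀ : ℝ, 0 < h₀ ∧ ∀ h : ℝ, 0 < h → h ≤ h₀ →
      0 ≤ h * ψ (1 / h) ^ 2 *
          ((∫ x : ℝ, (∫ s in Set.Ioi (0:ℝ),
              (2 * pdens ψ s x - pdens ψ s (x + h) - pdens ψ s (x - h))) ^ 2) -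
           ∫ x : ℝ, (∫ s in Set.Ioc (0:ℝ) (Real.sqrt h),
              (2 * pdens ψ s x - pdens ψ s (x + h) - pdens ψ s (x - h))) ^ 2) ∧
      h * ψ (1 / h) ^ 2 *
          ((∫ x : ℝ, (∫ s in Set.Ioi (0:ℝ),
              (2 * pdens ψ s x - pdens ψ s (x + h) - pdens ψ s (x - h))) ^ 2) -
           ∫ x : ℝ, (∫ s in Set.Ioc (0:ℝ) (Real.sqrt h),
              (2 * pdens ψ s x - pdens ψ s (x + h) - pdens ψ s (x - h))) ^ 2)
        ≤ C * Real.sqrt h := by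
  have hpos' : ∀ p : ℝ, 0 < p → 0 < ψ p := fun p hp => hpos p hp.ne'
  have hcont : ContinuousOn ψ (Set.Ioi 0) := fun p hp =>
    (hdiff1 p hp).continuousAt.continuousWithinAt
  have hcont1 : ContinuousOn ψ (Set.Ici 1) :=
    hcont.mono fun p hp => Set.mem_Ioi.2 (lt_of_lt_of_le one_pos (Set.mem_Ici.1 hp))
  have hRV2 := hRV 2 (by norm_num)
  obtain ⟨d, hd, hlow0⟩ := near_zero_low ψ hpos' hcont hliminf
  have hC0' : 0 < C₀ := by
    have h1 := hC0 1
    have h2 := hpos 1 one_ne_zero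
    linarith
  obtain ⟨γ, γ', k, hγ1, hγβ, hk1, hk2, C1, hC1, hup⟩ : ∃ (γ γ' : ℝ) (k : ℕ), 1 < γ ∧ γ < β ∧
      5 < γ * (2 + k) ∧ (k:ℝ) ≤ 9 - 4 * γ' ∧ ∃ C1 > 0, ∀ p : ℝ, 1 ≤ p → ψ p ≤ C1 * p ^ γ' := by
    rcases lt_or_ge β (3 / 2) with hb | hb
    · exact ⟨(1 + β) / 2, 3 / 2, 3, by linarith, by linarith, by push_cast; linarith, by norm_num,
        potter_up ψ β _ hb hpos' hcont1 hRV2⟩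
    rcases lt_or_ge β (7 / 4) with hb' | hb'
    · exact ⟨7 / 5, 7 / 4, 2, by norm_num, by linarith, by norm_num, by norm_num,
        potter_up ψ β _ hb' hpos' hcont1 hRV2⟩
    · refine ⟨17 / 10, 2, 1, by norm_num, by linarith, by norm_num, by norm_num, C₀, hC0', ?_⟩
      intro p _
      have := hC0 p
      norm_cast
  obtain ⟨c, hc, hlow⟩ := potter_low ψ β γ hγβ hpos' hcont1 hRV2
  set J := ∫ p in Set.Ioi (1:ℝ), p ^ (4 - γ * (2 + k)) with hJ
  have hJ0 : 0 ≤ J := setIntegral_nonneg measurableSet_Ioi fun p hp => by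
    have : (0:ℝ) < p := lt_trans one_pos hp
    positivity
  refine ⟨(1 / Real.pi) * (2 * C₀ ^ 2 / d ^ 2 + 2 * k.factorial / c ^ (2 + k) * J * C1 ^ 2),
    1, one_pos, fun h h0 h1 => ?_⟩
  set T := Real.sqrt h with hT
  have hT0 : 0 < T := Real.sqrt_pos.2 h0
  have hT1 : T ≤ 1 := Real.sqrt_le_one.2 h1
  have hTh : h = T ^ 2 := (Real.sq_sqrt h0.le).symm
  obtain ⟨iK, B, hB⟩ := K_int ψ hmeas hpos' c γ hc hγ1 hlow d hd hlow0 h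
  rw [diff_formula ψ hmeas heven hpos' h T hT0.le
    (exp_int ψ hmeas hnonneg c γ hc hγ1 hlow) iK B hB]
  obtain ⟨w0, w1⟩ := W_bound ψ hpos' c γ hc hlow d hd hlow0 k hk1 h T hT0
  have hpi := Real.pi_pos
  refine ⟨by positivity, ?_⟩
  set I := ∫ p in Set.Ioi (0:ℝ), ((2 - 2 * Real.cos (p * h)) / ψ p) ^ 2
        * (1 - (1 - Real.exp (-T * ψ p)) ^ 2)
  have hP0 := hnonneg (1 / h)
  have a1 : h * ψ (1 / h) ^ 2 * h ^ 4 ≤ C₀ ^ 2 * T := by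
    have b1 : ψ (1 / h) * h ^ 2 ≤ C₀ := by
      have := hC0 (1 / h)
      calc ψ (1 / h) * h ^ 2 ≤ (C₀ * (1 / h) ^ 2) * h ^ 2 := by gcongr
        _ = C₀ := by field_simp
    have b2 : h ≤ T := by rw [hTh]; nlinarith
    calc h * ψ (1 / h) ^ 2 * h ^ 4 = (ψ (1 / h) * h ^ 2) ^ 2 * h := by ring
      _ ≤ C₀ ^ 2 * T := by gcongr
  have a2 : h * ψ (1 / h) ^ 2 * (h ^ 4 / T ^ k) ≤ C1 ^ 2 * T := by
    have h1h : 1 ≤ 1 / h := by rw [le_div_iff₀ h0]; linarith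
    have b1 := hup (1 / h) h1h
    have := final_arith T γ' C1 (ψ (1 / h)) k hT0 hT1 hP0 (by rw [← hTh]; exact b1) hC1 hk2
    rwa [← hTh] at this
  calc h * ψ (1 / h) ^ 2 * (1 / Real.pi * I)
      ≤ h * ψ (1 / h) ^ 2 * (1 / Real.pi * (2 * h ^ 4 / d ^ 2
        + 2 * h ^ 4 * (k.factorial / T ^ k) / c ^ (2 + k) * J)) := by gcongr
    _ = (1 / Real.pi) * (2 / d ^ 2 * (h * ψ (1 / h) ^ 2 * h ^ 4)
        + 2 * k.factorial / c ^ (2 + k) * J * (h * ψ (1 / h) ^ 2 * (h ^ 4 / T ^ k))) := by ring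
    _ ≤ (1 / Real.pi) * (2 / d ^ 2 * (C₀ ^ 2 * T)
        + 2 * k.factorial / c ^ (2 + k) * J * (C1 ^ 2 * T)) := by gcongr
    _ = _ := by ring
end

section
/- There exist a constant C < ∞ and h₀ > 0 such that for all 0 < δ < 1, all 0 < h ≤ h₀, and all x ∈ ℝ: ū_δ(x) ≤ C·ψ⁻¹(1/δ)·min(1, 1/x²), v̄_δ(x) ≤ (C/δ³)·h·min(1, 1/x²), and w̄_δ(x) ≤ (C/δ³)·h²·min(1, 1/x²). -/
noncomputable def psiInv (ψ : ℝ → ℝ) (u : ℝ) : ℝ :=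
  sInf {l : ℝ | 0 < l ∧ u ≤ ψ l}

open MeasureTheory Set Filter Topology

noncomputable def cosT (G : ℝ → ℝ) (x : ℝ) : ℝ := ∫ p in Ioi (0:ℝ), Real.cos (p * x) * G p

lemma cosT_integrable (G : ℝ → ℝ) (hG : IntegrableOn G (Ioi 0)) (x : ℝ) :
    IntegrableOn (fun p => Real.cos (p * x) * G p) (Ioi 0) := by
  refine Integrable.bdd_mul (c := 1) hG ?_ ?_
  · exact (by fun_prop : Continuous fun p : ℝ => Real.cos (p * x)).aestronglyMeasurable
  · exact Eventually.of_forall fun p => by simpa using Real.abs_cos_le_one _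

lemma setInt_bound (F H : ℝ → ℝ) (hH : IntegrableOn H (Ioi 0)) (h : ∀ p, 0 < p → |F p| ≤ H p) :
    |∫ p in Ioi (0:ℝ), F p| ≤ ∫ p in Ioi (0:ℝ), H p := by
  rw [← Real.norm_eq_abs]
  refine norm_integral_le_of_norm_le hH ?_
  filter_upwards [ae_restrict_mem measurableSet_Ioi] with p hp
  exact h p hp

lemma cosT_bound (G H : ℝ → ℝ) (hH : IntegrableOn H (Ioi 0)) (h : ∀ p, 0 < p → |G p| ≤ H p)
    (x : ℝ) : |cosT G x| ≤ ∫ p in Ioi (0:ℝ), H p := by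
  refine setInt_bound _ H hH fun p hp => ?_
  rw [abs_mul]
  calc _ ≤ 1 * |G p| := by gcongr; exact Real.abs_cos_le_one _
    _ ≤ _ := by simpa using h p hp

lemma cosT_diff (G H : ℝ → ℝ) (hG : IntegrableOn G (Ioi 0))
    (hH : IntegrableOn H (Ioi 0)) (h : ∀ p, 0 < p → p * |G p| ≤ H p)
    (x t : ℝ) (ht : 0 < t) : |cosT G (x + t) - cosT G x| ≤ t * ∫ p in Ioi (0:ℝ), H p := by
  unfold cosT
  rw [← integral_sub (cosT_integrable G hG _) (cosT_integrable G hG _), ← integral_const_mul]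
  refine setInt_bound _ _ (hH.const_mul t) fun p hp => ?_
  rw [← sub_mul, abs_mul]
  calc _ ≤ |p * (x + t) - p * x| * |G p| :=
        mul_le_mul_of_nonneg_right (Real.abs_cos_sub_cos_le _ _) (abs_nonneg _)
    _ = t * (p * |G p|) := by
      rw [show p * (x + t) - p * x = p * t by ring, abs_of_pos (mul_pos hp ht)]; ring
    _ ≤ _ := by gcongr; exact h p hp

lemma cosT_diff2 (G H : ℝ → ℝ) (hG : IntegrableOn G (Ioi 0))
    (hH : IntegrableOn H (Ioi 0)) (h : ∀ p, 0 < p → p ^ 2 * |G p| ≤ H p)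
    (x t : ℝ) : |2 * cosT G x - cosT G (x + t) - cosT G (x - t)|
      ≤ t ^ 2 * ∫ p in Ioi (0:ℝ), H p := by
  unfold cosT
  have i1 := (cosT_integrable G hG x).const_mul 2
  have i2 := cosT_integrable G hG (x + t)
  have i3 : IntegrableOn (fun p => 2 * (Real.cos (p * x) * G p) - Real.cos (p * (x + t)) * G p)
    (Ioi 0) := i1.sub i2
  rw [← integral_const_mul, ← integral_sub i1 i2, ← integral_sub i3 (cosT_integrable G hG _),
    ← integral_const_mul]
  refine setInt_bound _ _ (hH.const_mul _) fun p hp => ?_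
  have e : 2 * (Real.cos (p * x) * G p) - Real.cos (p * (x + t)) * G p
      - Real.cos (p * (x - t)) * G p = Real.cos (p * x) * (2 * (1 - Real.cos (p * t))) * G p := by
    rw [mul_add, mul_sub, Real.cos_add, Real.cos_sub]; ring
  rw [e, abs_mul, abs_mul]
  have h1 : |2 * (1 - Real.cos (p * t))| ≤ p ^ 2 * t ^ 2 := by
    rw [abs_of_nonneg (by linarith [Real.cos_le_one (p * t)])]
    have := Real.one_sub_sq_div_two_le_cos (x := p * t)
    nlinarith
  calc _ ≤ 1 * (p ^ 2 * t ^ 2) * |G p| := by gcongr; exact Real.abs_cos_le_one _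
    _ = t ^ 2 * (p ^ 2 * |G p|) := by ring
    _ ≤ _ := by gcongr; exact h p hp

lemma alg_y (A : ℝ) (f : ℝ → ℝ) (h0 : ∀ x, |f x| ≤ A) (h1 : ∀ x, x ^ 2 * |f x| ≤ A) (x : ℝ) :
    |x| * |f x| ≤ A := by
  rcases le_total |x| 1 with h | h
  · calc _ ≤ 1 * |f x| := by gcongr
      _ ≤ A := by simpa using h0 x
  · calc _ ≤ x ^ 2 * |f x| := by
          gcongr; rw [← sq_abs]; nlinarith
      _ ≤ A := h1 x

lemma le_div_max {a B x : ℝ} (h0 : a ≤ B) (h1 : x ^ 2 * a ≤ B) : a ≤ B / max 1 (x ^ 2) := by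
  rw [le_div_iff₀ (by positivity)]
  rcases max_choice 1 (x ^ 2) with h | h <;> rw [h]
  · linarith
  · linarith

lemma alg_diff (A : ℝ) (f k : ℝ → ℝ) (hfk : ∀ x, x ^ 2 * f x = k x)
    (f0 : ∀ x, |f x| ≤ A) (f1 : ∀ x t, 0 < t → |f (x + t) - f x| ≤ t * A)
    (k0 : ∀ x, |k x| ≤ A) (k1 : ∀ x t, 0 < t → |k (x + t) - k x| ≤ t * A)
    (x t : ℝ) (ht : 0 < t) (ht2 : t ≤ 2) :
    |f (x + t) - f x| ≤ 5 * A * t / max 1 (x ^ 2) := by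
  have hA : 0 ≤ A := (abs_nonneg _).trans (f0 0)
  have hy : ∀ x, |x| * |f x| ≤ A := alg_y A f f0 fun x => by
    rw [← abs_of_nonneg (sq_nonneg x), ← abs_mul, hfk]; exact k0 x
  apply le_div_max
  · have := f1 x t ht; nlinarith [mul_nonneg hA ht.le]
  · have e : x ^ 2 * (f (x + t) - f x) = (k (x + t) - k x) - 2 * t * ((x + t) * f (x + t))
        + t * (t * f (x + t)) := by
      rw [← hfk, ← hfk]; ring
    rw [← abs_of_nonneg (sq_nonneg x), ← abs_mul, e]
    have a1 := k1 x t ht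
    have a2 := hy (x + t)
    rw [← abs_mul] at a2
    have a3 := f0 (x + t)
    have a4 : |2 * t * ((x + t) * f (x + t))| ≤ 2 * t * A := by
      rw [abs_mul, abs_of_pos (by positivity)]; gcongr
    have a5 : |t * (t * f (x + t))| ≤ t * (2 * A) := by
      rw [abs_mul, abs_mul, abs_of_pos ht]; gcongr
    have b1 := abs_add_le ((k (x + t) - k x) - 2 * t * ((x + t) * f (x + t))) (t * (t * f (x + t)))
    have b2 := abs_sub (k (x + t) - k x) (2 * t * ((x + t) * f (x + t)))
    linarith

lemma alg_diff2 (A : ℝ) (f k : ℝ → ℝ) (hfk : ∀ x, x ^ 2 * f x = k x)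
    (f0 : ∀ x, |f x| ≤ A) (f1 : ∀ x t, 0 < t → |f (x + t) - f x| ≤ t * A)
    (f2 : ∀ x t, |2 * f x - f (x + t) - f (x - t)| ≤ t ^ 2 * A)
    (k0 : ∀ x, |k x| ≤ A) (k1 : ∀ x t, 0 < t → |k (x + t) - k x| ≤ t * A)
    (k2 : ∀ x t, |2 * k x - k (x + t) - k (x - t)| ≤ t ^ 2 * A)
    (x t : ℝ) (ht : 0 < t) (ht1 : t ≤ 1) :
    |2 * f x - f (x + t) - f (x - t)| ≤ 43 * A * t ^ 2 / max 1 (x ^ 2) := by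
  have hA : 0 ≤ A := (abs_nonneg _).trans (f0 0)
  have d := alg_diff A f k hfk f0 f1 k0 k1 (x - t) (2 * t) (by positivity) (by linarith)
  rw [show x - t + 2 * t = x + t by ring] at d
  apply le_div_max
  · have := f2 x t; nlinarith [mul_nonneg hA (sq_nonneg t)]
  · have e : x ^ 2 * (2 * f x - f (x + t) - f (x - t)) = (2 * k x - k (x + t) - k (x - t))
        + 2 * t * (x * (f (x + t) - f (x - t))) + t ^ 2 * (f (x + t) + f (x - t)) := by
      rw [← hfk, ← hfk, ← hfk]; ring
    rw [← abs_of_nonneg (sq_nonneg x), ← abs_mul, e]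
    have a1 := k2 x t
    have a2 : |x * (f (x + t) - f (x - t))| ≤ 20 * A * t := by
      rw [abs_mul]
      have hm1 := le_max_left 1 ((x - t) ^ 2)
      have hm2 := le_max_right 1 ((x - t) ^ 2)
      have hx : |x| ≤ 2 * max 1 ((x - t) ^ 2) := by
        have h3 : |x| ≤ |x - t| + |t| := by simpa using abs_add_le (x - t) t
        rw [abs_of_pos ht] at h3
        rw [← sq_abs] at hm1 hm2 ⊢
        nlinarith [sq_nonneg (|x - t| - 1)]
      calc _ ≤ 2 * max 1 ((x - t) ^ 2) * (5 * A * (2 * t) / max 1 ((x - t) ^ 2)) := by gcongr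
        _ = _ := by
          have : max 1 ((x - t) ^ 2) ≠ 0 := by positivity
          field_simp; ring
    have a3 : |f (x + t) + f (x - t)| ≤ 2 * A := by
      linarith [abs_add_le (f (x + t)) (f (x - t)), f0 (x + t), f0 (x - t)]
    have a4 : |2 * t * (x * (f (x + t) - f (x - t)))| ≤ 2 * t * (20 * A * t) := by
      rw [abs_mul, abs_of_pos (by positivity)]; gcongr
    have a5 : |t ^ 2 * (f (x + t) + f (x - t))| ≤ t ^ 2 * (2 * A) := by
      rw [abs_mul, abs_of_pos (by positivity)]; gcongr
    have b1 := abs_add_three (2 * k x - k (x + t) - k (x - t))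
      (2 * t * (x * (f (x + t) - f (x - t)))) (t ^ 2 * (f (x + t) + f (x - t)))
    linarith

lemma exp_int_s14 {b : ℝ} (hb : 0 < b) : IntegrableOn (fun p => Real.exp (-b * p)) (Ioi 0) ∧
    ∫ p in Ioi (0:ℝ), Real.exp (-b * p) = 1 / b := by
  refine ⟨integrableOn_exp_mul_Ioi (by linarith) 0, ?_⟩
  rw [integral_exp_mul_Ioi (by linarith)]
  simp

/-- Linear lower growth. -/
lemma growth (β : ℝ) (hβ1 : 1 < β) (ψ : ℝ → ℝ) (hpos : ∀ p : ℝ, p ≠ 0 → 0 < ψ p)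
    (hRV : ∀ l : ℝ, 0 < l →
      Filter.Tendsto (fun x => ψ (l * x) / ψ x) Filter.atTop (nhds (l ^ β)))
    (hdiff1 : ∀ p : ℝ, 0 < p → DifferentiableAt ℝ ψ p) (D₁ : ℝ)
    (hD1 : ∀ l : ℝ, 1 ≤ l → l * |deriv ψ l| ≤ D₁ * ψ l) :
    ∃ X c : ℝ, 1 ≤ X ∧ 0 < c ∧ ∀ q p, X ≤ q → q ≤ p → c * (p / q) * ψ q ≤ ψ p := by
  have h2 : (2:ℝ) < 2 ^ β := by
    simpa using Real.rpow_lt_rpow_of_exponent_lt (x := 2) (by norm_num) hβ1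
  obtain ⟨X₁, hX₁⟩ := eventually_atTop.1 ((hRV 2 (by norm_num)).eventually (lt_mem_nhds h2))
  have hD : 0 ≤ D₁ := by
    have := hD1 1 le_rfl
    have h3 := hpos 1 one_ne_zero
    by_contra hneg
    push Not at hneg
    nlinarith [abs_nonneg (deriv ψ 1)]
  have hdbl : ∀ n : ℕ, ∀ y, max 1 X₁ ≤ y → 2 ^ n * ψ y ≤ ψ (2 ^ n * y) := by
    intro n
    induction n with
    | zero => intro y _; simp
    | succ n ih =>
      intro y hy
      have hy1 : 1 ≤ y := (le_max_left _ _).trans hy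
      have := ih (2 * y) (by linarith)
      have h5 := hX₁ y ((le_max_right _ _).trans hy)
      have hp := hpos y (by linarith)
      rw [lt_div_iff₀ hp] at h5
      calc (2:ℝ) ^ (n + 1) * ψ y = 2 ^ n * (2 * ψ y) := by ring
        _ ≤ 2 ^ n * ψ (2 * y) := by gcongr
        _ ≤ _ := this
        _ = _ := by congr 1; ring
  have hloc : ∀ q y, 1 ≤ q → q ≤ y → y ≤ 2 * q → Real.exp (-D₁) * ψ q ≤ ψ y := by
    intro q y hq hqy hy
    have hd : ∀ z ∈ Icc q y, HasDerivAt (fun z => Real.log (ψ z)) (deriv ψ z / ψ z) z := by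
      intro z hz
      exact (hdiff1 z (by linarith [hz.1])).hasDerivAt.log (hpos z (by linarith [hz.1])).ne'
    have hb := Convex.norm_image_sub_le_of_norm_hasDerivWithin_le (C := D₁ / q)
      (fun z hz => (hd z hz).hasDerivWithinAt (s := Icc q y)) (fun z hz => by
        have hz1 : 1 ≤ z := by linarith [hz.1]
        have hpz := hpos z (by linarith)
        rw [Real.norm_eq_abs, abs_div, abs_of_pos hpz, div_le_div_iff₀ hpz (by linarith)]
        calc |deriv ψ z| * q ≤ z * |deriv ψ z| := by rw [mul_comm]; gcongr; exact hz.1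
          _ ≤ _ := hD1 z hz1) (convex_Icc q y) (left_mem_Icc.2 hqy) (right_mem_Icc.2 hqy)
    have h6 : D₁ / q * ‖y - q‖ ≤ D₁ := by
      rw [Real.norm_eq_abs, abs_of_nonneg (by linarith), div_mul_eq_mul_div, div_le_iff₀ (by linarith)]
      gcongr; linarith
    have h7 := (abs_le.1 (hb.trans h6)).1
    have hq0 := hpos q (by linarith)
    have hy0 := hpos y (by linarith)
    rw [← Real.exp_log hq0, ← Real.exp_add, ← Real.le_log_iff_exp_le hy0]
    linarith
  refine ⟨max 1 X₁, Real.exp (-D₁) / 2, le_max_left _ _, by positivity, ?_⟩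
  intro q p hq hqp
  have hq1 : 1 ≤ q := (le_max_left _ _).trans hq
  obtain ⟨n, hn1, hn2⟩ := exists_nat_pow_near (x := p / q) (y := 2)
    (by rw [one_le_div (by linarith)]; exact hqp) (by norm_num)
  have hn1' := hn1
  rw [le_div_iff₀ (by linarith)] at hn1
  rw [div_lt_iff₀ (by linarith)] at hn2
  set y := p / 2 ^ n with hy
  have hp2 : (0:ℝ) < 2 ^ n := by positivity
  have hpy : p = 2 ^ n * y := by rw [hy]; field_simp
  have hqy : q ≤ y := by rw [hy, le_div_iff₀ hp2]; linarith
  have hy2 : y ≤ 2 * q := by rw [hy, div_le_iff₀ hp2]; rw [pow_succ] at hn2; linarith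
  have := hdbl n y (hq.trans hqy)
  rw [← hpy] at this
  have h8 := hloc q y hq1 hqy hy2
  have hq0 := hpos q (by linarith)
  calc _ ≤ Real.exp (-D₁) / 2 * (2 ^ (n + 1)) * ψ q := by
        gcongr; rw [div_le_iff₀ (by linarith)]; exact hn2.le
    _ = 2 ^ n * (Real.exp (-D₁) * ψ q) := by ring
    _ ≤ 2 ^ n * ψ y := by gcongr
    _ ≤ _ := this

lemma deriv_lim (ψ : ℝ → ℝ)
    (hnonneg : ∀ p : ℝ, 0 ≤ ψ p)
    (hdiff1 : ∀ p : ℝ, 0 < p → DifferentiableAt ℝ ψ p)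
    (hdiff2 : ∀ p : ℝ, 0 < p → DifferentiableAt ℝ (deriv ψ) p)
    (hint2 : IntegrableOn (fun l : ℝ => |deriv (deriv ψ) l|) (Set.Ioc (0:ℝ) 1))
    (C₀ : ℝ) (hC0 : ∀ p : ℝ, ψ p ≤ C₀ * p ^ 2) :
    ψ 0 = 0 ∧ HasDerivAt ψ 0 0 ∧ ContinuousWithinAt (deriv ψ) (Ici 0) 0 := by
  have h0 : ψ 0 = 0 := le_antisymm (by simpa using hC0 0) (hnonneg 0)
  have hd0 : HasDerivAt ψ 0 0 := by
    rw [hasDerivAt_iff_isLittleO]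
    have hO : (fun p => ψ p) =O[𝓝 0] (fun p : ℝ => p ^ 2) := by
      refine Asymptotics.IsBigO.of_bound C₀ (Eventually.of_forall fun p => ?_)
      rw [Real.norm_eq_abs, abs_of_nonneg (hnonneg p), Real.norm_eq_abs,
        abs_of_nonneg (sq_nonneg p)]
      exact hC0 p
    have hl : (fun p : ℝ => p ^ 2) =o[𝓝 0] (fun p : ℝ => p) := by
      simpa using Asymptotics.isLittleO_pow_pow (𝕜 := ℝ) (m := 1) (n := 2) (by norm_num)
    simpa [h0] using hO.trans_isLittleO hl
  refine ⟨h0, hd0, ?_⟩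
  have hii : IntervalIntegrable (deriv (deriv ψ)) volume 0 1 := by
    rw [intervalIntegrable_iff_integrableOn_Ioc_of_le zero_le_one]
    exact (integrable_norm_iff (measurable_deriv _).aestronglyMeasurable).1 hint2
  have hF := intervalIntegral.continuousOn_primitive_interval' (a := 1) hii right_mem_uIcc
  rw [uIcc_of_le zero_le_one] at hF
  have hF0 := (hF 0 (by simp)).tendsto
  have hF1 : Tendsto (fun b => ∫ x in (1:ℝ)..b, deriv (deriv ψ) x) (𝓝[>] 0)
      (𝓝 (∫ x in (1:ℝ)..0, deriv (deriv ψ) x)) := by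
    refine hF0.mono_left ?_
    rw [nhdsWithin_le_iff]
    filter_upwards [Ioc_mem_nhdsGT (zero_lt_one : (0:ℝ) < 1)] with p hp using ⟨hp.1.le, hp.2⟩
  have hlim : Tendsto (deriv ψ) (𝓝[>] 0)
      (𝓝 ((∫ x in (1:ℝ)..0, deriv (deriv ψ) x) + deriv ψ 1)) := by
    refine (hF1.add_const (deriv ψ 1)).congr' ?_
    filter_upwards [Ioc_mem_nhdsGT (zero_lt_one : (0:ℝ) < 1)] with p hp
    rw [intervalIntegral.integral_eq_sub_of_hasDerivAt (f := deriv ψ)]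
    · ring
    · intro z hz
      rw [uIcc_of_ge hp.2] at hz
      exact (hdiff2 z (hp.1.trans_le hz.1)).hasDerivAt
    · refine (hii.mono_set ?_).symm
      rw [uIcc_of_le hp.2, uIcc_of_le zero_le_one]
      exact Icc_subset_Icc hp.1.le le_rfl
  have hR := hasDerivWithinAt_Ici_of_tendsto_deriv (s := Ioi 0) (a := (0:ℝ)) (f := ψ)
    (fun p hp => (hdiff1 p hp).differentiableWithinAt) hd0.continuousAt.continuousWithinAt
    self_mem_nhdsWithin hlim
  have hL := (uniqueDiffWithinAt_Ici (0:ℝ)).eq_deriv _ hR hd0.hasDerivWithinAt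
  rw [hL] at hlim
  rw [← continuousWithinAt_Ioi_iff_Ici]
  rw [ContinuousWithinAt, hd0.deriv]
  exact hlim

noncomputable def gpp (ψ : ℝ → ℝ) (r p : ℝ) : ℝ :=
  (r ^ 2 * (deriv ψ p) ^ 2 - r * deriv (deriv ψ) p) * Real.exp (-r * ψ p)

lemma ibp (ψ : ℝ → ℝ) (r : ℝ)
    (hdiff1 : ∀ p : ℝ, 0 < p → DifferentiableAt ℝ ψ p)
    (hdiff2 : ∀ p : ℝ, 0 < p → DifferentiableAt ℝ (deriv ψ) p)
    (hd0 : HasDerivAt ψ 0 0) (hdc : ContinuousWithinAt (deriv ψ) (Ici 0) 0)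
    (hg : IntegrableOn (fun p => Real.exp (-r * ψ p)) (Ioi 0))
    (hgpp : IntegrableOn (gpp ψ r) (Ioi 0))
    (hlim : Tendsto (fun p => Real.exp (-r * ψ p)) atTop (𝓝 0))
    (hlim' : Tendsto (fun p => deriv ψ p * Real.exp (-r * ψ p)) atTop (𝓝 0)) (x : ℝ) :
    x ^ 2 * cosT (fun p => Real.exp (-r * ψ p)) x = - cosT (gpp ψ r) x := by
  set Φ : ℝ → ℝ := fun p => x * (Real.sin (p * x) * Real.exp (-r * ψ p))
    + (-r) * (Real.cos (p * x) * (deriv ψ p * Real.exp (-r * ψ p))) with hΦ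
  have hc : ContinuousWithinAt Φ (Ici 0) 0 := by
    have := hd0.continuousAt.continuousWithinAt (s := Ici 0)
    have h1 : ContinuousWithinAt (fun p => Real.exp (-r * ψ p)) (Ici 0) 0 := by fun_prop
    fun_prop
  have hder : ∀ p ∈ Ioi (0:ℝ), HasDerivAt Φ (x ^ 2 * (Real.cos (p * x) * Real.exp (-r * ψ p))
      + Real.cos (p * x) * gpp ψ r p) p := by
    intro p hp
    have h1 := (hdiff1 p hp).hasDerivAt
    have h2 := (hdiff2 p hp).hasDerivAt
    have h3 := (h1.const_mul (-r)).exp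
    have h4 : HasDerivAt (fun p : ℝ => p * x) x p := by simpa using (hasDerivAt_id p).mul_const x
    have := ((h4.sin.mul h3).const_mul x).add ((h4.cos.mul (h2.mul h3)).const_mul (-r))
    refine this.congr_deriv ?_
    simp only [gpp, Pi.mul_apply]
    ring
  have i1 := (cosT_integrable _ hg x).const_mul (x ^ 2)
  have i2 := cosT_integrable _ hgpp x
  have hl : Tendsto Φ atTop (𝓝 0) := by
    have b1 : Tendsto (fun p => Real.sin (p * x) * Real.exp (-r * ψ p)) atTop (𝓝 0) := by
      refine squeeze_zero_norm (fun p => ?_) (by simpa only [norm_zero] using hlim.norm)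
      rw [norm_mul]
      exact mul_le_of_le_one_left (norm_nonneg _) (Real.abs_sin_le_one _)
    have b2 : Tendsto (fun p => Real.cos (p * x) * (deriv ψ p * Real.exp (-r * ψ p)))
        atTop (𝓝 0) := by
      refine squeeze_zero_norm (fun p => ?_) (by simpa only [norm_zero] using hlim'.norm)
      rw [norm_mul]
      exact mul_le_of_le_one_left (norm_nonneg _) (Real.abs_cos_le_one _)
    have b3 := (b1.const_mul x).add (b2.const_mul (-r))
    simp only [mul_zero, add_zero] at b3
    exact b3
  have key := integral_Ioi_of_hasDerivAt_of_tendsto hc hder (i1.add i2) hl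
  rw [integral_add i1 i2, integral_const_mul] at key
  have hΦ0 : Φ 0 = 0 := by simp [hΦ, hd0.deriv]
  rw [hΦ0] at key
  unfold cosT
  linarith

lemma exp_dom {ψ : ℝ → ℝ} (hnonneg : ∀ p : ℝ, 0 ≤ ψ p) {X c s : ℝ} (hX : 0 ≤ X) (hc : 0 ≤ c)
    (hs : 0 < s) (hs1 : s ≤ 1) (h : ∀ p, X ≤ p → c * p ≤ ψ p) (p : ℝ) (hp : 0 < p) :
    Real.exp (-s * ψ p) ≤ Real.exp (c * X) * Real.exp (-(s * c) * p) := by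
  rw [← Real.exp_add, Real.exp_le_exp]
  rcases le_total X p with hXp | hXp
  · have := mul_le_mul_of_nonneg_left (h p hXp) hs.le
    nlinarith [mul_nonneg hc hX]
  · have h1 := mul_nonneg hs.le (hnonneg p)
    have h2 : s * c * p ≤ 1 * c * X := by gcongr
    linarith

lemma sq_exp_half {t : ℝ} (ht : 0 ≤ t) : t ^ 2 * Real.exp (-t) ≤ 8 * Real.exp (-t / 2) := by
  have h := Real.pow_div_factorial_le_exp (x := t / 2) (by linarith) 2
  have e : Real.exp (-t / 2) = Real.exp (t / 2) * Real.exp (-t) := by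
    rw [← Real.exp_add]; congr 1; ring
  rw [e, ← mul_assoc]
  gcongr
  norm_num [Nat.factorial] at h
  linarith

lemma one_exp_half {t : ℝ} (ht : 0 ≤ t) : t * Real.exp (-t) ≤ 2 * Real.exp (-t / 2) := by
  have h := Real.add_one_le_exp (t / 2)
  have e : Real.exp (-t / 2) = Real.exp (t / 2) * Real.exp (-t) := by
    rw [← Real.exp_add]; congr 1; ring
  rw [e, ← mul_assoc]
  gcongr
  linarith

lemma gpp_small (ψ : ℝ → ℝ) (hnonneg : ∀ p : ℝ, 0 ≤ ψ p) {r : ℝ} (hr : 0 < r) (hr1 : r ≤ 1)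
    (p : ℝ) : |gpp ψ r p| ≤ (deriv ψ p) ^ 2 + |deriv (deriv ψ) p| := by
  unfold gpp
  rw [abs_mul, abs_of_pos (Real.exp_pos _)]
  have h1 : Real.exp (-r * ψ p) ≤ 1 := Real.exp_le_one_iff.2 (by nlinarith [hnonneg p])
  refine (mul_le_of_le_one_right (abs_nonneg _) h1).trans ?_
  refine (abs_sub _ _).trans ?_
  rw [abs_mul, abs_mul, abs_of_pos hr, abs_of_nonneg (sq_nonneg (deriv ψ p)),
    abs_of_pos (pow_pos hr 2)]
  have h2 : r ^ 2 ≤ 1 := by nlinarith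
  exact add_le_add (mul_le_of_le_one_left (sq_nonneg _) h2) (mul_le_of_le_one_left (abs_nonneg _) hr1)

lemma gpp_large (ψ : ℝ → ℝ) (hnonneg : ∀ p : ℝ, 0 ≤ ψ p) {r : ℝ} (hr : 0 < r) (D₁ D₂ : ℝ)
    (hD1 : ∀ l : ℝ, 1 ≤ l → l * |deriv ψ l| ≤ D₁ * ψ l) (hD2' : 0 ≤ D₂)
    (hD2 : ∀ l : ℝ, 1 ≤ l → l ^ 2 * |deriv (deriv ψ) l| ≤ D₂ * ψ l) (p : ℝ) (hp : 1 ≤ p) :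
    p ^ 2 * |gpp ψ r p| ≤ (8 * D₁ ^ 2 + 2 * D₂) * Real.exp (-(r / 2) * ψ p) := by
  unfold gpp
  rw [abs_mul, abs_of_pos (Real.exp_pos _), ← mul_assoc]
  have ht : 0 ≤ r * ψ p := mul_nonneg hr.le (hnonneg p)
  have h1 : p ^ 2 * |r ^ 2 * (deriv ψ p) ^ 2 - r * deriv (deriv ψ) p|
      ≤ D₁ ^ 2 * (r * ψ p) ^ 2 + D₂ * (r * ψ p) := by
    have a1 : (p * |deriv ψ p|) ^ 2 ≤ (D₁ * ψ p) ^ 2 := by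
      have := hD1 p hp; gcongr
    rw [mul_pow, sq_abs] at a1
    have a2 := hD2 p hp
    have a3 := abs_sub (r ^ 2 * (deriv ψ p) ^ 2) (r * deriv (deriv ψ) p)
    rw [abs_mul, abs_mul, abs_of_pos hr, abs_of_nonneg (sq_nonneg (deriv ψ p)),
      abs_of_pos (pow_pos hr 2)] at a3
    calc _ ≤ p ^ 2 * (r ^ 2 * deriv ψ p ^ 2 + r * |deriv (deriv ψ) p|) := by gcongr
      _ = r ^ 2 * (p ^ 2 * deriv ψ p ^ 2) + r * (p ^ 2 * |deriv (deriv ψ) p|) := by ring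
      _ ≤ r ^ 2 * ((D₁ * ψ p) ^ 2) + r * (D₂ * ψ p) := by gcongr
      _ = _ := by ring
  have s1 := sq_exp_half ht
  have s2 := one_exp_half ht
  rw [show -r * ψ p = -(r * ψ p) by ring, show -(r / 2) * ψ p = -(r * ψ p) / 2 by ring]
  calc _ ≤ (D₁ ^ 2 * (r * ψ p) ^ 2 + D₂ * (r * ψ p)) * Real.exp (-(r * ψ p)) := by gcongr
    _ = D₁ ^ 2 * ((r * ψ p) ^ 2 * Real.exp (-(r * ψ p))) + D₂ * ((r * ψ p) * Real.exp (-(r * ψ p))) := by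
      ring
    _ ≤ D₁ ^ 2 * (8 * Real.exp (-(r * ψ p) / 2)) + D₂ * (2 * Real.exp (-(r * ψ p) / 2)) := by gcongr
    _ = _ := by ring

lemma pow_exp {b y p : ℝ} (hb : 0 < b) (hy : 1 ≤ y) (hyb : 2 / b ≤ y) (hp : 0 < p) (k : ℕ)
    (hk : k ≤ 2) : p ^ k * Real.exp (-b * p) ≤ 2 * y ^ 2 * Real.exp (-(b / 2) * p) := by
  have e : Real.exp (-(b / 2) * p) = Real.exp (b / 2 * p) * Real.exp (-b * p) := by
    rw [← Real.exp_add]; congr 1; ring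
  rw [e, ← mul_assoc]
  gcongr
  have h := Real.pow_div_factorial_le_exp (x := b / 2 * p) (by positivity) k
  rw [div_le_iff₀ (by positivity)] at h
  have hf : (k.factorial : ℝ) ≤ 2 := by
    have : k.factorial ≤ Nat.factorial 2 := Nat.factorial_le hk
    exact_mod_cast this
  have hyk : (2 / b) ^ k ≤ y ^ 2 := by
    calc _ ≤ y ^ k := by gcongr
      _ ≤ y ^ 2 := pow_le_pow_right₀ hy hk
  calc p ^ k = (2 / b) ^ k * (b / 2 * p) ^ k := by rw [← mul_pow]; congr 1; field_simp
    _ ≤ y ^ 2 * (Real.exp (b / 2 * p) * 2) := by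
      gcongr
      exact h.trans (by gcongr)
    _ = _ := by ring

set_option maxHeartbeats 4000000 in
theorem stmt_14
    (β : ℝ) (hβ1 : 1 < β) (hβ2 : β ≤ 2)
    (ψ : ℝ → ℝ)
    (hmeas : Measurable ψ)
    (heven : ∀ p : ℝ, ψ (-p) = ψ p)
    (hnonneg : ∀ p : ℝ, 0 ≤ ψ p)
    (hpos : ∀ p : ℝ, p ≠ 0 → 0 < ψ p)
    (hRV : ∀ l : ℝ, 0 < l →
      Filter.Tendsto (fun x => ψ (l * x) / ψ x) Filter.atTop (nhds (l ^ β)))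
    (hdiff1 : ∀ p : ℝ, 0 < p → DifferentiableAt ℝ ψ p)
    (hdiff2 : ∀ p : ℝ, 0 < p → DifferentiableAt ℝ (deriv ψ) p)
    (D₁ D₂ : ℝ)
    (hD1 : ∀ l : ℝ, 1 ≤ l → l * |deriv ψ l| ≤ D₁ * ψ l)
    (hD2 : ∀ l : ℝ, 1 ≤ l → l ^ 2 * |deriv (deriv ψ) l| ≤ D₂ * ψ l)
    (hint1 : MeasureTheory.IntegrableOn (fun l : ℝ => (deriv ψ l) ^ 2) (Set.Ioc (0:ℝ) 1))
    (hint2 : MeasureTheory.IntegrableOn (fun l : ℝ => |deriv (deriv ψ) l|) (Set.Ioc (0:ℝ) 1))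
    (hint3 : MeasureTheory.IntegrableOn (fun l : ℝ => ψ l / l) (Set.Ioc (0:ℝ) 1))
    (C₀ : ℝ) (hC0 : ∀ p : ℝ, ψ p ≤ C₀ * p ^ 2)
    (hliminf : 0 < Filter.liminf (fun p : ℝ => ψ p / p ^ 2) (nhdsWithin (0:ℝ) ({0}ᶜ))) :
    ∃ C h₀ : ℝ, 0 < h₀ ∧ ∀ δ : ℝ, 0 < δ → δ < 1 → ∀ h : ℝ, 0 < h → h ≤ h₀ →
      ∀ x r : ℝ, δ ≤ r → r ≤ 1 →
      pdens ψ r x ≤ C * psiInv ψ (1 / δ) / max 1 (x ^ 2) ∧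
      |pdens ψ r (x + h) - pdens ψ r x| ≤ C / δ ^ 3 * h / max 1 (x ^ 2) ∧
      |2 * pdens ψ r x - pdens ψ r (x + h) - pdens ψ r (x - h)|
        ≤ C / δ ^ 3 * h ^ 2 / max 1 (x ^ 2) := by
  obtain ⟨X, c, hX, hc, hgrow⟩ := growth β hβ1 ψ hpos hRV hdiff1 D₁ hD1
  obtain ⟨h0, hd0, hdc⟩ := deriv_lim ψ hnonneg hdiff1 hdiff2 hint2 C₀ hC0
  have hψ1 := hpos 1 one_ne_zero
  have hC0p : 0 < C₀ := by have := hC0 1; norm_num at this; linarith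
  have hD2' : 0 ≤ D₂ := by
    have := hD2 1 le_rfl
    by_contra hneg
    push Not at hneg
    nlinarith [abs_nonneg (deriv (deriv ψ) 1)]
  have hD1' : 0 ≤ D₁ := by
    have := hD1 1 le_rfl
    by_contra hneg
    push Not at hneg
    nlinarith [abs_nonneg (deriv ψ 1)]
  have hX0 : 0 < X := by linarith
  have hψX := hpos X hX0.ne'
  obtain ⟨c₁, hc₁, hlin⟩ : ∃ c₁ : ℝ, 0 < c₁ ∧ ∀ p, X ≤ p → c₁ * p ≤ ψ p := by
    refine ⟨c * ψ X / X, by positivity, fun p hp => ?_⟩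
    have := hgrow X p le_rfl hp
    calc _ = c * (p / X) * ψ X := by ring
      _ ≤ _ := this
  set E := Real.exp (c₁ * X) with hE
  have hEp : 0 < E := Real.exp_pos _
  set B := 8 * D₁ ^ 2 + 2 * D₂ with hB
  have hBp : 0 ≤ B := by positivity
  set M : ℝ → ℝ := (Ioc (0:ℝ) 1).indicator (fun p => (deriv ψ p) ^ 2 + |deriv (deriv ψ) p|) with hM
  have hMnn : ∀ p, 0 ≤ M p := fun p => indicator_nonneg (fun _ _ => by positivity) p
  have hMint : Integrable M := (hint1.add hint2).integrable_indicator measurableSet_Ioc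
  set IM := ∫ p in Ioi (0:ℝ), M p with hIM
  have hIMp : 0 ≤ IM := integral_nonneg hMnn
  have hMval : ∀ p, 0 < p → p ≤ 1 → M p = (deriv ψ p) ^ 2 + |deriv (deriv ψ) p| :=
    fun p hp hp1 => indicator_of_mem (show p ∈ Ioc (0:ℝ) 1 from ⟨hp, hp1⟩) _
  set m := max 1 (2 / c₁) with hm
  have hm1 : 1 ≤ m := le_max_left _ _
  have hm2 : 2 / c₁ ≤ m := le_max_right _ _
  set J := IM + B * 2 * ∫ p in Ioi (0:ℝ), (1 + p ^ 2)⁻¹ with hJ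
  have hJint : IntegrableOn (fun p : ℝ => M p + B * 2 * (1 + p ^ 2)⁻¹) (Ioi 0) :=
    hMint.integrableOn.add (integrable_inv_one_add_sq.integrableOn.const_mul _)
  have hJeq : ∫ p in Ioi (0:ℝ), (M p + B * 2 * (1 + p ^ 2)⁻¹) = J := by
    rw [integral_add hMint.integrableOn (integrable_inv_one_add_sq.integrableOn.const_mul _),
      integral_const_mul]
  have hJp : 0 ≤ J := by
    rw [← hJeq]; exact integral_nonneg fun p => add_nonneg (hMnn p) (by positivity)
  set c₂ := Real.sqrt (1 / C₀) with hc₂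
  have hc₂p : 0 < c₂ := Real.sqrt_pos.2 (by positivity)
  set K := 2 * E * m ^ 3 + (IM + B * E * m ^ 3) with hK
  have hKp : 0 ≤ K := by positivity
  set C₁ := 2 * (Real.exp c / c) + E / c₁ * (C₀ * X ^ 2) / c₂ with hC₁
  have hC₁p : 0 ≤ C₁ := by positivity
  refine ⟨C₁ + J / c₂ + 43 * K, 1, one_pos, ?_⟩
  intro δ hδ hδ1 h hh hh1 x r hδr hr1
  have hr : 0 < r := hδ.trans_le hδr
  have hJc : 0 ≤ J / c₂ := by positivity
  set g : ℝ → ℝ := fun p => Real.exp (-r * ψ p) with hgdef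
  set b := r * c₁ with hbdef
  have hb : 0 < b := mul_pos hr hc₁
  have hgdom : ∀ p, 0 < p → g p ≤ E * Real.exp (-b * p) := fun p hp =>
    exp_dom hnonneg hX0.le hc₁.le hr hr1 hlin p hp
  have hgpos : ∀ p, 0 < g p := fun p => Real.exp_pos _
  have hgmeas : Measurable g := by fun_prop
  have hgint : IntegrableOn g (Ioi 0) := by
    refine Integrable.mono' ((exp_int_s14 hb).1.const_mul E) hgmeas.aestronglyMeasurable ?_
    filter_upwards [ae_restrict_mem measurableSet_Ioi] with p hp
    rw [Real.norm_eq_abs, abs_of_pos (hgpos p)]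
    exact hgdom p hp
  have hkmeas : Measurable (gpp ψ r) := by
    have := measurable_deriv ψ
    have := measurable_deriv (deriv ψ)
    unfold gpp
    fun_prop
  have hkJ : ∀ p, 0 < p → |gpp ψ r p| ≤ M p + B * 2 * (1 + p ^ 2)⁻¹ := by
    intro p hp
    rcases le_total p 1 with hp1 | hp1
    · rw [hMval p hp hp1]
      have := gpp_small ψ hnonneg hr hr1 p
      have h2 : 0 ≤ B * 2 * (1 + p ^ 2)⁻¹ := by positivity
      linarith
    · have h1 := gpp_large ψ hnonneg hr D₁ D₂ hD1 hD2' hD2 p hp1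
      have h2 : Real.exp (-(r / 2) * ψ p) ≤ 1 :=
        Real.exp_le_one_iff.2 (by nlinarith [mul_nonneg hr.le (hnonneg p)])
      have h3 : |gpp ψ r p| ≤ B * 2 * (1 + p ^ 2)⁻¹ := by
        rw [← div_eq_mul_inv, le_div_iff₀ (by positivity)]
        have h4 : B * Real.exp (-(r / 2) * ψ p) ≤ B := mul_le_of_le_one_right hBp h2
        have h5 : 1 + p ^ 2 ≤ 2 * p ^ 2 := by nlinarith
        calc _ ≤ |gpp ψ r p| * (2 * p ^ 2) := by gcongr
          _ = 2 * (p ^ 2 * |gpp ψ r p|) := by ring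
          _ ≤ B * 2 := by linarith
      linarith [hMnn p]
  have hkint : IntegrableOn (gpp ψ r) (Ioi 0) := by
    refine Integrable.mono' hJint hkmeas.aestronglyMeasurable ?_
    filter_upwards [ae_restrict_mem measurableSet_Ioi] with p hp
    exact hkJ p hp
  have hlimψ : Tendsto ψ atTop atTop :=
    tendsto_atTop_mono' atTop (eventually_atTop.2 ⟨X, hlin⟩)
      (tendsto_id.const_mul_atTop hc₁)
  have hlimg : Tendsto g atTop (𝓝 0) := by
    refine Real.tendsto_exp_atBot.comp ?_
    exact hlimψ.const_mul_atTop_of_neg (by linarith)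
  have hlimg' : Tendsto (fun p => deriv ψ p * Real.exp (-r * ψ p)) atTop (𝓝 0) := by
    have hz : Tendsto (fun p : ℝ => (D₁ * 2 / r) * p⁻¹) atTop (𝓝 0) := by
      simpa using tendsto_inv_atTop_zero.const_mul (D₁ * 2 / r)
    refine squeeze_zero_norm' ?_ hz
    filter_upwards [eventually_ge_atTop 1] with p hp
    have ht := mul_nonneg hr.le (hnonneg p)
    have a1 := hD1 p hp
    have a2 := one_exp_half ht
    have a3 : Real.exp (-(r * ψ p) / 2) ≤ 1 := Real.exp_le_one_iff.2 (by linarith)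
    rw [Real.norm_eq_abs, abs_mul, abs_of_pos (Real.exp_pos _), ← div_eq_mul_inv,
      le_div_iff₀ (by linarith), le_div_iff₀ hr, show -r * ψ p = -(r * ψ p) by ring]
    calc _ = r * ((p * |deriv ψ p|) * Real.exp (-(r * ψ p))) := by ring
      _ ≤ r * ((D₁ * ψ p) * Real.exp (-(r * ψ p))) := by gcongr
      _ = D₁ * (r * ψ p * Real.exp (-(r * ψ p))) := by ring
      _ ≤ D₁ * 2 := by gcongr; linarith
  have hibp := ibp ψ r hdiff1 hdiff2 hd0 hdc hgint hkint hlimg hlimg'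
  set f : ℝ → ℝ := cosT g with hf
  set k : ℝ → ℝ := fun x => - cosT (gpp ψ r) x with hk
  have hfk : ∀ x, x ^ 2 * f x = k x := hibp
  have hpd : ∀ x, pdens ψ r x = (1 / Real.pi) * f x := fun x => rfl
  have hpi0 : 0 < 1 / Real.pi := by positivity
  have hpi : 1 / Real.pi ≤ 1 := by
    rw [div_le_one Real.pi_pos]; linarith [Real.pi_gt_three]
  -- the uniform constant
  set y := m / δ with hy
  have hmy : m ≤ y := by rw [hy, le_div_iff₀ hδ]; nlinarith
  have hy1 : 1 ≤ y := hm1.trans hmy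
  have hyb : 2 / b ≤ y := by
    calc 2 / b = (2 / c₁) / r := by rw [hbdef]; field_simp
      _ ≤ m / δ := by gcongr
  set A := K / δ ^ 3 with hA
  have hδ3 : 0 < δ ^ 3 := by positivity
  have hδ31 : δ ^ 3 ≤ 1 := pow_le_one₀ hδ.le hδ1.le
  have hAeq : A = 2 * E * y ^ 3 + (IM / δ ^ 3 + B * E * y ^ 3) := by
    rw [hA, hK, hy]; field_simp
  have hIMd : IM ≤ IM / δ ^ 3 := by rw [le_div_iff₀ hδ3]; exact mul_le_of_le_one_right hIMp hδ31
  have hb2 : 0 < b / 2 := by positivity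
  have hb2y : 1 / (b / 2) ≤ y := by
    rw [one_div_div]; exact hyb
  -- dominating functions
  set H₁ : ℝ → ℝ := fun p => 2 * E * y ^ 2 * Real.exp (-(b / 2) * p) with hH₁
  have hH₁i : IntegrableOn H₁ (Ioi 0) := (exp_int_s14 hb2).1.const_mul _
  have hy3 : y ≤ y ^ 3 := by nlinarith [mul_self_nonneg y, mul_self_nonneg (y - 1)]
  have hH₁b : ∫ p in Ioi (0:ℝ), H₁ p ≤ A := by
    rw [hH₁, integral_const_mul, (exp_int_s14 hb2).2, hAeq]
    have : 2 * E * y ^ 2 * (1 / (b / 2)) ≤ 2 * E * y ^ 2 * y := by gcongr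
    have h2 : 0 ≤ IM / δ ^ 3 + B * E * y ^ 3 := by positivity
    linarith
  have hH₁d : ∀ j ≤ 2, ∀ p, 0 < p → p ^ j * |g p| ≤ H₁ p := by
    intro j hj p hp
    rw [abs_of_pos (hgpos p)]
    have := pow_exp hb hy1 hyb hp j hj
    calc _ ≤ p ^ j * (E * Real.exp (-b * p)) := by gcongr; exact hgdom p hp
      _ = E * (p ^ j * Real.exp (-b * p)) := by ring
      _ ≤ E * (2 * y ^ 2 * Real.exp (-(b / 2) * p)) := by gcongr
      _ = _ := by rw [hH₁]; ring
  set H₂ : ℝ → ℝ := fun p => M p + B * E * Real.exp (-(b / 2) * p) with hH₂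
  have hH₂i : IntegrableOn H₂ (Ioi 0) := hMint.integrableOn.add ((exp_int_s14 hb2).1.const_mul _)
  have hH₂b : ∫ p in Ioi (0:ℝ), H₂ p ≤ A := by
    rw [hH₂, integral_add hMint.integrableOn ((exp_int_s14 hb2).1.const_mul _), integral_const_mul,
      (exp_int_s14 hb2).2, hAeq]
    have : B * E * (1 / (b / 2)) ≤ B * E * y ^ 3 := by gcongr; exact hb2y.trans hy3
    have h2 : 0 ≤ 2 * E * y ^ 3 := by positivity
    linarith
  have hH₂d : ∀ j ≤ 2, ∀ p, 0 < p → p ^ j * |gpp ψ r p| ≤ H₂ p := by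
    intro j hj p hp
    rcases le_total p 1 with hp1 | hp1
    · have h1 := gpp_small ψ hnonneg hr hr1 p
      have h2 : 0 ≤ B * E * Real.exp (-(b / 2) * p) := by positivity
      have h3 : p ^ j * |gpp ψ r p| ≤ |gpp ψ r p| :=
        mul_le_of_le_one_left (abs_nonneg _) (pow_le_one₀ hp.le hp1)
      simp only [hH₂]
      rw [hMval p hp hp1]
      linarith
    · have h1 := gpp_large ψ hnonneg hr D₁ D₂ hD1 hD2' hD2 p hp1
      have h2 := exp_dom hnonneg hX0.le hc₁.le (half_pos hr) (by linarith) hlin p hp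
      rw [show r / 2 * c₁ = b / 2 by rw [hbdef]; ring] at h2
      have h3 : p ^ j * |gpp ψ r p| ≤ p ^ 2 * |gpp ψ r p| := by gcongr
      have h4 := mul_le_mul_of_nonneg_left h2 hBp
      simp only [hH₂]
      have := hMnn p
      rw [mul_assoc]
      linarith
  have hA0 : 0 ≤ A := by positivity
  have f0 : ∀ x, |f x| ≤ A := fun x =>
    (cosT_bound g H₁ hH₁i (fun p hp => by simpa using hH₁d 0 (by norm_num) p hp) x).trans hH₁b
  have f1 : ∀ x t, 0 < t → |f (x + t) - f x| ≤ t * A := fun x t ht =>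
    (cosT_diff g H₁ hgint hH₁i (fun p hp => by simpa using hH₁d 1 (by norm_num) p hp) x t ht).trans
      (by gcongr)
  have f2 : ∀ x t, |2 * f x - f (x + t) - f (x - t)| ≤ t ^ 2 * A := fun x t =>
    (cosT_diff2 g H₁ hgint hH₁i (fun p hp => hH₁d 2 le_rfl p hp) x t).trans (by gcongr)
  have k0 : ∀ x, |k x| ≤ A := fun x => by
    rw [hk, abs_neg]
    exact (cosT_bound _ H₂ hH₂i (fun p hp => by simpa using hH₂d 0 (by norm_num) p hp) x).trans hH₂b
  have k1 : ∀ x t, 0 < t → |k (x + t) - k x| ≤ t * A := fun x t ht => by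
    have := cosT_diff _ H₂ hkint hH₂i
      (fun p hp => by simpa using hH₂d 1 (by norm_num) p hp) x t ht
    rw [hk, ← abs_neg]
    calc _ = |cosT (gpp ψ r) (x + t) - cosT (gpp ψ r) x| := by congr 1; ring
      _ ≤ _ := this
      _ ≤ _ := by gcongr
  have k2 : ∀ x t, |2 * k x - k (x + t) - k (x - t)| ≤ t ^ 2 * A := fun x t => by
    have := cosT_diff2 _ H₂ hkint hH₂i (fun p hp => hH₂d 2 le_rfl p hp) x t
    rw [hk, ← abs_neg]
    calc _ = |2 * cosT (gpp ψ r) x - cosT (gpp ψ r) (x + t) - cosT (gpp ψ r) (x - t)| := by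
          congr 1; ring
      _ ≤ _ := this
      _ ≤ _ := by gcongr
  have hCA : 43 * A ≤ (C₁ + J / c₂ + 43 * K) / δ ^ 3 := by
    rw [hA, ← mul_div_assoc]; gcongr; linarith
  refine ⟨?_, ?_, ?_⟩
  · -- the sup bound
    set S : Set ℝ := {l : ℝ | 0 < l ∧ 1 / δ ≤ ψ l} with hS
    set L := psiInv ψ (1 / δ) with hL
    have hLS : L = sInf S := rfl
    have hδ' : 1 ≤ 1 / δ := by rw [le_div_iff₀ hδ]; linarith
    have hne : S.Nonempty := by
      obtain ⟨p, hp1, hp2⟩ := ((hlimψ.eventually_ge_atTop (1 / δ)).and (eventually_gt_atTop 0)).exists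
      exact ⟨p, hp2, hp1⟩
    have hLc : c₂ ≤ L := by
      rw [hLS]
      refine le_csInf hne fun l hl => ?_
      rw [hc₂, Real.sqrt_le_iff]
      refine ⟨hl.1.le, ?_⟩
      rw [div_le_iff₀ hC0p]
      have := hC0 l
      have := hl.2
      linarith
    have hLp : 0 < L := hc₂p.trans_le hLc
    obtain ⟨l, ⟨hl0, hl1⟩, hl2⟩ := exists_lt_of_csInf_lt hne (show sInf S < 2 * L by
      rw [← hLS]; linarith)
    have hfL : |f x| ≤ C₁ * L := by
      rcases le_total X l with hXl | hXl
      · have hcl : 0 < c / l := by positivity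
        have hdom : ∀ p, 0 < p → |g p| ≤ Real.exp c * Real.exp (-(c / l) * p) := by
          intro p hp
          rw [abs_of_pos (hgpos p), ← Real.exp_add, Real.exp_le_exp]
          have e : c / l * p = c * (p / l) := by ring
          rcases le_total l p with hlp | hlp
          · have h1 := hgrow l p hXl hlp
            have h2 : c * (p / l) ≤ r * ψ p := by
              calc c * (p / l) = δ * (c * (p / l) * (1 / δ)) := by field_simp
                _ ≤ r * (c * (p / l) * ψ l) := by gcongr
                _ ≤ r * ψ p := by gcongr
            linarith
          · have h1 := mul_nonneg hr.le (hnonneg p)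
            have h2 : p / l ≤ 1 := by rw [div_le_one hl0]; exact hlp
            have h3 : c * (p / l) ≤ c := mul_le_of_le_one_right hc.le h2
            linarith
        have := cosT_bound g _ ((exp_int_s14 hcl).1.const_mul (Real.exp c)) hdom x
        rw [integral_const_mul, (exp_int_s14 hcl).2] at this
        have h5 : Real.exp c * (1 / (c / l)) = Real.exp c / c * l := by field_simp
        have h6 : Real.exp c / c * l ≤ Real.exp c / c * (2 * L) := by gcongr
        have h7 : 0 ≤ E / c₁ * (C₀ * X ^ 2) / c₂ * L := by positivity
        rw [hC₁]
        linarith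
      · have h1 : 1 / δ ≤ C₀ * X ^ 2 := hl1.trans ((hC0 l).trans (by gcongr))
        have := cosT_bound g _ ((exp_int_s14 hb).1.const_mul E)
          (fun p hp => by rw [abs_of_pos (hgpos p)]; exact hgdom p hp) x
        rw [integral_const_mul, (exp_int_s14 hb).2] at this
        have h2 : E * (1 / b) ≤ E / c₁ * (C₀ * X ^ 2) := by
          calc E * (1 / b) = E / c₁ * (1 / r) := by rw [hbdef]; field_simp
            _ ≤ E / c₁ * (1 / δ) := by gcongr
            _ ≤ _ := by gcongr
        have h3 : E / c₁ * (C₀ * X ^ 2) ≤ E / c₁ * (C₀ * X ^ 2) / c₂ * L := by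
          rw [div_mul_eq_mul_div (_ * _) c₂ L, le_div_iff₀ hc₂p]; gcongr
        have h4 : 0 ≤ 2 * (Real.exp c / c) * L := by positivity
        rw [hC₁]
        linarith
    have hxf : x ^ 2 * |f x| ≤ J / c₂ * L := by
      rw [← abs_of_nonneg (sq_nonneg x), ← abs_mul, hfk, hk, abs_neg]
      have := cosT_bound _ _ hJint hkJ x
      rw [hJeq] at this
      have h3 : J ≤ J / c₂ * L := by
        rw [div_mul_eq_mul_div, le_div_iff₀ hc₂p]; gcongr
      exact this.trans h3
    have hCL : C₁ * L ≤ (C₁ + J / c₂ + 43 * K) * L := by gcongr; linarith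
    have hCL2 : J / c₂ * L ≤ (C₁ + J / c₂ + 43 * K) * L := by gcongr; linarith
    have h9 : pdens ψ r x ≤ |f x| := by
      rw [hpd]
      calc _ ≤ 1 / Real.pi * |f x| := by gcongr; exact le_abs_self _
        _ ≤ |f x| := mul_le_of_le_one_left (abs_nonneg _) hpi
    exact h9.trans (le_div_max (hfL.trans hCL) (hxf.trans hCL2))
  · have := alg_diff A f k hfk f0 f1 k0 k1 x h hh (by linarith)
    rw [hpd, hpd, ← mul_sub, abs_mul, abs_of_pos hpi0]
    refine (mul_le_of_le_one_left (abs_nonneg _) hpi).trans (this.trans ?_)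
    gcongr
    linarith
  · have := alg_diff2 A f k hfk f0 f1 f2 k0 k1 k2 x h hh hh1
    rw [hpd, hpd, hpd, show 2 * (1 / Real.pi * f x) - 1 / Real.pi * f (x + h)
      - 1 / Real.pi * f (x - h) = 1 / Real.pi * (2 * f x - f (x + h) - f (x - h)) by ring,
      abs_mul, abs_of_pos hpi0]
    refine (mul_le_of_le_one_left (abs_nonneg _) hpi).trans (this.trans ?_)
    gcongr
end
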